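/- Let n > 1000 be an integer, let F_n be the n-th Fibonacci number, let α^(1) < α^(2) < α^(3) be the three real roots of f_n(X) = X·(X − F_n)·(X − 2^n) − 1, and let (x, y) be an integer solution of x·(x − F_n·y)·(x − 2^n·y) − y³ = ±1 with |y| ≥ 2, with β^(i) = x − α^(i)·y. Then the type of (x, y) is not 3 (i.e., |β^(3)| is not the minimum of |β^(1)|, |β^(2)|, |β^(3)|), and if the type is 1 or 2, then n < 1.03·10^{15}. -/

import Mathlib

section
open Finset

theorem P1_multi {ι : Type*} [Fintype ι] [DecidableEq ι] (g : ι → ι → ℝ) (l u s : ι → ℝ)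
    (M D : ℕ)
    (hV : ∀ m q : ι → ℕ, ∑ i, m i + D * ∑ i, q i < M →
      Matrix.det (Matrix.of fun i j => g i j * u j ^ m i * s j ^ q i) = 0)
    (p q : ℕ) (hpq : p + D * q < M) :
    ∑ π : Equiv.Perm ι, ((Equiv.Perm.sign π : ℤ) : ℝ) * (∏ i, g i (π i)) *
      (∑ i, l i * u (π i)) ^ p * (∑ i, l i * s (π i)) ^ q = 0 := by
  have h1 : ∀ π : Equiv.Perm ι, ((Equiv.Perm.sign π : ℤ) : ℝ) * (∏ i, g i (π i)) *
      (∑ i, l i * u (π i)) ^ p * (∑ i, l i * s (π i)) ^ q =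
      ∑ a ∈ piAntidiag univ p, ∑ b ∈ piAntidiag univ q,
        ((Nat.multinomial univ a : ℝ) * (Nat.multinomial univ b : ℝ) *
          (∏ i, l i ^ a i) * (∏ i, l i ^ b i)) *
        (((Equiv.Perm.sign π : ℤ) : ℝ) * ∏ i, (g i (π i) * u (π i) ^ a i * s (π i) ^ b i)) := by
    intro π
    rw [sum_pow_eq_sum_piAntidiag, sum_pow_eq_sum_piAntidiag, mul_assoc, sum_mul_sum, mul_sum]
    refine sum_congr rfl fun a _ => ?_
    rw [mul_sum]
    refine sum_congr rfl fun b _ => ?_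
    simp only [mul_pow, prod_mul_distrib]
    ring
  simp_rw [h1]
  rw [sum_comm]
  refine sum_eq_zero fun a ha => ?_
  rw [sum_comm]
  refine sum_eq_zero fun b hb => ?_
  rw [← mul_sum]
  have h2 := hV a b (by
    rw [mem_piAntidiag] at ha hb
    rw [ha.1, hb.1]; exact hpq)
  rw [← Matrix.det_transpose, Matrix.det_apply'] at h2
  simp only [Matrix.transpose_apply, Matrix.of_apply] at h2
  rw [h2, mul_zero]

theorem P1_mul (f g : ℕ → ℝ) (a b : ℝ) (ha : HasSum f a) (hb : HasSum g b) :
    HasSum (fun x : ℕ × ℕ => f x.1 * g x.2) (a * b) :=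
  HasSum.mul ha hb (summable_mul_of_summable_norm ha.summable.norm hb.summable.norm)

theorem P1_exp (a b : ℝ) : HasSum (fun x : ℕ × ℕ => a ^ x.1 / (x.1.factorial : ℝ) *
      (b ^ x.2 / (x.2.factorial : ℝ))) (Real.exp a * Real.exp b) := by
  have ha : HasSum (fun n : ℕ => a ^ n / (n.factorial : ℝ)) (Real.exp a) := by
    rw [Real.exp_eq_exp_ℝ]; exact NormedSpace.expSeries_div_hasSum_exp a
  have hb : HasSum (fun n : ℕ => b ^ n / (n.factorial : ℝ)) (Real.exp b) := by
    rw [Real.exp_eq_exp_ℝ]; exact NormedSpace.expSeries_div_hasSum_exp b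
  exact P1_mul _ _ _ _ ha hb

theorem P1_analytic {ι : Type*} [Fintype ι] [DecidableEq ι] (g : ι → ι → ℝ) (l u s : ι → ℝ)
    (M D : ℕ) (ε ρ G W V : ℝ) (hρ : 1 ≤ ρ) (hG0 : 0 ≤ G)
    (hV : ∀ m q : ι → ℕ, ∑ i, m i + D * ∑ i, q i < M →
      Matrix.det (Matrix.of fun i j => g i j * u j ^ m i * s j ^ q i) = 0)
    (hG : ∀ π : Equiv.Perm ι, |∏ i, g i (π i)| ≤ G)
    (hW : ∀ π : Equiv.Perm ι, |∑ i, l i * u (π i)| ≤ W)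
    (hS : ∀ π : Equiv.Perm ι, |∑ i, l i * s (π i)| ≤ V) :
    |Matrix.det (Matrix.of fun i j => g i j * Real.exp (l i * (u j + ε * s j)))| ≤
      (Fintype.card ι).factorial * G * (ρ ^ M)⁻¹ * Real.exp (ρ * W + ρ ^ D * |ε| * V) := by
  have hdet : HasSum (fun x : ℕ × ℕ => ∑ π : Equiv.Perm ι, (((Equiv.Perm.sign π : ℤ) : ℝ) *
    (∏ i, g i (π i))) * ((∑ i, l i * u (π i)) ^ x.1 / x.1.factorial *
      ((ε * ∑ i, l i * s (π i)) ^ x.2 / x.2.factorial)))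
      (Matrix.det (Matrix.of fun i j => g i j * Real.exp (l i * (u j + ε * s j)))) := by
    rw [← Matrix.det_transpose, Matrix.det_apply']
    refine hasSum_sum fun π _ => ?_
    have h := (P1_exp (∑ i, l i * u (π i)) (ε * ∑ i, l i * s (π i))).mul_left
      (((Equiv.Perm.sign π : ℤ) : ℝ) * (∏ i, g i (π i)))
    have e : (((Equiv.Perm.sign π : ℤ) : ℝ) * ∏ i, (Matrix.of fun i j => g i j *
        Real.exp (l i * (u j + ε * s j))).transpose (π i) i) = (((Equiv.Perm.sign π : ℤ) : ℝ) *
        ∏ i, g i (π i)) * (Real.exp (∑ i, l i * u (π i)) * Real.exp (ε * ∑ i, l i * s (π i))) := by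
      simp only [Matrix.transpose_apply, Matrix.of_apply, prod_mul_distrib]
      rw [← Real.exp_sum, ← Real.exp_add, mul_assoc]
      congr 3
      rw [mul_sum, ← sum_add_distrib]
      exact sum_congr rfl fun i _ => by ring
    rw [e]
    exact h
  have hW0 : 0 ≤ W := le_trans (abs_nonneg _) (hW 1)
  have hV0 : 0 ≤ V := le_trans (abs_nonneg _) (hS 1)
  have hρ0 : 0 < ρ := by linarith
  have hb : HasSum (fun x : ℕ × ℕ => ((Fintype.card ι).factorial * G * (ρ ^ M)⁻¹) *
      ((ρ * W) ^ x.1 / (x.1.factorial : ℝ) * ((ρ ^ D * |ε| * V) ^ x.2 / (x.2.factorial : ℝ))))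
      ((Fintype.card ι).factorial * G * (ρ ^ M)⁻¹ * Real.exp (ρ * W + ρ ^ D * |ε| * V)) := by
    rw [Real.exp_add]
    exact (P1_exp _ _).mul_left _
  rw [← Real.norm_eq_abs, ← hdet.tsum_eq]
  refine tsum_of_norm_bounded hb ?_
  rintro ⟨p, q⟩
  dsimp only
  by_cases hpq : p + D * q < M
  · have h0 := P1_multi g l u s M D hV p q hpq
    have : ∑ π : Equiv.Perm ι, (((Equiv.Perm.sign π : ℤ) : ℝ) *
      (∏ i, g i (π i))) * ((∑ i, l i * u (π i)) ^ p / p.factorial *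
      ((ε * ∑ i, l i * s (π i)) ^ q / q.factorial)) = 0 := by
      have h1 := congrArg (fun z => z * (ε ^ q / (p.factorial * q.factorial))) h0
      simp only [zero_mul, sum_mul] at h1
      rw [← h1]
      refine sum_congr rfl fun π _ => ?_
      have : (p.factorial : ℝ) ≠ 0 := by positivity
      have : (q.factorial : ℝ) ≠ 0 := by positivity
      rw [mul_pow]; field_simp
    rw [this, norm_zero]
    positivity
  · push Not at hpq
    refine (norm_sum_le _ _).trans ?_
    have hterm : ∀ π ∈ (univ : Finset (Equiv.Perm ι)), ‖(((Equiv.Perm.sign π : ℤ) : ℝ) *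
      (∏ i, g i (π i))) * ((∑ i, l i * u (π i)) ^ p / p.factorial *
      ((ε * ∑ i, l i * s (π i)) ^ q / q.factorial))‖ ≤
        G * (W ^ p / p.factorial * ((|ε| * V) ^ q / q.factorial)) := by
      intro π _
      have hs : |((Equiv.Perm.sign π : ℤ) : ℝ)| = 1 := by
        rcases Int.units_eq_one_or (Equiv.Perm.sign π) with h | h <;> simp [h]
      simp only [Real.norm_eq_abs, abs_mul, hs, one_mul, abs_div, abs_pow, Nat.abs_cast]
      gcongr
      · exact hG π
      · exact hW π
      · exact hS π
    refine (sum_le_card_nsmul _ _ _ hterm).trans ?_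
    rw [card_univ, Fintype.card_perm, nsmul_eq_mul]
    have h2 : W ^ p / p.factorial * ((|ε| * V) ^ q / q.factorial) * ρ ^ M ≤
        (ρ * W) ^ p / p.factorial * ((ρ ^ D * |ε| * V) ^ q / q.factorial) := by
      have : (ρ * W) ^ p / p.factorial * ((ρ ^ D * |ε| * V) ^ q / q.factorial) =
        W ^ p / p.factorial * ((|ε| * V) ^ q / q.factorial) * ρ ^ (p + D * q) := by
        rw [pow_add, pow_mul]; simp only [mul_pow]; ring
      rw [this]
      gcongr
    have h3 : W ^ p / p.factorial * ((|ε| * V) ^ q / q.factorial) ≤ (ρ ^ M)⁻¹ *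
        ((ρ * W) ^ p / p.factorial * ((ρ ^ D * |ε| * V) ^ q / q.factorial)) := by
      rw [inv_mul_eq_div, le_div_iff₀ (by positivity)]; exact h2
    calc _ ≤ ((Fintype.card ι).factorial : ℝ) * (G * ((ρ ^ M)⁻¹ *
        ((ρ * W) ^ p / p.factorial * ((ρ ^ D * |ε| * V) ^ q / q.factorial)))) := by gcongr
      _ = _ := by ring

end

section
open Finset

theorem P1_count {ι : Type*} [Fintype ι] [DecidableEq ι] (d : ι → ℕ) (κ q : ℕ)
    (hc : Fintype.card ι = κ * q) (hd : ∀ e < q, #{i | d i = e} ≤ κ) :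
    κ * (q * (q - 1) / 2) ≤ ∑ i, d i := by
  have h1 : ∀ e < q, #{i | d i ≤ e} ≤ κ * (e + 1) := by
    intro e he
    have : ({i | d i ≤ e} : Finset ι) = (range (e+1)).biUnion fun e' => {i | d i = e'} := by
      ext i; simp [Nat.lt_succ_iff]
    rw [this]
    refine card_biUnion_le.trans ?_
    refine (sum_le_card_nsmul _ _ κ fun e' he' => hd e' ?_).trans ?_
    · simp at he'; omega
    · simp [mul_comm]
  have h2 : ∀ i, #{e ∈ range q | e < d i} ≤ d i := by
    intro i
    calc _ ≤ #(range (d i)) := card_le_card (fun e => by simp)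
      _ = d i := card_range _
  have h3 : ∑ i, #{e ∈ range q | e < d i} = ∑ e ∈ range q, #{i | e < d i} := by
    simp only [card_filter]; rw [sum_comm]
  have h4 : ∀ e ∈ range q, κ * (q - 1 - e) ≤ #{i | e < d i} := by
    intro e he
    have he' := mem_range.1 he
    have := h1 e he'
    have h5 : #{i | d i ≤ e} + #{i | e < d i} = Fintype.card ι := by
      have := card_filter_add_card_filter_not (s := (univ : Finset ι)) (fun i => d i ≤ e)
      simpa using this
    have h6 : κ * q = κ * (e+1) + κ * (q - 1 - e) := by
      rw [← mul_add]; congr 1; omega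
    omega
  calc κ * (q * (q - 1) / 2) = ∑ e ∈ range q, κ * (q - 1 - e) := by
        rw [← mul_sum, sum_range_reflect (fun x => x) q, sum_range_id]
    _ ≤ _ := sum_le_sum h4
    _ = _ := h3.symm
    _ ≤ _ := sum_le_sum fun i _ => h2 i

theorem P1_dep {ι : Type*} [Fintype ι] [DecidableEq ι] (f : ι → ι → ℝ) (κ : ℕ)
    (T : Finset ι) (hT : κ < #T) (b : Fin κ → ι → ℝ) (c : ι → Fin κ → ℝ)
    (h : ∀ i ∈ T, ∀ j, f i j = ∑ a, c i a * b a j) : Matrix.det (Matrix.of f) = 0 := by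
  have h1 : ¬ LinearIndependent ℝ (fun i : T => c i) := by
    intro h
    have := h.fintype_card_le_finrank
    simp at this; omega
  rw [Fintype.not_linearIndependent_iff] at h1
  obtain ⟨w, hw, i0, hi0⟩ := h1
  rw [← Matrix.exists_vecMul_eq_zero_iff]
  refine ⟨fun i => if hi : i ∈ T then w ⟨i, hi⟩ else 0, ?_, ?_⟩
  · intro h0
    have := congrFun h0 i0
    simp at this
    exact hi0 this
  · ext j
    simp only [Matrix.vecMul, dotProduct, Matrix.of_apply, Pi.zero_apply]
    have : ∀ i, (if hi : i ∈ T then w ⟨i, hi⟩ else 0) * f i j =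
        if hi : i ∈ T then w ⟨i, hi⟩ * f i j else 0 := by intro i; split_ifs <;> simp
    simp_rw [this]
    rw [← sum_subset (subset_univ T) (fun i _ hi => by simp [hi]), ← sum_attach]
    simp only [coe_mem, dite_true]
    have h2 : ∀ i ∈ T.attach, w ⟨i.1, i.2⟩ * f i j = ∑ a, (w i * c i a) * b a j := by
      intro i _
      rw [h i i.2 j, mul_sum]
      exact sum_congr rfl fun a _ => by simp only [mul_assoc]
    rw [sum_congr rfl h2, sum_comm]
    refine sum_eq_zero fun a _ => ?_
    rw [← sum_mul]
    have := congrFun hw a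
    simp only [Finset.sum_apply, Pi.smul_apply, smul_eq_mul, Pi.zero_apply] at this
    rw [← Finset.univ_eq_attach, this, zero_mul]

theorem P1_order {ι : Type*} [Fintype ι] [DecidableEq ι] (g : ι → ι → ℝ) (u s : ι → ℝ)
    (κ q M : ℕ) (dg : ι → ℕ) (b : ℕ → Fin κ → ι → ℝ) (hc : Fintype.card ι = κ * q)
    (hb : ∀ i m, ∃ c : Fin κ → ℝ, ∀ j, g i j * u j ^ m = ∑ a, c a * b (dg i + m) a j)
    (hM : M + ∑ i, dg i ≤ κ * (q * (q - 1) / 2)) :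
    ∀ m r : ι → ℕ, ∑ i, m i + q * ∑ i, r i < M →
      Matrix.det (Matrix.of fun i j => g i j * u j ^ m i * s j ^ r i) = 0 := by
  intro m r hmr
  by_contra hne
  have hcnt : ∀ e < q, #{i | (if r i = 0 then dg i + m i else q) = e} ≤ κ := by
    intro e he
    by_contra hlt
    push Not at hlt
    apply hne
    choose c hc' using fun i => hb i (m i)
    refine P1_dep _ κ _ hlt (b e) c ?_
    intro i hi j
    simp only [mem_filter, mem_univ, true_and] at hi
    split_ifs at hi with h0
    · rw [h0, pow_zero, mul_one, hc' i j, hi]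
    · omega
  have h1 := P1_count (fun i => if r i = 0 then dg i + m i else q) κ q hc hcnt
  have h2 : ∑ i, (if r i = 0 then dg i + m i else q) ≤ ∑ i, (dg i + m i + q * r i) := by
    refine sum_le_sum fun i _ => ?_
    split_ifs with h0
    · omega
    · have : 1 ≤ r i := by omega
      nlinarith
  rw [sum_add_distrib, sum_add_distrib, ← mul_sum] at h2
  omega

end

section
open Finset Polynomial

theorem P2_coeff_prod {A ι : Type*} [CommRing A] (s : Finset ι) (f : ι → A[X]) (d : ι → ℕ)
    (h : ∀ i ∈ s, (f i).natDegree ≤ d i) :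
    (∏ i ∈ s, f i).natDegree ≤ ∑ i ∈ s, d i ∧
    (∏ i ∈ s, f i).coeff (∑ i ∈ s, d i) = ∏ i ∈ s, (f i).coeff (d i) := by
  classical
  induction s using Finset.induction_on with
  | empty => simp
  | insert a s ha ih =>
    have h1 := ih fun i hi => h i (mem_insert_of_mem hi)
    have h2 := h a (mem_insert_self _ _)
    rw [prod_insert ha, sum_insert ha, prod_insert ha]
    refine ⟨natDegree_mul_le.trans (add_le_add h2 h1.1), ?_⟩
    rw [coeff_mul_add_eq_of_natDegree_le h2 h1.1, h1.2]

theorem P2_coeff_det {A ι : Type*} [CommRing A] [Fintype ι] [DecidableEq ι]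
    (E : Matrix ι ι A[X]) (d : ι → ℕ) (h : ∀ a l, (E a l).natDegree ≤ d l) :
    E.det.natDegree ≤ ∑ i, d i ∧
    E.det.coeff (∑ i, d i) = Matrix.det (Matrix.of fun a l => (E a l).coeff (d l)) := by
  rw [Matrix.det_apply, Matrix.det_apply]
  constructor
  · refine natDegree_sum_le_of_forall_le _ _ fun π _ => ?_
    refine (natDegree_smul_le _ _).trans ?_
    exact (P2_coeff_prod univ (fun i => E (π i) i) d fun i _ => h _ _).1
  · rw [finsetSum_coeff]
    refine sum_congr rfl fun π _ => ?_
    rw [Polynomial.coeff_smul, (P2_coeff_prod univ (fun i => E (π i) i) d fun i _ => h _ _).2]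
    rfl

/-- entries of the elimination matrix -/
noncomputable def P2E {A σ : Type*} [CommRing A] [Fintype σ] {L : ℕ} (p : Fin L → A[X])
    (z η : σ → A) (C' : Fin L → σ → A) (a l : Fin L) : A[X] :=
  ∑ s, C (C' a s * η s ^ (l : ℕ)) * (p l).comp (X + C (z s))

open Classical in
noncomputable def P2Q {A σ : Type*} [CommRing A] [Fintype σ] {L : ℕ} (p : Fin L → A[X])
    (z η : σ → A) (C' : Fin L → σ → A) : A[X] :=
  Matrix.det (Matrix.of fun a l : {l : Fin L // p l ≠ 0} => P2E p z η C' a l)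

theorem P2_comp {A : Type*} [CommRing A] [IsDomain A] (p : A[X]) (z : A) :
    (p.comp (X + C z)).natDegree = p.natDegree ∧
    (p.comp (X + C z)).coeff p.natDegree = p.leadingCoeff := by
  have h1 : (p.comp (X + C z)).natDegree = p.natDegree := by
    rw [natDegree_comp, natDegree_X_add_C, mul_one]
  refine ⟨h1, ?_⟩
  have := leadingCoeff_comp (p := p) (q := X + C z) (by rw [natDegree_X_add_C]; exact one_ne_zero)
  rw [leadingCoeff_X_add_C, one_pow, mul_one, leadingCoeff, h1] at this
  exact this

theorem P2_main {A σ : Type*} [CommRing A] [IsDomain A] [Fintype σ] {L : ℕ} (p : Fin L → A[X])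
    (z η : σ → A) (C' : Fin L → σ → A)
    (hC : ∀ a l : Fin L, ∑ s, C' a s * η s ^ (l : ℕ) = if a = l then 1 else 0) :
    P2Q p z η C' ≠ 0 ∧ (P2Q p z η C').natDegree ≤ ∑ l, (p l).natDegree := by
  classical
  have hdeg : ∀ a l : {l : Fin L // p l ≠ 0}, (P2E p z η C' a l).natDegree ≤ (p l).natDegree := by
    intro a l
    refine natDegree_sum_le_of_forall_le _ _ fun s _ => ?_
    refine (natDegree_C_mul_le _ _).trans ?_
    rw [(P2_comp _ _).1]
  have hco : ∀ a l : {l : Fin L // p l ≠ 0}, (P2E p z η C' a l).coeff (p l).natDegree =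
      if a = l then (p l).leadingCoeff else 0 := by
    intro a l
    rw [P2E, finsetSum_coeff]
    simp_rw [coeff_C_mul, (P2_comp (p l) _).2]
    rw [← sum_mul, hC]
    by_cases h : a = l
    · simp [h]
    · simp [h, Subtype.coe_injective.eq_iff]
  have hd := P2_coeff_det (Matrix.of fun a l : {l : Fin L // p l ≠ 0} => P2E p z η C' a l)
    (fun l => (p l).natDegree) hdeg
  have e : P2Q p z η C' =
    (Matrix.of fun a l : {l : Fin L // p l ≠ 0} => P2E p z η C' a l).det := by
    unfold P2Q; congr!
  rw [e]
  constructor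
  · intro h0
    rw [h0] at hd
    have h2 := hd.2
    simp only [Matrix.of_apply, hco] at h2
    have h3 : (Matrix.of fun a l : {l : Fin L // p l ≠ 0} => if a = l then (p l).leadingCoeff else 0)
      = Matrix.diagonal fun l : {l : Fin L // p l ≠ 0} => (p l).leadingCoeff := by
      ext a l
      by_cases h : a = l
      · subst h; simp
      · simp [h]
    rw [h3, Matrix.det_diagonal, coeff_zero] at h2
    have := prod_ne_zero_iff.2 (fun (l : {l : Fin L // p l ≠ 0}) (_ : l ∈ univ) =>
      leadingCoeff_ne_zero.2 l.2)
    exact this h2.symm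
  · refine hd.1.trans ?_
    rw [← Finset.sum_subtype (univ.filter fun l => p l ≠ 0) (p := fun l => p l ≠ 0) (by simp)
      (fun l => (p l).natDegree)]
    exact sum_le_sum_of_subset (filter_subset _ _)

theorem P2_vanish {A σ : Type*} [CommRing A] [Fintype σ] {L : ℕ} (p : Fin L → A[X])
    (hp : ∃ l, p l ≠ 0)
    (z η : σ → A) (C' : Fin L → σ → A) {B : Type*} [CommRing B] [IsDomain B] (ψ : A[X] →+* B)
    (y : B) (hy : y ≠ 0)
    (h : ∀ s, ∑ l : Fin L, ψ ((p l).comp (X + C (z s))) * (y * ψ (C (η s))) ^ (l : ℕ) = 0) :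
    ψ (P2Q p z η C') = 0 := by
  classical
  unfold P2Q
  rw [RingHom.map_det, ← Matrix.exists_mulVec_eq_zero_iff]
  obtain ⟨l0, hl0⟩ := hp
  refine ⟨fun l => y ^ (l : ℕ), ?_, ?_⟩
  · intro h0
    have := congrFun h0 ⟨l0, hl0⟩
    exact pow_ne_zero _ hy this
  · ext a
    simp only [Matrix.mulVec, dotProduct, RingHom.mapMatrix_apply, Matrix.map_apply,
      Matrix.of_apply, Pi.zero_apply, P2E, map_sum, map_mul, map_pow]
    have h2 : ∀ s, ∑ l : {l : Fin L // p l ≠ 0}, ψ ((p l).comp (X + C (z s))) *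
        (y * ψ (C (η s))) ^ (l : ℕ) = 0 := by
      intro s
      rw [← h s, ← Finset.sum_filter_add_sum_filter_not univ (fun l => p l ≠ 0),
        Finset.sum_subtype (univ.filter fun l => p l ≠ 0) (p := fun l => p l ≠ 0) (by simp),
        left_eq_add]
      refine sum_eq_zero fun l hl => ?_
      simp at hl
      simp [hl]
    simp_rw [sum_mul]
    rw [sum_comm]
    refine sum_eq_zero fun s _ => ?_
    have h3 := congrArg (fun t => ψ (C (C' a s)) * t) (h2 s)
    simp only [mul_zero, mul_sum] at h3
    rw [← h3]
    refine sum_congr rfl fun l _ => ?_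
    rw [mul_pow]; ring

theorem P2_vander {L : ℕ} {F A : Type*} [Field F] [CommRing A] (i : F →+* A)
    (η : Fin L → F) (hη : Function.Injective η) :
    ∃ C' : Fin L → Fin L → A, ∀ a l : Fin L, ∑ s, C' a s * i (η s) ^ (l : ℕ) =
      if a = l then 1 else 0 := by
  have hdet : IsUnit (Matrix.vandermonde η).det := by
    rw [isUnit_iff_ne_zero]; exact Matrix.det_vandermonde_ne_zero_iff.2 hη
  refine ⟨fun a s => i ((Matrix.vandermonde η)⁻¹ a s), fun a l => ?_⟩
  have := Matrix.nonsing_inv_mul _ hdet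
  have h2 := congrArg i (congrFun (congrFun this a) l)
  simp only [Matrix.mul_apply, Matrix.vandermonde_apply, map_sum, map_mul, map_pow,
    Matrix.one_apply] at h2
  rw [h2]; split_ifs <;> simp

end

section
open Finset

theorem L_liouville {K : Type*} [Field K] [NumberField K] (σ0 : K →+* ℂ) (z : K)
    (hz : IsIntegral ℤ z) (hz0 : z ≠ 0) (H : ℝ) (hH : 1 ≤ H) (hb : ∀ σ : K →+* ℂ, ‖σ z‖ ≤ H)
    (d : ℕ) (hd : Module.finrank ℚ K ≤ d + 1) : 1 ≤ ‖σ0 z‖ * H ^ d := by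
  have h1 : (1:ℝ) ≤ ‖algebraMap ℚ ℂ (Algebra.norm ℚ z)‖ := by
    have hi : IsIntegral ℤ (Algebra.norm ℚ z) := Algebra.isIntegral_norm ℚ hz
    obtain ⟨k, hk⟩ := IsIntegrallyClosed.isIntegral_iff.1 hi
    have hk0 : k ≠ 0 := by
      rintro rfl
      apply hz0
      rw [map_zero] at hk
      exact Algebra.norm_eq_zero_iff.1 hk.symm
    rw [← hk]
    simp only [algebraMap_int_eq, eq_intCast, map_intCast, Complex.norm_intCast]
    exact_mod_cast Int.one_le_abs hk0
  rw [Algebra.norm_eq_prod_embeddings, norm_prod] at h1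
  classical
  have e0 : ∀ σ : K →ₐ[ℚ] ℂ, ‖σ z‖ ≤ H := fun σ => hb σ.toRingHom
  rw [← mul_prod_erase univ _ (mem_univ (RingHom.toRatAlgHom σ0))] at h1
  refine h1.trans ?_
  have : (RingHom.toRatAlgHom σ0) z = σ0 z := rfl
  rw [this]
  gcongr
  refine (prod_le_prod (fun σ _ => norm_nonneg _) fun σ _ => e0 σ).trans ?_
  rw [prod_const]
  refine pow_le_pow_right₀ hH ?_
  rw [card_erase_of_mem (mem_univ _), card_univ, AlgHom.card]
  omega

theorem L_columns {ι J F : Type*} [Fintype ι] [DecidableEq ι] [Field F] (f : ι → J → F)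
    (h : ∀ c : ι → F, (∀ j, ∑ i, c i * f i j = 0) → c = 0) :
    ∃ φ : ι → J, Matrix.det (Matrix.of fun i j => f i (φ j)) ≠ 0 := by
  have hs : Submodule.span F (Set.range fun j => (fun i => f i j)) = ⊤ := by
    by_contra hne
    obtain ⟨g, hg0, hg⟩ := Submodule.exists_le_ker_of_lt_top _ (lt_top_iff_ne_top.2 hne)
    apply hg0
    have hc := h (fun i => g (Pi.single i 1)) (fun j => by
      have := hg (Submodule.subset_span ⟨j, rfl⟩)
      rw [LinearMap.mem_ker, LinearMap.pi_apply_eq_sum_univ] at this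
      rw [← this]
      refine sum_congr rfl fun i _ => ?_
      rw [smul_eq_mul, mul_comm]; congr 2; ext k; simp [Pi.single_apply, eq_comm])
    refine LinearMap.pi_ext' fun i => LinearMap.ext_ring ?_
    simpa using congrFun hc i
  obtain ⟨b, hb1, hb2, hb3⟩ := exists_linearIndependent F (Set.range fun j => (fun i => f i j))
  rw [hs] at hb2
  let B := Module.Basis.mk hb3 (by rw [Subtype.range_coe]; exact hb2.ge)
  let e : ι ≃ b := (Pi.basisFun F ι).indexEquiv B
  have hch : ∀ i, ∃ j, (fun i => f i j) = (e i : ι → F) := fun i => hb1 (e i).2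
  choose φ hφ using hch
  refine ⟨φ, ?_⟩
  have hli : LinearIndependent F (fun i => (Matrix.of fun i j => f j (φ i)) i) := by
    have : (fun i => (Matrix.of fun i j => f j (φ i)) i) = (fun i => ((e i : b) : ι → F)) := by
      ext i k
      exact congrFun (hφ i) k
    rw [this]
    exact hb3.comp e e.injective
  rw [← Matrix.det_transpose]
  have := Matrix.linearIndependent_rows_iff_isUnit.1 hli
  rw [Matrix.isUnit_iff_isUnit_det] at this
  exact this.ne_zero

end

section
open Finset Polynomial

theorem P3_zero (G1 G2 : ℝ) (h1 : 0 < G1) (h1' : G1 ≠ 1) (h2 : 0 < G2) (K L R' S m : ℕ)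
    (hm : R' ≤ m) (hRS : L * (K - 1) < R' * S) (c : Fin K × Fin L → ℝ)
    (hc : ∀ j : Fin (R' + L) × Fin S, ∑ i, c i * (((j.1 : ℝ) - m * (j.2 : ℝ)) ^ (i.1 : ℕ) *
      (G1 ^ (j.1 : ℕ) * G2 ^ (j.2 : ℕ)) ^ (i.2 : ℕ)) = 0) : c = 0 := by
  by_contra hne
  set p : Fin L → ℝ[X] := fun l => ∑ k : Fin K, C (c (k, l)) * X ^ (k : ℕ) with hp
  have hcoef : ∀ l (k : Fin K), (p l).coeff k = c (k, l) := by
    intro l k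
    simp only [hp, finsetSum_coeff, coeff_C_mul, coeff_X_pow]
    rw [Finset.sum_eq_single k]
    · simp
    · intro b _ hb
      have : (k : ℕ) ≠ b := fun h => hb (Fin.ext h.symm)
      simp [this]
    · simp
  have hpne : ∃ l, p l ≠ 0 := by
    by_contra hall
    push Not at hall
    apply hne
    ext ⟨k, l⟩
    rw [← hcoef l k, hall l]; simp
  have hdeg : ∀ l, (p l).natDegree ≤ K - 1 := by
    intro l
    refine natDegree_sum_le_of_forall_le _ _ fun k _ => ?_
    refine (natDegree_C_mul_X_pow_le _ _).trans ?_
    omega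
  have hη : Function.Injective (fun s : Fin L => G1 ^ (s : ℕ)) := by
    intro a b hab
    exact Fin.ext (pow_right_injective₀ h1 h1' hab)
  obtain ⟨C', hC'⟩ := P2_vander (RingHom.id ℝ) (fun s : Fin L => G1 ^ (s : ℕ)) hη
  obtain ⟨hQ0, hQd⟩ := P2_main p (fun s : Fin L => (s : ℝ)) (fun s : Fin L => G1 ^ (s : ℕ)) C' hC'
  have hQd' : (P2Q p (fun s : Fin L => (s : ℝ)) (fun s : Fin L => G1 ^ (s : ℕ)) C').natDegree ≤
      L * (K - 1) := by
    refine hQd.trans ?_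
    refine (sum_le_card_nsmul _ _ _ fun l _ => hdeg l).trans ?_
    simp
  apply hQ0
  refine Polynomial.eq_zero_of_natDegree_lt_card_of_eval_eq_zero _
    (f := fun j : Fin R' × Fin S => ((j.1 : ℝ) - m * (j.2 : ℝ))) ?_ ?_ ?_
  · rintro ⟨r, s⟩ ⟨r', s'⟩ h
    have h' : ((r : ℕ) : ℤ) - m * ((s : ℕ) : ℤ) = ((r' : ℕ) : ℤ) - m * ((s' : ℕ) : ℤ) := by
      have : ((r : ℕ) : ℝ) - m * ((s : ℕ) : ℝ) = ((r' : ℕ) : ℝ) - m * ((s' : ℕ) : ℝ) := h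
      exact_mod_cast this
    have hr := r.2
    have hr' := r'.2
    have hs : (s : ℕ) = s' := by
      rcases lt_trichotomy (s : ℕ) s' with h | h | h
      · nlinarith
      · exact h
      · nlinarith
    rw [hs] at h'
    have : (r : ℕ) = r' := by omega
    exact Prod.ext (Fin.ext this) (Fin.ext hs)
  · rintro ⟨r, s⟩
    refine P2_vanish p hpne _ _ C' (evalRingHom ((r : ℝ) - m * (s : ℝ)))
      (G1 ^ (r : ℕ) * G2 ^ (s : ℕ)) (by positivity) ?_
    intro t
    have := hc (⟨r + t, by omega⟩, s)
    rw [← this, Fintype.sum_prod_type_right]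
    refine sum_congr rfl fun l _ => ?_
    simp only [hp, coe_evalRingHom, eval_comp, eval_add, eval_X, eval_C, eval_finset_sum,
      eval_mul, eval_pow, sum_mul]
    refine sum_congr rfl fun k _ => ?_
    push_cast
    rw [pow_add]
    ring
  · simp only [Fintype.card_prod, Fintype.card_fin]
    omega

end

section
open Finset

theorem L_detbound {ι : Type*} [Fintype ι] [DecidableEq ι] (A : Matrix ι ι ℂ) (b : ι → ℝ)
    (h : ∀ i j, ‖A i j‖ ≤ b i) : ‖A.det‖ ≤ (Fintype.card ι).factorial * ∏ i, b i := by
  rw [← Matrix.det_transpose, Matrix.det_apply']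
  refine (norm_sum_le _ _).trans ?_
  refine (sum_le_card_nsmul _ _ (∏ i, b i) ?_).trans ?_
  · intro π _
    have hs : ‖((Equiv.Perm.sign π : ℤ) : ℂ)‖ = 1 := by
      rcases Int.units_eq_one_or (Equiv.Perm.sign π) with h | h <;> simp [h]
    rw [norm_mul, hs, one_mul, norm_prod]
    exact prod_le_prod (fun i _ => norm_nonneg _) fun i _ => h _ _
  · rw [card_univ, Fintype.card_perm, nsmul_eq_mul]

theorem P3_sums (K L : ℕ) : (∑ i : Fin K × Fin L, (i.1 : ℕ)) = L * (K * (K - 1) / 2) ∧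
    (∑ i : Fin K × Fin L, (i.2 : ℕ)) = K * (L * (L - 1) / 2) := by
  constructor
  · rw [Fintype.sum_prod_type_right]
    simp only [Fin.sum_univ_eq_sum_range (fun i => i), sum_range_id, sum_const, card_univ,
      Fintype.card_fin, smul_eq_mul]
  · rw [Fintype.sum_prod_type]
    simp only [Fin.sum_univ_eq_sum_range (fun i => i), sum_range_id, sum_const, card_univ,
      Fintype.card_fin, smul_eq_mul]

set_option maxHeartbeats 2000000 in
theorem P3_twolog {F : Type*} [Field F] [NumberField F] (hdeg : Module.finrank ℚ F ≤ 6)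
    (σ0 : F →+* ℝ) (g ν δ : F) (hgi : IsIntegral ℤ g) (hνi : IsIntegral ℤ ν)
    (hδi : IsIntegral ℤ δ) (hg : 0 < σ0 g) (hg1 : σ0 g ≠ 1) (hν : 0 < σ0 ν) (hδ : 0 < σ0 δ)
    (η1 η2 : ℝ) (hη1 : 0 ≤ η1) (hη2 : 0 ≤ η2)
    (hσg : ∀ σ : F →+* ℂ, ‖σ g‖ ≤ Real.exp η1) (hσν : ∀ σ : F →+* ℂ, ‖σ ν‖ ≤ Real.exp η2)
    (hσδ : ∀ σ : F →+* ℂ, ‖σ δ‖ ≤ Real.exp η2)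
    (hlg : |Real.log (σ0 g)| ≤ η1) (hlν : |Real.log (σ0 ν / σ0 δ)| ≤ 2 * η2)
    (K L R' S m : ℕ) (Xm : ℝ) (hXm : 1 ≤ Xm) (hX : (R' + L : ℝ) + m * S ≤ Xm) (hK : 1 ≤ K)
    (hL : 1 ≤ L)
    (hm : R' ≤ m) (hRS : L * (K - 1) < R' * S)
    (hΛ : |m * Real.log (σ0 g) + Real.log (σ0 ν / σ0 δ)| *
      (Real.exp (K * L) * ((K * (L * (L - 1) / 2) : ℕ) * S)) ≤ 1)
    (hnum : 6 * (K * L * Real.log (K * L)) + 6 * (L * (K * (K - 1) / 2) : ℕ) * Real.log Xm +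
      (K * (L * (L - 1) / 2) : ℕ) * (8 * ((R' + L) * η1) + 12 * (S * η2)) + 5 +
       (L * (K * (K - 1) / 2) : ℕ) ≤ (K * L * (K * L - 1) / 2 : ℕ)) : False := by
  set G1 := σ0 g with hG1
  set G2 := σ0 ν / σ0 δ with hG2
  have hG2p : 0 < G2 := div_pos hν hδ
  set ω1 := Real.log G1 with hω1
  set ω2 := Real.log G2 with hω2
  set Λ := m * ω1 + ω2 with hΛdef
  set Sk := L * (K * (K - 1) / 2) with hSk
  set Sl := K * (L * (L - 1) / 2) with hSl
  set R := R' + L with hR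
  obtain ⟨hsk, hsl⟩ := P3_sums K L
  rw [← hSk] at hsk
  rw [← hSl] at hsl
  obtain ⟨φ, hφ⟩ := L_columns (fun (i : Fin K × Fin L) (j : Fin (R' + L) × Fin S) =>
    ((j.1 : ℝ) - m * (j.2 : ℝ)) ^ (i.1 : ℕ) * (G1 ^ (j.1 : ℕ) * G2 ^ (j.2 : ℕ)) ^ (i.2 : ℕ))
    (P3_zero G1 G2 hg hg1 hG2p K L R' S m hm hRS)
  -- bounds on points
  have hxb : ∀ j, |((φ j).1 : ℝ) - m * ((φ j).2 : ℝ)| ≤ Xm := by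
    intro j
    have h1 : (((φ j).1 : ℕ) : ℝ) ≤ R' + L := by exact_mod_cast (φ j).1.2.le
    have h2 : (((φ j).2 : ℕ) : ℝ) ≤ S := by exact_mod_cast (φ j).2.2.le
    have h3 : (m:ℝ) * (((φ j).2 : ℕ) : ℝ) ≤ m * S := by gcongr
    rw [abs_le]; constructor
    · have : (0:ℝ) ≤ (((φ j).1 : ℕ) : ℝ) := by positivity
      have : (0:ℝ) ≤ R' + L := by positivity
      linarith
    · have : (0:ℝ) ≤ (m:ℝ) * (((φ j).2 : ℕ) : ℝ) := by positivity
      have : (0:ℝ) ≤ (m:ℝ) * S := by positivity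
      linarith
  have hG1e : G1 = Real.exp ω1 := (Real.exp_log hg).symm
  have hG2e : G2 = Real.exp ω2 := (Real.exp_log hG2p).symm
  -- analytic estimate
  set M := K * L * (K * L - 1) / 2 - Sk with hM
  have hMle : Sk ≤ K * L * (K * L - 1) / 2 := by
    have h1 : (0:ℝ) ≤ 6 * (K * L * Real.log (K * L)) := by
      have : (1:ℝ) ≤ K * L := by exact_mod_cast Nat.mul_pos hK hL
      have := Real.log_nonneg this
      positivity
    have h2 : (0:ℝ) ≤ 6 * (Sk : ℝ) * Real.log Xm := by
      have := Real.log_nonneg hXm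
      positivity
    have h3 : (0:ℝ) ≤ (Sl:ℝ) * (8 * ((R' + L) * η1) + 12 * (S * η2)) := by positivity
    have : (Sk:ℝ) ≤ (K * L * (K * L - 1) / 2 : ℕ) := by linarith
    exact_mod_cast this
  have han := P1_analytic (fun (i j : Fin K × Fin L) => (((φ j).1 : ℝ) - m * ((φ j).2 : ℝ)) ^ (i.1 : ℕ))
    (fun i => (i.2 : ℝ)) (fun j => (((φ j).1 : ℝ) - m * ((φ j).2 : ℝ)) * ω1)
    (fun j => ((φ j).2 : ℝ)) M (K * L) Λ (Real.exp 1) (Xm ^ Sk)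
    (Sl * (R * η1 + 2 * (S * η2) + S * |Λ|)) (Sl * S) (by
      have := Real.add_one_le_exp 1; linarith) (by positivity)
    (P1_order _ _ _ 1 (K * L) M (fun i => (i.1 : ℕ))
      (fun e _ j => (((φ j).1 : ℝ) - m * ((φ j).2 : ℝ)) ^ e) (by simp) (fun i mm =>
        ⟨fun _ => ω1 ^ mm, fun j => by simp [mul_pow, pow_add]; ring⟩)
      (by rw [hsk, one_mul]; omega))
    (by
      intro π
      rw [abs_prod, ← hsk, ← prod_pow_eq_pow_sum]
      refine prod_le_prod (fun _ _ => abs_nonneg _) fun i _ => ?_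
      rw [abs_pow]
      exact pow_le_pow_left₀ (abs_nonneg _) (hxb _) _)
    (by
      intro π
      refine (abs_sum_le_sum_abs _ _).trans ?_
      have : (Sl : ℝ) = ∑ i : Fin K × Fin L, ((i.2 : ℕ) : ℝ) := by rw [← hsl]; push_cast; rfl
      rw [this, sum_mul]
      refine sum_le_sum fun i _ => ?_
      rw [abs_mul, Nat.abs_cast]
      gcongr
      set j := π i
      have h1 : (((φ j).1 : ℕ) : ℝ) ≤ R := by exact_mod_cast (φ j).1.2.le
      have h2 : (((φ j).2 : ℕ) : ℝ) ≤ S := by exact_mod_cast (φ j).2.2.le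
      have e : (((φ j).1 : ℝ) - m * ((φ j).2 : ℝ)) * ω1 =
        ((φ j).1 : ℝ) * ω1 + ((φ j).2 : ℝ) * ω2 - ((φ j).2 : ℝ) * Λ := by rw [hΛdef]; ring
      rw [e]
      refine (abs_sub _ _).trans ?_
      refine add_le_add ((abs_add_le _ _).trans ?_) ?_
      · rw [abs_mul, abs_mul, Nat.abs_cast, Nat.abs_cast]
        have a1 : (((φ j).1 : ℕ) : ℝ) * |ω1| ≤ R * η1 := by gcongr
        have a2 : (((φ j).2 : ℕ) : ℝ) * |ω2| ≤ S * (2 * η2) := by gcongr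
        linarith
      · rw [abs_mul, Nat.abs_cast]; gcongr)
    (by
      intro π
      refine (abs_sum_le_sum_abs _ _).trans ?_
      have : (Sl : ℝ) = ∑ i : Fin K × Fin L, ((i.2 : ℕ) : ℝ) := by rw [← hsl]; push_cast; rfl
      rw [this, sum_mul]
      refine sum_le_sum fun i _ => ?_
      rw [abs_mul, Nat.abs_cast, Nat.abs_cast]
      have h2 : (((φ (π i)).2 : ℕ) : ℝ) ≤ S := by exact_mod_cast (φ (π i)).2.2.le
      gcongr)
  have hent : (Matrix.of fun i j : Fin K × Fin L => (((φ j).1 : ℝ) - m * ((φ j).2 : ℝ)) ^ (i.1 : ℕ) *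
      Real.exp ((i.2 : ℝ) * ((((φ j).1 : ℝ) - m * ((φ j).2 : ℝ)) * ω1 + Λ * ((φ j).2 : ℝ)))) =
      Matrix.of fun i j => (((φ j).1 : ℝ) - m * ((φ j).2 : ℝ)) ^ (i.1 : ℕ) *
        (G1 ^ ((φ j).1 : ℕ) * G2 ^ ((φ j).2 : ℕ)) ^ (i.2 : ℕ) := by
    ext i j
    simp only [Matrix.of_apply]
    congr 1
    rw [hG1e, hG2e, ← Real.exp_nat_mul, ← Real.exp_nat_mul, ← Real.exp_add, ← Real.exp_nat_mul]
    congr 1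
    rw [hΛdef]; ring
  rw [hent] at han
  set Δ := (Matrix.of fun i j : Fin K × Fin L => (((φ j).1 : ℝ) - m * ((φ j).2 : ℝ)) ^ (i.1 : ℕ) *
        (G1 ^ ((φ j).1 : ℕ) * G2 ^ ((φ j).2 : ℕ)) ^ (i.2 : ℕ)).det with hΔ
  -- arithmetic
  set z : F := (Matrix.of fun i j : Fin K × Fin L => (((φ j).1 : ℕ) - (m : F) * ((φ j).2 : ℕ)) ^ (i.1 : ℕ) *
        (g ^ ((φ j).1 : ℕ) * (ν ^ ((φ j).2 : ℕ) * δ ^ (S - ((φ j).2 : ℕ)))) ^ (i.2 : ℕ)).det with hz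
  have hzi : IsIntegral ℤ z := by
    refine IsIntegral.det fun i j => ?_
    simp only [Matrix.of_apply]
    refine IsIntegral.mul (IsIntegral.pow (IsIntegral.sub (isIntegral_algebraMap (x := (((φ j).1 : ℕ) : ℤ))|> fun h => by simpa using h) ?_) _) ?_
    · exact IsIntegral.mul (isIntegral_algebraMap (x := (m : ℤ))|> fun h => by simpa using h)
        (isIntegral_algebraMap (x := (((φ j).2 : ℕ) : ℤ))|> fun h => by simpa using h)
    · exact IsIntegral.pow (IsIntegral.mul (hgi.pow _) (IsIntegral.mul (hνi.pow _) (hδi.pow _))) _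
  have hσz : σ0 z = (σ0 δ) ^ (S * Sl) * Δ := by
    rw [hz, RingHom.map_det, hΔ, mul_comm S Sl, pow_mul, ← hsl]
    have : ((σ0 δ ^ (∑ i : Fin K × Fin L, (i.2 : ℕ))) ^ S) =
        ∏ i : Fin K × Fin L, (σ0 δ ^ S) ^ (i.2 : ℕ) := by
      rw [prod_pow_eq_pow_sum, ← pow_mul, ← pow_mul, mul_comm]
    rw [this, ← Matrix.det_mul_column]
    congr 1
    ext i j
    simp only [RingHom.mapMatrix_apply, Matrix.map_apply, Matrix.of_apply, map_mul, map_pow,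
      map_sub, map_natCast]
    have hsS : ((φ j).2 : ℕ) ≤ S := (φ j).2.2.le
    have e : σ0 δ ^ S * (G1 ^ ((φ j).1 : ℕ) * G2 ^ ((φ j).2 : ℕ)) = G1 ^ ((φ j).1 : ℕ) *
      (σ0 ν ^ ((φ j).2 : ℕ) * σ0 δ ^ (S - ((φ j).2 : ℕ))) := by
      have e1 : σ0 δ ^ S = σ0 δ ^ (S - ((φ j).2 : ℕ)) * σ0 δ ^ ((φ j).2 : ℕ) := by
        rw [← pow_add, Nat.sub_add_cancel hsS]
      have : σ0 δ ^ ((φ j).2 : ℕ) ≠ 0 := pow_ne_zero _ hδ.ne'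
      rw [hG2, div_pow, e1]
      field_simp
    rw [mul_left_comm ((σ0 δ ^ S) ^ (i.2 : ℕ)), ← mul_pow (σ0 δ ^ S), e]
  have hz0 : z ≠ 0 := by
    intro h0
    rw [h0, map_zero] at hσz
    have : (σ0 δ) ^ (S * Sl) * Δ ≠ 0 := mul_ne_zero (pow_ne_zero _ hδ.ne') hφ
    exact this hσz.symm
  set H : ℝ := (K * L).factorial * (Xm ^ Sk * Real.exp (Sl * (R * η1 + S * η2))) with hH
  have hH1 : 1 ≤ H := by
    have a1 : (1:ℝ) ≤ (K * L).factorial := by exact_mod_cast Nat.factorial_pos _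
    have a2 : 1 ≤ Xm ^ Sk := one_le_pow₀ hXm
    have a3 : 1 ≤ Real.exp (Sl * (R * η1 + S * η2)) := Real.one_le_exp (by positivity)
    exact one_le_mul_of_one_le_of_one_le a1 (one_le_mul_of_one_le_of_one_le a2 a3)
  have hHb : ∀ σ : F →+* ℂ, ‖σ z‖ ≤ H := by
    intro σ
    rw [hz, RingHom.map_det]
    refine (L_detbound _ (fun i => Xm ^ (i.1 : ℕ) * Real.exp (R * η1 + S * η2) ^ (i.2 : ℕ)) ?_).trans ?_
    · intro i j
      simp only [RingHom.mapMatrix_apply, Matrix.map_apply, Matrix.of_apply, map_mul, map_pow,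
        map_sub, map_natCast, norm_mul, norm_pow]
      have h1 : (((φ j).1 : ℕ) : ℝ) ≤ R := by exact_mod_cast (φ j).1.2.le
      have hsS : ((φ j).2 : ℕ) ≤ S := (φ j).2.2.le
      gcongr
      · have := hxb j
        have e : (((φ j).1 : ℕ) : ℂ) - (m : ℂ) * ((φ j).2 : ℕ) =
          (((((φ j).1 : ℕ) : ℝ) - (m : ℝ) * ((φ j).2 : ℕ) : ℝ) : ℂ) := by push_cast; rfl
        rw [e, Complex.norm_real]
        exact this
      · rw [Real.exp_add]
        refine mul_le_mul ?_ ?_ (by positivity) (by positivity)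
        · refine (pow_le_pow_left₀ (norm_nonneg _) (hσg σ) _).trans ?_
          rw [← Real.exp_nat_mul]
          gcongr
        · calc _ ≤ Real.exp η2 ^ ((φ j).2 : ℕ) * Real.exp η2 ^ (S - ((φ j).2 : ℕ)) := by
                gcongr
                · exact hσν σ
                · exact hσδ σ
            _ = _ := by
                rw [← pow_add, Nat.add_sub_cancel' hsS, ← Real.exp_nat_mul]
    · rw [prod_mul_distrib, prod_pow_eq_pow_sum, prod_pow_eq_pow_sum, hsk, hsl,
        ← Real.exp_nat_mul, Fintype.card_prod, Fintype.card_fin, Fintype.card_fin]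
  have hlio := L_liouville (Complex.ofRealHom.comp σ0) z hzi hz0 H hH1 hHb 5 (by omega)
  have hn : ‖(Complex.ofRealHom.comp σ0) z‖ = |σ0 z| := by simp
  rw [hn, hσz, abs_mul, abs_pow, abs_of_pos hδ] at hlio
  have hδb : σ0 δ ≤ Real.exp η2 := by
    have := hσδ (Complex.ofRealHom.comp σ0)
    simp only [RingHom.coe_comp, Function.comp_apply, Complex.ofRealHom_eq_coe, Complex.norm_real,
      Real.norm_eq_abs, abs_of_pos hδ] at this
    exact this
  -- combine
  have hΛ1 : |Λ| * (Sl * S) ≤ |Λ| * (Real.exp (K * L) * (Sl * S)) := by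
    refine mul_le_mul_of_nonneg_left ?_ (abs_nonneg _)
    have : 1 ≤ Real.exp (K * L) := Real.one_le_exp (by positivity)
    have h0 : (0:ℝ) ≤ Sl * S := by positivity
    nlinarith
  have he3 : Real.exp 1 < 3 := by have := Real.exp_one_lt_d9; linarith
  have he0 : 0 < Real.exp 1 := Real.exp_pos 1
  have hfact : ((K * L).factorial : ℝ) ≤ Real.exp (K * L * Real.log (K * L)) := by
    have hpos : (0:ℝ) < K * L := by exact_mod_cast Nat.mul_pos hK hL
    have h1 : ((K * L).factorial : ℝ) ≤ ((K * L : ℕ) : ℝ) ^ (K * L) := by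
      exact_mod_cast Nat.factorial_le_pow (K * L)
    refine h1.trans (le_of_eq ?_)
    rw [mul_comm ((K:ℝ) * L) (Real.log _), Real.exp_mul, Real.exp_log hpos]
    rw [← Nat.cast_mul, Real.rpow_natCast]
  have hXe : Xm ^ Sk = Real.exp (Sk * Real.log Xm) := by
    rw [Real.exp_nat_mul, Real.exp_log (by linarith)]
  have hρM : ((Real.exp 1) ^ M)⁻¹ = Real.exp (-M) := by
    rw [← Real.exp_nat_mul, mul_one, Real.exp_neg]
  have hΔb : |Δ| ≤ Real.exp (K * L * Real.log (K * L) + Sk * Real.log Xm - M +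
      (3 * (Sl * (R * η1 + 2 * (S * η2))) + 4)) := by
    refine han.trans ?_
    rw [Fintype.card_prod, Fintype.card_fin, Fintype.card_fin, hρM, hXe]
    have er : Real.exp (K * L * Real.log (K * L) + Sk * Real.log Xm - M +
      (3 * (Sl * (R * η1 + 2 * (S * η2))) + 4)) = Real.exp (K * L * Real.log (K * L)) *
        Real.exp (Sk * Real.log Xm) * Real.exp (-M) *
        Real.exp (3 * (Sl * (R * η1 + 2 * (S * η2))) + 4) := by
      rw [← Real.exp_add, ← Real.exp_add, ← Real.exp_add]; congr 1
    rw [er]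
    gcongr ?_ * _ * _ * Real.exp ?_
    have hpow : Real.exp 1 ^ (K * L) = Real.exp (K * L) := by
      rw [← Real.exp_nat_mul, mul_one]; push_cast; rfl
    rw [hpow]
    have a1 : Real.exp (K * L) * |Λ| * (Sl * S) ≤ 1 := by
      calc _ = |Λ| * (Real.exp (K * L) * (Sl * S)) := by ring
        _ ≤ 1 := hΛ
    have a2 : 0 ≤ Sl * (R * η1 + 2 * (S * η2)) := by positivity
    have a3 : |Λ| * (Sl * S) ≤ 1 := hΛ1.trans hΛ
    have a4 : 0 ≤ |Λ| * (Sl * S) := by positivity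
    calc _ = Real.exp 1 * (Sl * (R * η1 + 2 * (S * η2))) + Real.exp 1 * (|Λ| * (Sl * S)) +
          Real.exp (K * L) * |Λ| * (Sl * S) := by ring
      _ ≤ 3 * (Sl * (R * η1 + 2 * (S * η2))) + 3 * 1 + 1 := by gcongr
      _ = _ := by ring
  have hHe : H ≤ Real.exp (K * L * Real.log (K * L) + Sk * Real.log Xm + Sl * (R * η1 + S * η2)) := by
    rw [hH, hXe, Real.exp_add, Real.exp_add, mul_assoc]
    gcongr
  have hfin : σ0 δ ^ (S * Sl) * |Δ| * H ^ 5 ≤ Real.exp (((S * Sl : ℕ) : ℝ) * η2 +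
      (K * L * Real.log (K * L) + Sk * Real.log Xm - M +
      (3 * (Sl * (R * η1 + 2 * (S * η2))) + 4)) + (5:ℕ) *
      (K * L * Real.log (K * L) + Sk * Real.log Xm + Sl * (R * η1 + S * η2))) := by
    rw [Real.exp_add, Real.exp_add, Real.exp_nat_mul, Real.exp_nat_mul]
    gcongr
  have hlt := hlio.trans hfin
  rw [Real.one_le_exp_iff] at hlt
  have hMr : (M : ℝ) = (K * L * (K * L - 1) / 2 : ℕ) - Sk := by
    rw [hM, Nat.cast_sub hMle]
  have hRr : (R : ℝ) = R' + L := by rw [hR]; push_cast; rfl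
  rw [hMr, hRr] at hlt
  rw [Nat.cast_mul S Sl] at hlt
  have h5 : ((5:ℕ):ℝ) = 5 := by norm_num
  rw [h5] at hlt
  generalize ((K * L * (K * L - 1) / 2 : ℕ) : ℝ) = MM at *
  nlinarith [hlt, hnum]

end

section
open Finset

theorem P4_dirichlet (X p : ℕ) (b : ℤ) (hb : |b| ≤ X) (hp : 1 ≤ p) (hX1 : p ^ 3 ≤ X)
    (hX2 : X ≤ 2 * p ^ 3) :
    ∃ (k m r1 y : ℕ) (j r2 : ℤ), 1 ≤ k ∧ k ≤ p ∧ |j| ≤ k ∧ X = k * m + r1 ∧ r1 ≤ p ∧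
      b = j * m + r2 ∧ r1 + |r2| + 1 ≤ y ∧ k * y ≤ 6 * p ^ 2 ∧ p ^ 3 ≤ 2 * (k * m) ∧ m ≤ X
        ∧ 1 ≤ y := by
  obtain ⟨j, k0, hk0, hk1, hjk⟩ := Real.exists_int_int_abs_mul_sub_le ((b : ℝ) / X) (n := p) hp
  lift k0 to ℕ using hk0.le
  rename' k0 => k
  have hk : 1 ≤ k := by exact_mod_cast hk0
  have hkp : k ≤ p := by exact_mod_cast hk1
  have hp3 : p ≤ p ^ 3 := Nat.le_self_pow (by norm_num) p
  have hXpos : (0:ℝ) < X := by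
    have : 0 < X := by omega
    exact_mod_cast this
  have hpR : (1:ℝ) ≤ p := by exact_mod_cast hp
  have hkR : (1:ℝ) ≤ k := by exact_mod_cast hk
  have hkpR : (k:ℝ) ≤ p := by exact_mod_cast hkp
  have hbR : |(b:ℝ)| ≤ X := by exact_mod_cast hb
  push_cast at hjk
  have hj : |j| ≤ k := by
    have h1 : |(b:ℝ) / X| ≤ 1 := by rw [abs_div, abs_of_pos hXpos]; exact (div_le_one hXpos).2 hbR
    have h2 : |(k:ℝ) * (b / X)| ≤ k := by
      rw [abs_mul, Nat.abs_cast]; nlinarith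
    have h3 : (1:ℝ) / (p + 1) < 1 := by rw [div_lt_one (by linarith)]; linarith
    have h4 : |(j:ℝ)| < k + 1 := by
      have := abs_sub_abs_le_abs_sub (j:ℝ) ((k:ℝ) * (b / X))
      rw [abs_sub_comm] at this
      linarith
    have : |j| < k + 1 := by exact_mod_cast h4
    omega
  set m := X / k with hm
  set r1 := X % k with hr1
  have hdiv : X = k * m + r1 := (Nat.div_add_mod X k).symm
  have hr1k : r1 < k := Nat.mod_lt _ hk
  set r2 : ℤ := b - j * m with hr2
  have hr2b : |(r2:ℝ)| ≤ 2 * p ^ 2 / k + p := by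
    have e : (r2:ℝ) = -((k:ℝ) * (b / X) - j) * (-(X / k)) + j * (r1 / k) := by
      rw [hr2]; push_cast
      have : (X:ℝ) = k * m + r1 := by exact_mod_cast hdiv
      field_simp
      rw [this]; ring
    rw [e]
    refine (abs_add_le _ _).trans (add_le_add ?_ ?_)
    · rw [abs_mul, abs_neg, abs_neg, abs_of_pos (by positivity : (0:ℝ) < X / k)]
      have hX2R : (X:ℝ) ≤ 2 * p ^ 3 := by exact_mod_cast hX2
      calc _ ≤ 1 / ((p:ℝ) + 1) * (2 * p ^ 3 / k) := by gcongr
        _ ≤ 1 / (p:ℝ) * (2 * p ^ 3 / k) := by gcongr; linarith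
        _ = _ := by field_simp
    · have hjR : |(j:ℝ)| ≤ k := by exact_mod_cast hj
      have hr1R : (r1:ℝ) / k ≤ 1 := by
        rw [div_le_one (by linarith)]; exact_mod_cast hr1k.le
      rw [abs_mul, abs_of_nonneg (by positivity : (0:ℝ) ≤ r1 / k)]
      calc _ ≤ (k:ℝ) * 1 := by gcongr
        _ ≤ p := by linarith
  refine ⟨k, m, r1, r1 + r2.natAbs + 1, j, r2, hk, hkp, hj, hdiv, by omega, by rw [hr2]; ring,
    by push_cast; simp, ?_, ?_, Nat.div_le_self _ _, by omega⟩
  · have h1 : ((r2.natAbs : ℕ) : ℝ) = |(r2:ℝ)| := by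
      rw [Nat.cast_natAbs]; push_cast; rfl
    have h2 : ((k * (r1 + r2.natAbs + 1) : ℕ) : ℝ) ≤ ((6 * p ^ 2 : ℕ) : ℝ) := by
      push_cast [h1]
      have h3 : (k:ℝ) * |(r2:ℝ)| ≤ 2 * p ^ 2 + k * p := by
        calc _ ≤ (k:ℝ) * (2 * p ^ 2 / k + p) := by gcongr
          _ = _ := by field_simp
      have h4 : (r1:ℝ) + 1 ≤ k := by exact_mod_cast hr1k
      nlinarith
    exact_mod_cast h2
  · have : k ≤ p ^ 3 := hkp.trans hp3
    have h5 : k * 1 ≤ k * m := by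
      apply Nat.mul_le_mul_left
      rw [hm, Nat.le_div_iff_mul_le (by omega)]; omega
    omega

end

section
open Finset

set_option maxHeartbeats 1000000 in
theorem P4_num (p lg k y m η X : ℕ) (hlg : p < 2 ^ lg) (hlg1 : 1 ≤ lg) (hk : 1 ≤ k) (hkp : k ≤ p)
    (hy : 1 ≤ y) (hη : 1 ≤ η) (hky : k * y ≤ 6 * p ^ 2) (hkm : p ^ 3 ≤ 2 * (k * m)) (hmX : m ≤ X)
    (hX1 : p ^ 3 ≤ X) (hX2 : X ≤ 2 * p ^ 3) (hp : 20000000000 * η * lg ^ 2 ≤ p) (Λ : ℝ)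
    (hΛ : |Λ| ≤ Real.exp (-((X:ℝ) * η / 32))) :
    ∃ (K L R' S : ℕ) (Xm : ℝ), 1 ≤ Xm ∧ (R' + L : ℝ) + m * S ≤ Xm ∧ 1 ≤ K ∧ 1 ≤ L ∧ R' ≤ m ∧
      L * (K - 1) < R' * S ∧
      |Λ| * (Real.exp (K * L) * ((K * (L * (L - 1) / 2) : ℕ) * S)) ≤ 1 ∧
      6 * (K * L * Real.log (K * L)) + 6 * (L * (K * (K - 1) / 2) : ℕ) * Real.log Xm +
      (K * (L * (L - 1) / 2) : ℕ) * (8 * ((R' + L) * (2 * k * η : ℝ)) + 12 * (S * (η * y : ℝ))) + 5 +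
       (L * (K * (K - 1) / 2) : ℕ) ≤ (K * L * (K * L - 1) / 2 : ℕ) := by
  obtain ⟨h1, hh1⟩ : ∃ h1, h1 = 2 * k * η := ⟨_, rfl⟩
  obtain ⟨h2, hh2⟩ : ∃ h2, h2 = η * y := ⟨_, rfl⟩
  have h11 : 1 ≤ h1 := by rw [hh1]; linarith [Nat.mul_le_mul hk hη]
  have h21 : 1 ≤ h2 := by rw [hh2]; linarith [Nat.mul_le_mul hη hy]
  have h12 : h1 * h2 ≤ 12 * η ^ 2 * p ^ 2 := by
    calc h1 * h2 = 2 * η ^ 2 * (k * y) := by rw [hh1, hh2]; ring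
      _ ≤ 2 * η ^ 2 * (6 * p ^ 2) := Nat.mul_le_mul_left _ hky
      _ = _ := by ring
  obtain ⟨L, hL⟩ : ∃ L, L = 100 * lg := ⟨_, rfl⟩
  obtain ⟨K, hK⟩ : ∃ K, K = 2352 * (h1 * h2) * L := ⟨_, rfl⟩
  have hL1 : 100 ≤ L := by omega
  have hh12 : 1 ≤ h1 * h2 := Nat.mul_le_mul h11 h21
  have hK1 : 2352 * L ≤ K := by rw [hK]; linarith [Nat.mul_le_mul_right (2352 * L) hh12]
  have hKLbig : 235200 ≤ K * L := Nat.mul_le_mul (by omega : 2352 ≤ K) hL1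
  have hp1 : 1 ≤ p := by omega
  have hlgsq : lg ≤ lg ^ 2 := Nat.le_self_pow (by norm_num) lg
  have hpη : 20000000000 * (η * lg) ≤ p := by
    refine le_trans ?_ hp
    rw [mul_assoc]
    exact Nat.mul_le_mul_left _ (Nat.mul_le_mul_left _ hlgsq)
  have hlgp : Real.log p ≤ 0.6932 * lg := by
    have : (p:ℝ) ≤ 2 ^ lg := by exact_mod_cast hlg.le
    calc Real.log p ≤ Real.log (2 ^ lg) := Real.log_le_log (by exact_mod_cast hp1) this
      _ = lg * Real.log 2 := by rw [Real.log_pow]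
      _ ≤ _ := by linarith [mul_le_mul_of_nonneg_left Real.log_two_lt_d9.le (Nat.cast_nonneg lg : (0:ℝ) ≤ lg), (Nat.cast_nonneg lg : (0:ℝ) ≤ lg)]
  have hlog0 : 0 ≤ Real.log p := Real.log_natCast_nonneg p
  -- KL bound
  have hKL64 : 64 * (K * L) ≤ p ^ 3 * η := by
    calc 64 * (K * L) = 64 * 23520000 * lg ^ 2 * (h1 * h2) := by rw [hK, hL]; ring
      _ ≤ 64 * 23520000 * lg ^ 2 * (12 * η ^ 2 * p ^ 2) := Nat.mul_le_mul_left _ h12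
      _ = 18063360000 * η * lg ^ 2 * (p ^ 2 * η) := by ring
      _ ≤ 20000000000 * η * lg ^ 2 * (p ^ 2 * η) := by
          apply Nat.mul_le_mul_right; apply Nat.mul_le_mul_right; apply Nat.mul_le_mul_right; norm_num
      _ ≤ p * (p ^ 2 * η) := Nat.mul_le_mul_right _ hp
      _ = _ := by ring
  have hηp : η ≤ p := by linarith [Nat.le_mul_of_pos_right η hlg1, Nat.zero_le (η * lg)]
  have hKLp : K * L ≤ p ^ 4 := by
    have : p ^ 3 * η ≤ p ^ 4 := by rw [pow_succ p 3]; exact Nat.mul_le_mul_left _ hηp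
    omega
  have hkR : k * (49 * h2 * L) ≤ k * m := by
    have : k * (49 * h2 * L) = 4900 * (η * lg) * (k * y) := by rw [hh2, hL]; ring
    have h3 : 4900 * (η * lg) * (k * y) ≤ 4900 * (η * lg) * (6 * p ^ 2) := Nat.mul_le_mul_left _ hky
    have h4 : 20000000000 * (η * lg) * p ^ 2 ≤ p * p ^ 2 := Nat.mul_le_mul_right _ hpη
    linarith [Nat.zero_le (p ^ 3)]
  have hRm : 49 * h2 * L ≤ m := Nat.le_of_mul_le_mul_left hkR (by omega)
  have hXmN : 49 * h2 * L + m * (49 * h1 * L) ≤ p ^ 5 := by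
    have a1 : m ≤ 2 * p ^ 3 := hmX.trans hX2
    have a2 : 49 * h1 * L ≤ 9800 * (η * lg) * p := by
      rw [hh1, hL]
      calc 49 * (2 * k * η) * (100 * lg) = 9800 * (η * lg) * k := by ring
        _ ≤ _ := Nat.mul_le_mul_left _ hkp
    have a3 : m * (49 * h1 * L) ≤ 2 * p ^ 3 * (9800 * (η * lg) * p) := Nat.mul_le_mul a1 a2
    have a4 : 20000000000 * (η * lg) * p ^ 4 ≤ p * p ^ 4 := Nat.mul_le_mul_right _ hpη
    have a5 : 49 * h2 * L ≤ 2 * p ^ 4 := by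
      refine hRm.trans (a1.trans ?_)
      exact Nat.mul_le_mul_left _ (Nat.pow_le_pow_right hp1 (by norm_num))
    have a6 : 1 ≤ η * lg := Nat.mul_le_mul hη hlg1
    have a7 : p ^ 4 ≤ (η * lg) * p ^ 4 := Nat.le_mul_of_pos_left _ a6
    have a8 : 2 * p ^ 3 * (9800 * (η * lg) * p) = 19600 * ((η * lg) * p ^ 4) := by ring
    have a9 : p * p ^ 4 = p ^ 5 := by ring
    rw [mul_assoc] at a4
    omega
  have hRL : 49 * h2 * L - L + L = 49 * h2 * L := Nat.sub_add_cancel (by linarith [Nat.le_mul_of_pos_left L h21])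
  refine ⟨K, L, 49 * h2 * L - L, 49 * h1 * L, (p:ℝ) ^ 5, ?_, ?_, by omega, by omega, by omega, ?_, ?_, ?_⟩
  · exact_mod_cast Nat.one_le_pow _ _ hp1
  · have : (((49 * h2 * L - L + L : ℕ) + m * (49 * h1 * L : ℕ) : ℕ) : ℝ) ≤ ((p ^ 5 : ℕ) : ℝ) := by
      exact_mod_cast (by rw [hRL]; exact hXmN)
    push_cast at this ⊢
    linarith
  · have e : 48 * h2 * L ≤ 49 * h2 * L - L := by
      have : L ≤ h2 * L := Nat.le_mul_of_pos_left _ h21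
      have : 49 * h2 * L = 48 * h2 * L + h2 * L := by ring
      omega
    calc L * (K - 1) < L * K := by
          apply Nat.mul_lt_mul_of_pos_left <;> omega
      _ = 48 * h2 * L * (49 * h1 * L) := by rw [hK]; ring
      _ ≤ _ := Nat.mul_le_mul_right _ e
  · have hKLr : (64:ℝ) * (K * L) ≤ X * η := by
      have : 64 * (K * L) ≤ X * η := hKL64.trans (Nat.mul_le_mul_right _ hX1)
      exact_mod_cast this
    have hSl : (K * (L * (L - 1) / 2)) * (49 * h1 * L) ≤ (K * L) ^ 2 := by
      have b1 : L * (L - 1) / 2 ≤ L * L := (Nat.div_le_self _ _).trans (Nat.mul_le_mul_left _ (Nat.sub_le _ _))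
      have b2 : 49 * h1 * L ≤ K := by
        rw [hK]
        apply Nat.mul_le_mul_right
        have : h1 ≤ h1 * h2 := Nat.le_mul_of_pos_right _ h21
        omega
      calc _ ≤ K * (L * L) * K := Nat.mul_le_mul (Nat.mul_le_mul_left _ b1) b2
        _ = _ := by ring
    have hSlr : (((K * (L * (L - 1) / 2) : ℕ) : ℝ) * (49 * h1 * L : ℕ)) ≤ ((K:ℝ) * L) ^ 2 := by
      exact_mod_cast hSl
    have hz : (16:ℝ) ≤ K * L := by
      have : 16 ≤ K * L := by omega
      exact_mod_cast this
    set z : ℝ := K * L with hzdef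
    have hsq : z ^ 2 ≤ Real.exp z := by
      have e1 : z / 4 ≤ Real.exp (z / 4) := by linarith [Real.add_one_le_exp (z / 4)]
      have e2 : (z / 4) ^ 4 ≤ Real.exp (z / 4) ^ 4 := by gcongr
      rw [← Real.exp_nat_mul] at e2
      have e3 : ((4:ℕ):ℝ) * (z / 4) = z := by push_cast; ring
      rw [e3] at e2
      have e4 : 0 ≤ z ^ 2 - 256 := by have := mul_self_le_mul_self (by norm_num) hz; linarith
      linarith [mul_nonneg (sq_nonneg z) e4]
    calc _ ≤ Real.exp (-((X:ℝ) * η / 32)) * (Real.exp z * Real.exp z) := by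
          gcongr
          exact hSlr.trans hsq
      _ = Real.exp (-((X:ℝ) * η / 32) + (z + z)) := by rw [Real.exp_add, Real.exp_add]
      _ ≤ 1 := by rw [Real.exp_le_one_iff]; linarith
  · have hLr : (L:ℝ) = 100 * lg := by rw [hL]; push_cast; ring
    have hKr : (K:ℝ) = 2352 * (h1 * h2) * L := by rw [hK]; push_cast; ring
    have hRLr : ((49 * h2 * L - L : ℕ) : ℝ) + L = 49 * h2 * L := by exact_mod_cast hRL
    have c1 : Real.log (K * L) ≤ 2.7728 * lg := by
      have : (K * L : ℝ) ≤ (p:ℝ) ^ 4 := by exact_mod_cast hKLp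
      have h := Real.log_le_log (by have : 0 < K * L := by omega
                                    exact_mod_cast this) this
      rw [Real.log_pow] at h
      push_cast at h
      linarith
    have c2 : Real.log ((p:ℝ) ^ 5) ≤ 3.466 * lg := by
      rw [Real.log_pow]; push_cast; linarith
    have hdiv2 : ∀ a : ℕ, ((a * (a - 1) / 2 : ℕ) : ℝ) = a * (a - 1) / 2 := by
      intro a
      have h2 : 2 ∣ a * (a - 1) := (Nat.even_mul_pred_self a).two_dvd
      rw [Nat.cast_div h2 (by norm_num)]
      rcases a with _ | a
      · simp
      · push_cast; simp
    have hKLpos : 1 ≤ K * L := by omega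
    rw [hdiv2 (K * L)]
    rw [Nat.cast_mul L, Nat.cast_mul K (L * (L - 1) / 2), hdiv2 K, hdiv2 L, hRLr]
    have hh1r : (2 * k * η : ℝ) = h1 := by rw [hh1]; push_cast; ring
    have hh2r : (η * y : ℝ) = h2 := by rw [hh2]; push_cast; ring
    rw [hh1r, hh2r]
    have hLR : (100:ℝ) ≤ L := by exact_mod_cast hL1
    have hKR : 2352 * (L:ℝ) ≤ K := by exact_mod_cast hK1
    have hlgR : (1:ℝ) ≤ lg := by exact_mod_cast hlg1
    have d3 : 8 * (49 * (h2:ℝ) * L * h1) + 12 * ((49 * h1 * L : ℕ) * (h2:ℝ)) ≤ K / 2 := by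
      push_cast
      rw [hKr]
      have : (0:ℝ) ≤ h1 * h2 * L := by positivity
      linarith
    have hKL0 : (0:ℝ) ≤ K * L := by positivity
    have t1 : 6 * ((K:ℝ) * L * Real.log (K * L)) ≤ 0.17 * (K * L * L) := by
      have : (K:ℝ) * L * Real.log (K * L) ≤ K * L * (0.027728 * L) := by
        apply mul_le_mul_of_nonneg_left _ hKL0
        linarith
      linarith [mul_nonneg hKL0 (Nat.cast_nonneg L : (0:ℝ) ≤ L)]
    have hK0 : (1:ℝ) ≤ K := by linarith
    have t2 : 6 * ((L:ℝ) * (K * (K - 1) / 2)) * Real.log ((p:ℝ) ^ 5) ≤ 0.104 * (K * L) ^ 2 := by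
      have a : (L:ℝ) * (K * (K - 1) / 2) ≤ L * (K * K / 2) := by gcongr; linarith
      have b : Real.log ((p:ℝ) ^ 5) ≤ 0.03466 * L := by rw [hLr]; linarith
      have b0 : 0 ≤ Real.log ((p:ℝ) ^ 5) := by rw [Real.log_pow]; positivity
      calc _ ≤ 6 * (L * (K * K / 2)) * (0.03466 * (L:ℝ)) := by gcongr
        _ = 0.10398 * (K * L) ^ 2 := by ring
        _ ≤ _ := by gcongr; norm_num
    have t3 : ((K:ℝ) * (L * (L - 1) / 2)) * (8 * (49 * (h2:ℝ) * L * h1) + 12 * ((49 * h1 * L : ℕ) * (h2:ℝ)))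
        ≤ 0.25 * (K * L) ^ 2 := by
      calc _ ≤ ((K:ℝ) * (L * L / 2)) * (K / 2) := by
            gcongr
            linarith
        _ = _ := by ring
    have t4 : (L:ℝ) * (K * (K - 1) / 2) ≤ 0.005 * (K * L) ^ 2 := by
      have a : (L:ℝ) * (K * (K - 1) / 2) ≤ L * (K * K / 2) := by gcongr; linarith
      have : L * (K * K / 2) * (100:ℝ) ≤ L * (K * K / 2) * L := by gcongr
      linarith
    have t5 : (K:ℝ) * L * L ≤ (K * L) ^ 2 / 2352 := by
      have : (K:ℝ) * L * (2352 * L) ≤ K * L * (K * L) := by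
        apply mul_le_mul_of_nonneg_left _ hKL0
        exact hKR.trans (le_mul_of_one_le_right (by linarith) (by linarith))
      linarith
    have t6 : (K:ℝ) * L * 1 ≤ K * L * L := by gcongr; linarith
    have t7 : (235200:ℝ) ≤ K * L := by exact_mod_cast hKLbig
    have t8 : (235200:ℝ) * (K * L) ≤ (K * L) ^ 2 := by
      rw [sq]; exact mul_le_mul_of_nonneg_right t7 hKL0
    have t9 : (((K * L : ℕ) : ℝ) * (((K * L : ℕ) : ℝ) - 1) / 2) = (K * L : ℝ) ^ 2 / 2 - K * L / 2 := by
      push_cast; ring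
    rw [t9]
    linarith

end

section
open Finset

theorem L_log_zpow_prod {F : Type*} [Field F] (σ : F →+* ℂ) (e1 e2 : F) (he1 : e1 ≠ 0) (he2 : e2 ≠ 0)
    (η : ℝ) (h1 : |Real.log ‖σ e1‖| ≤ η) (h2 : |Real.log ‖σ e2‖| ≤ η) (i j : ℤ) :
    ‖σ (e1 ^ i * e2 ^ j)‖ ≤ Real.exp ((|i| + |j| : ℤ) * η) ∧
    |Real.log ‖σ (e1 ^ i * e2 ^ j)‖| ≤ (|i| + |j| : ℤ) * η := by
  have p1 : 0 < ‖σ e1‖ := norm_pos_iff.2 (by simpa using he1)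
  have p2 : 0 < ‖σ e2‖ := norm_pos_iff.2 (by simpa using he2)
  have key : Real.log ‖σ (e1 ^ i * e2 ^ j)‖ = i * Real.log ‖σ e1‖ + j * Real.log ‖σ e2‖ := by
    rw [map_mul, map_zpow₀, map_zpow₀, norm_mul, norm_zpow, norm_zpow,
      Real.log_mul (zpow_pos p1 _).ne' (zpow_pos p2 _).ne', Real.log_zpow, Real.log_zpow]
  have hb : |Real.log ‖σ (e1 ^ i * e2 ^ j)‖| ≤ (|i| + |j| : ℤ) * η := by
    rw [key]
    refine (abs_add_le _ _).trans ?_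
    rw [abs_mul, abs_mul]
    push_cast
    rw [add_mul]
    gcongr
  refine ⟨?_, hb⟩
  rw [← Real.log_le_iff_le_exp]
  · exact (le_abs_self _).trans hb
  · exact norm_pos_iff.2 (by simp [zpow_ne_zero, he1, he2])

theorem P4_core {F : Type*} [Field F] [NumberField F] (hdeg : Module.finrank ℚ F ≤ 6)
    (σ0 : F →+* ℝ) (e1 e2 ν0 δ0 : F) (hi1 : IsIntegral ℤ e1) (hi1' : IsIntegral ℤ e1⁻¹)
    (hi2 : IsIntegral ℤ e2) (hi2' : IsIntegral ℤ e2⁻¹) (hν : IsIntegral ℤ ν0) (hδ : IsIntegral ℤ δ0)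
    (hp1 : 0 < σ0 e1) (hp2 : 0 < σ0 e2) (hpν : 0 < σ0 ν0) (hpδ : 0 < σ0 δ0) (η : ℕ) (hη : 1 ≤ η)
    (hh1 : ∀ σ : F →+* ℂ, |Real.log ‖σ e1‖| ≤ η) (hh2 : ∀ σ : F →+* ℂ, |Real.log ‖σ e2‖| ≤ η)
    (hhν : ∀ σ : F →+* ℂ, ‖σ ν0‖ ≤ Real.exp η) (hhδ : ∀ σ : F →+* ℂ, ‖σ δ0‖ ≤ Real.exp η)
    (hνδ : |Real.log (σ0 ν0 / σ0 δ0)| ≤ 2 * η)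
    (hind : ∀ i j : ℤ, e1 ^ i * e2 ^ j = 1 → i = 0 ∧ j = 0)
    (a b : ℤ) (X p lg : ℕ) (haX : |a| = X) (hb : |b| ≤ X) (hX1 : p ^ 3 ≤ X) (hX2 : X ≤ 2 * p ^ 3)
    (hlg : p < 2 ^ lg) (hlg1 : 1 ≤ lg) (hp : 20000000000 * η * lg ^ 2 ≤ p)
    (hΛ : |Real.log (σ0 ν0 / σ0 δ0) + a * Real.log (σ0 e1) + b * Real.log (σ0 e2)|
      ≤ Real.exp (-((X:ℝ) * η / 32))) : False := by
  have hpp : 1 ≤ p := by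
    refine le_trans ?_ hp
    have : 1 ≤ lg ^ 2 := Nat.one_le_pow _ _ hlg1
    have := Nat.mul_le_mul hη this
    rw [mul_assoc]; omega
  obtain ⟨k, m, r1, y, j, r2, hk, hkp, hjk, hXe, hr1, hbe, hy, hky, hkm, hmX, hy1⟩ :=
    P4_dirichlet X p b hb hpp hX1 hX2
  obtain ⟨s, hs, has⟩ : ∃ s : ℤ, |s| = 1 ∧ a = s * X := by
    rcases abs_choice a with h | h
    · exact ⟨1, by simp, by rw [← haX, h]; ring⟩
    · exact ⟨-1, by simp, by rw [← haX, h]; ring⟩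
  have hη0 : (0:ℝ) ≤ η := Nat.cast_nonneg _
  have he1 : e1 ≠ 0 := by rintro rfl; simp at hp1
  have he2 : e2 ≠ 0 := by rintro rfl; simp at hp2
  have hIntg : ∀ (e : F), IsIntegral ℤ e → IsIntegral ℤ e⁻¹ → ∀ i : ℤ, IsIntegral ℤ (e ^ i) := by
    intro e h h' i
    rcases Int.eq_nat_or_neg i with ⟨t, rfl | rfl⟩
    · rw [zpow_natCast]; exact h.pow t
    · rw [zpow_neg, zpow_natCast, ← inv_pow]; exact h'.pow t
  set Λ := Real.log (σ0 ν0 / σ0 δ0) + a * Real.log (σ0 e1) + b * Real.log (σ0 e2) with hΛd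
  obtain ⟨K, L, R', S, Xm, c1, c2, c3, c4, c5, c6, c7, c8⟩ :=
    P4_num p lg k y m η X hlg hlg1 hk hkp hy1 hη hky hkm hmX hX1 hX2 hp Λ hΛ
  set g := e1 ^ (s * k) * e2 ^ j with hg
  set w := e1 ^ (s * r1) * e2 ^ r2 with hw
  have hsk : |s * (k:ℤ)| = k := by rw [abs_mul, hs, one_mul, Nat.abs_cast]
  have hsr : |s * (r1:ℤ)| = r1 := by rw [abs_mul, hs, one_mul, Nat.abs_cast]
  have gb : ((|s * (k:ℤ)| + |j| : ℤ) : ℝ) * η ≤ 2 * k * η := by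
    apply mul_le_mul_of_nonneg_right _ hη0
    rw [hsk]
    have : ((k + |j| : ℤ) : ℝ) ≤ ((2 * k : ℤ) : ℝ) := by exact_mod_cast (by omega)
    simpa using this
  have wb : (((|s * (r1:ℤ)| + |r2| : ℤ) : ℝ) + 1) * η ≤ η * y := by
    rw [mul_comm (η:ℝ)]
    apply mul_le_mul_of_nonneg_right _ hη0
    rw [hsr]
    have : ((r1 + |r2| + 1 : ℤ) : ℝ) ≤ ((y : ℤ) : ℝ) := by exact_mod_cast hy
    simpa using this
  have hy1R : (1:ℝ) ≤ y := by exact_mod_cast hy1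
  have hηy : (η:ℝ) ≤ η * y := le_mul_of_one_le_right hη0 hy1R
  have hσr : ∀ z : F, ‖(Complex.ofRealHom.comp σ0) z‖ = |σ0 z| := by
    intro z; simp
  have hgpos : 0 < σ0 g := by
    rw [hg, map_mul, map_zpow₀, map_zpow₀]; exact mul_pos (zpow_pos hp1 _) (zpow_pos hp2 _)
  have hwpos : 0 < σ0 w := by
    rw [hw, map_mul, map_zpow₀, map_zpow₀]; exact mul_pos (zpow_pos hp1 _) (zpow_pos hp2 _)
  have hlogg : Real.log (σ0 g) = (s * k : ℤ) * Real.log (σ0 e1) + j * Real.log (σ0 e2) := by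
    rw [hg, map_mul, map_zpow₀, map_zpow₀, Real.log_mul (zpow_pos hp1 _).ne' (zpow_pos hp2 _).ne',
      Real.log_zpow, Real.log_zpow]
  have hlogw : Real.log (σ0 w) = (s * r1 : ℤ) * Real.log (σ0 e1) + r2 * Real.log (σ0 e2) := by
    rw [hw, map_mul, map_zpow₀, map_zpow₀, Real.log_mul (zpow_pos hp1 _).ne' (zpow_pos hp2 _).ne',
      Real.log_zpow, Real.log_zpow]
  have hlogνw : Real.log (σ0 (ν0 * w) / σ0 δ0) = Real.log (σ0 ν0 / σ0 δ0) + Real.log (σ0 w) := by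
    rw [map_mul, mul_div_right_comm, Real.log_mul (div_pos hpν hpδ).ne' hwpos.ne']
  have hlw : |Real.log (σ0 w)| ≤ ((|s * (r1:ℤ)| + |r2| : ℤ) : ℝ) * η := by
    have := (L_log_zpow_prod (Complex.ofRealHom.comp σ0) e1 e2 he1 he2 η (hh1 _) (hh2 _) (s * r1) r2).2
    rwa [hσr, Real.log_abs] at this
  have hlg' : |Real.log (σ0 g)| ≤ ((|s * (k:ℤ)| + |j| : ℤ) : ℝ) * η := by
    have := (L_log_zpow_prod (Complex.ofRealHom.comp σ0) e1 e2 he1 he2 η (hh1 _) (hh2 _) (s * k) j).2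
    rwa [hσr, Real.log_abs] at this
  refine P3_twolog hdeg σ0 g (ν0 * w) δ0 ((hIntg _ hi1 hi1' _).mul (hIntg _ hi2 hi2' _))
    (hν.mul ((hIntg _ hi1 hi1' _).mul (hIntg _ hi2 hi2' _))) hδ hgpos ?_ (by rw [map_mul]; positivity) hpδ
    (2 * k * η) (η * y) (by positivity) (by positivity) ?_ ?_ ?_ (hlg'.trans gb) ?_ K L R' S m Xm c1 c2 c3 c4 c5 c6
    ?_ c8
  · intro h
    have : g = 1 := σ0.injective (by rw [h, map_one])
    have := (hind _ _ this).1
    have : |s * (k:ℤ)| = 0 := by rw [this]; simp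
    omega
  · intro σ
    exact (L_log_zpow_prod σ e1 e2 he1 he2 η (hh1 _) (hh2 _) (s * k) j).1.trans (Real.exp_le_exp.2 gb)
  · intro σ
    rw [map_mul, norm_mul]
    have := (L_log_zpow_prod σ e1 e2 he1 he2 η (hh1 _) (hh2 _) (s * r1) r2).1
    calc _ ≤ Real.exp η * Real.exp ((|s * (r1:ℤ)| + |r2| : ℤ) * η) := by
          gcongr
          exact hhν σ
      _ = Real.exp (((|s * (r1:ℤ)| + |r2| : ℤ) + 1) * η) := by rw [← Real.exp_add]; congr 1; ring
      _ ≤ _ := Real.exp_le_exp.2 wb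
  · intro σ
    exact (hhδ σ).trans (Real.exp_le_exp.2 hηy)
  · rw [hlogνw]
    refine (abs_add_le _ _).trans ?_
    have : ((|s * (r1:ℤ)| + |r2| : ℤ) : ℝ) * η + η ≤ η * y := by linarith
    linarith
  · convert c7 using 3
    rw [hlogνw, hlogg, hlogw, hΛd, has, hXe, hbe]
    push_cast
    ring

end

section
open Finset

theorem P4_final {F : Type*} [Field F] [NumberField F] (hdeg : Module.finrank ℚ F ≤ 6)
    (σ0 : F →+* ℝ) (e1 e2 ν0 δ0 : F) (hi1 : IsIntegral ℤ e1) (hi1' : IsIntegral ℤ e1⁻¹)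
    (hi2 : IsIntegral ℤ e2) (hi2' : IsIntegral ℤ e2⁻¹) (hν : IsIntegral ℤ ν0) (hδ : IsIntegral ℤ δ0)
    (hp1 : 0 < σ0 e1) (hp2 : 0 < σ0 e2) (hpν : 0 < σ0 ν0) (hpδ : 0 < σ0 δ0) (η : ℕ) (hη : 1 ≤ η)
    (hh1 : ∀ σ : F →+* ℂ, |Real.log ‖σ e1‖| ≤ η) (hh2 : ∀ σ : F →+* ℂ, |Real.log ‖σ e2‖| ≤ η)
    (hhν : ∀ σ : F →+* ℂ, ‖σ ν0‖ ≤ Real.exp η) (hhδ : ∀ σ : F →+* ℂ, ‖σ δ0‖ ≤ Real.exp η)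
    (hνδ : |Real.log (σ0 ν0 / σ0 δ0)| ≤ 2 * η)
    (hind : ∀ i j : ℤ, e1 ^ i * e2 ^ j = 1 → i = 0 ∧ j = 0)
    (a b : ℤ) (X t0 : ℕ) (haX : |a| ≤ X) (hb : |b| ≤ X) (hab : |a| = X ∨ |b| = X)
    (ht : ∀ t ≥ t0, 20000000000 * η * (t + 1) ^ 2 ≤ 2 ^ t)
    (hΛ : |Real.log (σ0 ν0 / σ0 δ0) + a * Real.log (σ0 e1) + b * Real.log (σ0 e2)|
      ≤ Real.exp (-((X:ℝ) * η / 32))) : X < 2 ^ (3 * t0) := by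
  by_contra hX
  push Not at hX
  obtain ⟨p, hp1', hp2'⟩ : ∃ p, p ^ 3 ≤ X ∧ X < (p + 1) ^ 3 := by
    refine ⟨Nat.findGreatest (fun q => q ^ 3 ≤ X) X, ?_, ?_⟩
    · exact Nat.findGreatest_spec (P := fun q => q ^ 3 ≤ X) (Nat.zero_le X) (by simp)
    · by_contra h
      push Not at h
      have h1 := Nat.le_findGreatest (P := fun q => q ^ 3 ≤ X) (n := X)
        (m := Nat.findGreatest (fun q => q ^ 3 ≤ X) X + 1)
        ((Nat.le_self_pow (by norm_num) _).trans h) h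
      omega
  have hpt : 2 ^ t0 ≤ p := by
    by_contra h
    have h1 : p + 1 ≤ 2 ^ t0 := by omega
    have h2 : (p + 1) ^ 3 ≤ (2 ^ t0) ^ 3 := Nat.pow_le_pow_left h1 3
    rw [← pow_mul, mul_comm t0] at h2
    omega
  have hp0 : p ≠ 0 := by have := Nat.one_le_two_pow (n := t0); omega
  have hlog := Nat.pow_log_le_self 2 hp0
  have hlog2 := Nat.lt_pow_succ_log_self (b := 2) (by norm_num) p
  have hlt : t0 ≤ Nat.log 2 p := Nat.le_log_of_pow_le (by norm_num) hpt
  have hc := (ht _ hlt).trans hlog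
  have hp4 : 4 ≤ p := by
    refine le_trans ?_ hc
    have h1 : 1 ≤ (Nat.log 2 p + 1) ^ 2 := Nat.one_le_pow _ _ (by omega)
    have := Nat.mul_le_mul hη h1
    rw [mul_assoc]; omega
  have hX2 : X ≤ 2 * p ^ 3 := by
    obtain ⟨q, rfl⟩ := Nat.exists_eq_add_of_le hp4
    have : (4 + q + 1) ^ 3 ≤ 2 * (4 + q) ^ 3 := by ring_nf; nlinarith [Nat.zero_le q]
    omega
  rcases hab with h | h
  · exact P4_core hdeg σ0 e1 e2 ν0 δ0 hi1 hi1' hi2 hi2' hν hδ hp1 hp2 hpν hpδ η hη hh1 hh2 hhν hhδ hνδ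
      hind a b X p _ h hb hp1' hX2 hlog2 (by omega) hc hΛ
  · refine P4_core hdeg σ0 e2 e1 ν0 δ0 hi2 hi2' hi1 hi1' hν hδ hp2 hp1 hpν hpδ η hη hh2 hh1 hhν hhδ hνδ
      (fun i j hij => ((hind j i (by rw [mul_comm]; exact hij)).symm)) b a X p _ h haX hp1' hX2 hlog2
      (by omega) hc ?_
    convert hΛ using 2
    ring

end

section
open Finset

abbrev MP2 := MvPolynomial (Fin 2) ℝ

noncomputable def BD (a b : ℕ) : Submodule ℝ MP2 :=
  MvPolynomial.restrictSupport ℝ {s | s 0 ≤ a ∧ s 1 ≤ b}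

theorem mem_BD {a b : ℕ} {f : MP2} :
    f ∈ BD a b ↔ MvPolynomial.degreeOf 0 f ≤ a ∧ MvPolynomial.degreeOf 1 f ≤ b := by
  rw [BD, MvPolynomial.mem_restrictSupport_iff, MvPolynomial.degreeOf_le_iff,
    MvPolynomial.degreeOf_le_iff]
  constructor
  · intro h
    exact ⟨fun m hm => (h hm).1, fun m hm => (h hm).2⟩
  · intro h m hm
    exact ⟨h.1 m hm, h.2 m hm⟩

noncomputable def BDequiv (a b : ℕ) :
    {s : Fin 2 →₀ ℕ | s 0 ≤ a ∧ s 1 ≤ b} ≃ Fin (a + 1) × Fin (b + 1) where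
  toFun s := (⟨s.1 0, by have := s.2.1; omega⟩, ⟨s.1 1, by have := s.2.2; omega⟩)
  invFun p := ⟨Finsupp.equivFunOnFinite.symm ![p.1, p.2], by
    constructor
    · have := p.1.2; simp; omega
    · have := p.2.2; simp; omega⟩
  left_inv s := by
    ext i
    fin_cases i <;> simp
  right_inv p := by
    ext <;> simp

noncomputable instance (a b : ℕ) : Fintype {s : Fin 2 →₀ ℕ | s 0 ≤ a ∧ s 1 ≤ b} :=
  Fintype.ofEquiv _ (BDequiv a b).symm

instance (a b : ℕ) : Module.Finite ℝ (BD a b) :=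
  Module.Finite.of_basis (MvPolynomial.basisRestrictSupport ℝ _)

theorem finrank_BD (a b : ℕ) : Module.finrank ℝ (BD a b) = (a + 1) * (b + 1) := by
  have h := Module.finrank_eq_card_basis
    (MvPolynomial.basisRestrictSupport ℝ {s : Fin 2 →₀ ℕ | s 0 ≤ a ∧ s 1 ≤ b})
  rw [Fintype.card_congr (BDequiv a b)] at h
  rw [Fintype.card_prod, Fintype.card_fin, Fintype.card_fin] at h
  exact h

theorem L_finrank_map {V W : Type*} [AddCommGroup V] [Module ℝ V] [AddCommGroup W] [Module ℝ W]
    (f : V →ₗ[ℝ] W) (hf : Function.Injective f) (p : Submodule ℝ V) :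
    Module.finrank ℝ (p.map f) = Module.finrank ℝ p :=
  (LinearEquiv.finrank_eq (Submodule.equivMapOfInjective f hf p)).symm

theorem Z1_eval_surj (S : Finset (Fin 2 → ℝ)) (a b : ℕ) (ha : S.card ≤ a) (hb : S.card ≤ b)
    (s : Fin 2 → ℝ) (hs : s ∈ S) :
    ∃ f ∈ BD a b, ∀ t ∈ S, MvPolynomial.eval t f = if t = s then 1 else 0 := by
  classical
  have h1 : ∀ t ∈ S.erase s, ∃ i : Fin 2, s i ≠ t i := by
    intro t ht
    by_contra h
    push Not at h
    exact (mem_erase.1 ht).1 (funext fun i => (h i).symm)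
  choose! i hi using h1
  set g : MP2 := ∏ t ∈ S.erase s, (MvPolynomial.X (i t) - MvPolynomial.C (t (i t))) with hg
  have hgs : MvPolynomial.eval s g ≠ 0 := by
    rw [hg, map_prod]
    refine prod_ne_zero_iff.2 fun t ht => ?_
    simp [sub_ne_zero, hi t ht]
  have hdeg : ∀ j : Fin 2, MvPolynomial.degreeOf j g ≤ S.card := by
    intro j
    refine (MvPolynomial.degreeOf_prod_le _ _ _).trans ?_
    refine (sum_le_card_nsmul _ _ 1 fun t _ => ?_).trans ?_
    · refine (MvPolynomial.degreeOf_sub_le _ _ _).trans ?_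
      rw [MvPolynomial.degreeOf_C, MvPolynomial.degreeOf_X]
      split_ifs <;> simp
    · rw [smul_eq_mul, mul_one]; exact card_le_card (erase_subset _ _)
  refine ⟨MvPolynomial.C (MvPolynomial.eval s g)⁻¹ * g, ?_, ?_⟩
  · rw [mem_BD]
    exact ⟨(MvPolynomial.degreeOf_C_mul_le _ _ _).trans ((hdeg 0).trans ha),
      (MvPolynomial.degreeOf_C_mul_le _ _ _).trans ((hdeg 1).trans hb)⟩
  · intro t ht
    split_ifs with h
    · subst h; simp [hgs]
    · have : MvPolynomial.eval t g = 0 := by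
        rw [hg, map_prod]
        exact prod_eq_zero (mem_erase.2 ⟨h, ht⟩) (by simp)
      simp [this]

noncomputable def Z1_ev (S : Finset (Fin 2 → ℝ)) : MP2 →ₗ[ℝ] (S → ℝ) :=
  LinearMap.pi fun s => (MvPolynomial.aeval (R := ℝ) (s : Fin 2 → ℝ)).toLinearMap

theorem Z1_bezout (q f : MP2) (hq : Prime q) (hqf : ¬ q ∣ f) (S : Finset (Fin 2 → ℝ))
    (hS : ∀ s ∈ S, MvPolynomial.eval s q = 0 ∧ MvPolynomial.eval s f = 0) :
    S.card ≤ MvPolynomial.degreeOf 0 q * MvPolynomial.degreeOf 1 f +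
      MvPolynomial.degreeOf 1 q * MvPolynomial.degreeOf 0 f := by
  classical
  have hf0 : f ≠ 0 := by rintro rfl; exact hqf (dvd_zero _)
  obtain ⟨a1, ha1⟩ : ∃ a, a = MvPolynomial.degreeOf 0 q := ⟨_, rfl⟩
  obtain ⟨a2, ha2⟩ : ∃ a, a = MvPolynomial.degreeOf 1 q := ⟨_, rfl⟩
  obtain ⟨b1, hb1⟩ : ∃ a, a = MvPolynomial.degreeOf 0 f := ⟨_, rfl⟩
  obtain ⟨b2, hb2⟩ : ∃ a, a = MvPolynomial.degreeOf 1 f := ⟨_, rfl⟩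
  obtain ⟨N, hN⟩ : ∃ N, N = S.card := ⟨_, rfl⟩
  rw [← ha1, ← ha2, ← hb1, ← hb2]
  have hadd : ∀ (g w : MP2) (c d e1 e2 : ℕ), MvPolynomial.degreeOf 0 g ≤ e1 →
      MvPolynomial.degreeOf 1 g ≤ e2 → w ∈ BD c d → g * w ∈ BD (c + e1) (d + e2) := by
    intro g w c d e1 e2 h1 h2 hw
    rw [mem_BD] at hw ⊢
    constructor
    · refine (MvPolynomial.degreeOf_mul_le _ _ _).trans ?_; have := hw.1; omega
    · refine (MvPolynomial.degreeOf_mul_le _ _ _).trans ?_; have := hw.2; omega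
  -- main linear map
  let Ψ : (BD (N + b1) (N + b2) × BD (N + a1) (N + a2)) →ₗ[ℝ] MP2 :=
    LinearMap.coprod ((LinearMap.mulLeft ℝ q).comp (BD (N + b1) (N + b2)).subtype)
      ((LinearMap.mulLeft ℝ f).comp (BD (N + a1) (N + a2)).subtype)
  let Θ : BD N N →ₗ[ℝ] MP2 × MP2 :=
    LinearMap.prod ((LinearMap.mulLeft ℝ (-f)).comp (BD N N).subtype)
      ((LinearMap.mulLeft ℝ q).comp (BD N N).subtype)
  let J : (BD (N + b1) (N + b2) × BD (N + a1) (N + a2)) →ₗ[ℝ] MP2 × MP2 :=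
    LinearMap.prodMap (BD (N + b1) (N + b2)).subtype (BD (N + a1) (N + a2)).subtype
  have hJ : Function.Injective J := by
    rintro ⟨u, v⟩ ⟨u', v'⟩ h
    simp only [J, LinearMap.prodMap_apply, Submodule.subtype_apply, Prod.mk.injEq] at h
    exact Prod.ext (Subtype.ext h.1) (Subtype.ext h.2)
  have hker : Module.finrank ℝ (LinearMap.ker Ψ) ≤ (N + 1) * (N + 1) := by
    rw [← finrank_BD N N]
    have h1 : (LinearMap.ker Ψ).map J ≤ LinearMap.range Θ := by
      rintro _ ⟨⟨u, v⟩, huv, rfl⟩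
      have h0 : q * (u : MP2) + f * (v : MP2) = 0 := huv
      have hdvd : q ∣ f * (v : MP2) := ⟨-(u : MP2), by linear_combination h0⟩
      obtain ⟨w, hw⟩ := (hq.dvd_or_dvd hdvd).resolve_left hqf
      have hu : (u : MP2) = -f * w := by
        apply mul_left_cancel₀ hq.ne_zero
        rw [hw] at h0
        linear_combination h0
      have hwB : w ∈ BD N N := by
        by_cases hw0 : w = 0
        · rw [hw0]; exact Submodule.zero_mem _
        · have hv := mem_BD.1 v.2
          rw [hw, MvPolynomial.degreeOf_mul_eq hq.ne_zero hw0,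
            MvPolynomial.degreeOf_mul_eq hq.ne_zero hw0] at hv
          rw [mem_BD]; omega
      refine ⟨⟨w, hwB⟩, ?_⟩
      exact Prod.ext (by simp [Θ, J, hu]) (by simp [Θ, J, hw])
    have h2 := Submodule.finrank_mono h1
    rw [L_finrank_map J hJ] at h2
    exact h2.trans (LinearMap.finrank_range_le Θ)
  -- range
  have hrange : LinearMap.range Ψ ≤ (LinearMap.ker ((Z1_ev S).comp
      (BD (N + a1 + b1) (N + a2 + b2)).subtype)).map (BD (N + a1 + b1) (N + a2 + b2)).subtype := by
    rintro _ ⟨⟨u, v⟩, rfl⟩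
    have hm : q * (u : MP2) + f * (v : MP2) ∈ BD (N + a1 + b1) (N + a2 + b2) := by
      refine Submodule.add_mem _ ?_ ?_
      · have := hadd q u _ _ a1 a2 ha1.ge ha2.ge u.2
        rwa [show N + b1 + a1 = N + a1 + b1 by ring, show N + b2 + a2 = N + a2 + b2 by ring] at this
      · exact hadd f v _ _ b1 b2 hb1.ge hb2.ge v.2
    refine ⟨⟨_, hm⟩, ?_, rfl⟩
    ext s
    have := hS s.1 s.2
    simp [Z1_ev, MvPolynomial.aeval_eq_eval, this.1, this.2]
  have hsurj : Function.Surjective ((Z1_ev S).comp (BD (N + a1 + b1) (N + a2 + b2)).subtype) := by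
    rw [← LinearMap.range_eq_top, eq_top_iff, ← (Pi.basisFun ℝ S).span_eq, Submodule.span_le]
    rintro _ ⟨s, rfl⟩
    obtain ⟨g, hg, hge⟩ := Z1_eval_surj S (N + a1 + b1) (N + a2 + b2) (by omega) (by omega) s.1 s.2
    refine ⟨⟨g, hg⟩, ?_⟩
    ext t
    have := hge t.1 t.2
    simp only [Z1_ev, LinearMap.comp_apply, LinearMap.pi_apply, AlgHom.toLinearMap_apply,
      Submodule.subtype_apply, Pi.basisFun_apply, Pi.single_apply]
    refine Eq.trans (by rw [MvPolynomial.aeval_eq_eval]) (this.trans ?_)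
    simp only [Subtype.ext_iff]
  have e1 := LinearMap.finrank_range_add_finrank_ker ((Z1_ev S).comp
      (BD (N + a1 + b1) (N + a2 + b2)).subtype)
  rw [LinearMap.range_eq_top.2 hsurj, finrank_top, Module.finrank_fintype_fun_eq_card,
    Fintype.card_coe, finrank_BD] at e1
  have e2 := LinearMap.finrank_range_add_finrank_ker Ψ
  rw [Module.finrank_prod, finrank_BD, finrank_BD] at e2
  have e3 := Submodule.finrank_mono hrange
  rw [L_finrank_map _ (Submodule.subtype_injective _)] at e3
  nlinarith

end

section
open Finset

noncomputable def tau (v : Fin 2 → ℝ) : MP2 →ₐ[ℝ] MP2 :=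
  MvPolynomial.aeval (fun i => MvPolynomial.X i + MvPolynomial.C (v i))

theorem tau_eval (v z : Fin 2 → ℝ) (f : MP2) :
    MvPolynomial.eval z (tau v f) = MvPolynomial.eval (z + v) f := by
  unfold tau
  induction f using MvPolynomial.induction_on <;> simp_all

theorem tau_tau (v w : Fin 2 → ℝ) (f : MP2) : tau v (tau w f) = tau (v + w) f := by
  apply MvPolynomial.funext
  intro z
  simp only [tau_eval]
  rw [add_assoc]

theorem tau_zero (f : MP2) : tau 0 f = f := by
  apply MvPolynomial.funext
  intro z
  simp only [tau_eval, add_zero]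

noncomputable def tauE (v : Fin 2 → ℝ) : MP2 ≃ₐ[ℝ] MP2 :=
  AlgEquiv.ofAlgHom (tau v) (tau (-v))
    (by ext1 i; simp [tau_tau, tau_zero]) (by ext1 i; simp [tau_tau, tau_zero])

theorem tau_prime (v : Fin 2 → ℝ) (q : MP2) (hq : Prime q) : Prime (tau v q) :=
  (MulEquiv.prime_iff (tauE v).toMulEquiv).2 hq

theorem tau_degreeOf (v : Fin 2 → ℝ) (f : MP2) (i : Fin 2) :
    MvPolynomial.degreeOf i (tau v f) ≤ MvPolynomial.degreeOf i f := by
  unfold tau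
  rw [MvPolynomial.aeval_def, MvPolynomial.eval₂_eq']
  refine (MvPolynomial.degreeOf_sum_le _ _ _).trans ?_
  refine Finset.sup_le fun m hm => ?_
  have h1 : m i ≤ MvPolynomial.degreeOf i f := MvPolynomial.monomial_le_degreeOf i hm
  refine le_trans ?_ h1
  refine (MvPolynomial.degreeOf_C_mul_le _ _ _).trans ?_
  refine (MvPolynomial.degreeOf_prod_le _ _ _).trans ?_
  calc ∑ j : Fin 2, MvPolynomial.degreeOf i
        ((MvPolynomial.X j + MvPolynomial.C (v j) : MP2) ^ m j)
      ≤ ∑ j : Fin 2, if j = i then m i else 0 := by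
        refine sum_le_sum fun j _ => ?_
        refine (MvPolynomial.degreeOf_pow_le _ _ _).trans ?_
        have : MvPolynomial.degreeOf i (MvPolynomial.X j + MvPolynomial.C (v j) : MP2) ≤
            if j = i then 1 else 0 := by
          refine (MvPolynomial.degreeOf_add_le _ _ _).trans ?_
          rw [MvPolynomial.degreeOf_C, MvPolynomial.degreeOf_X]
          by_cases h : i = j
          · simp [h]
          · simp [h]
        split_ifs at this ⊢ with h
        · subst h; nlinarith
        · simp at this; simp [this]
    _ = m i := by simp

theorem Z2_factors (Q : MP2) (hQ : Q ≠ 0) : ∃ T : Finset MP2, (∀ q ∈ T, Prime q ∧ q ∣ Q) ∧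
    (∀ q ∈ T, ∀ q' ∈ T, Associated q q' → q = q') ∧
    (∀ q, Prime q → q ∣ Q → ∃ q' ∈ T, Associated q q') ∧
    (∀ z, MvPolynomial.eval z Q = 0 → ∃ q ∈ T, MvPolynomial.eval z q = 0) := by
  classical
  obtain ⟨f, hf, hfQ⟩ := UniqueFactorizationMonoid.exists_prime_factors Q hQ
  let o : MP2 → MP2 := fun b => Quot.out (Associates.mk b)
  have ho : ∀ b, Associated (o b) b := fun b =>
    Associates.mk_eq_mk_iff_associated.1 (Quot.out_eq (Associates.mk b))
  have hdv : ∀ b ∈ f, b ∣ Q := fun b hb => (Multiset.dvd_prod hb).trans hfQ.dvd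
  refine ⟨f.toFinset.image o, ?_, ?_, ?_, ?_⟩
  · intro q hq
    obtain ⟨b, hb, rfl⟩ := mem_image.1 hq
    rw [Multiset.mem_toFinset] at hb
    exact ⟨(ho b).symm.prime (hf b hb), (ho b).dvd.trans (hdv b hb)⟩
  · intro q hq q' hq' h
    obtain ⟨b, hb, rfl⟩ := mem_image.1 hq
    obtain ⟨b', hb', rfl⟩ := mem_image.1 hq'
    have : Associates.mk b = Associates.mk b' :=
      Associates.mk_eq_mk_iff_associated.2 (((ho b).symm.trans h).trans (ho b'))
    simp only [o, this]
  · intro q hq hqQ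
    obtain ⟨b, hb, hqb⟩ := hq.exists_mem_multiset_dvd (hqQ.trans hfQ.symm.dvd)
    exact ⟨o b, mem_image_of_mem _ (Multiset.mem_toFinset.2 hb),
      (hq.associated_of_dvd (hf b hb) hqb).trans (ho b).symm⟩
  · intro z hz
    have h1 : MvPolynomial.eval z f.prod = 0 := by
      obtain ⟨c, hc⟩ := hfQ.symm.dvd
      rw [hc, map_mul, hz, zero_mul]
    rw [map_multiset_prod, Multiset.prod_eq_zero_iff, Multiset.mem_map] at h1
    obtain ⟨b, hb, hbz⟩ := h1
    refine ⟨o b, mem_image_of_mem _ (Multiset.mem_toFinset.2 hb), ?_⟩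
    obtain ⟨c, hc⟩ := (ho b).symm.dvd
    rw [hc, map_mul, hbz, zero_mul]

theorem Z2_degsum (T : Finset MP2) (f : MP2) (hf : f ≠ 0) (hT : ∀ q ∈ T, Prime q ∧ q ∣ f)
    (hA : ∀ q ∈ T, ∀ q' ∈ T, Associated q q' → q = q')
    (d : MP2 → ℕ) (hd : ∀ a b, a ≠ 0 → b ≠ 0 → d (a * b) = d a + d b) :
    ∑ q ∈ T, d q ≤ d f := by
  classical
  have h1 : ∏ q ∈ T, q ∣ f := by
    refine Finset.prod_dvd_of_isRelPrime ?_ fun q hq => (hT q hq).2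
    intro a ha b hb hab
    simp only [Function.onFun]
    refine ((hT a ha).1.irreducible.isRelPrime_iff_not_dvd).2 fun h => ?_
    exact hab (hA a ha b hb ((hT a ha).1.associated_of_dvd (hT b hb).1 h))
  have hd1 : d 1 = 0 := by
    have := hd 1 1 one_ne_zero one_ne_zero
    simp at this; exact this
  have h2 : ∀ S ⊆ T, d (∏ q ∈ S, q) = ∑ q ∈ S, d q := by
    intro S
    induction S using Finset.induction_on with
    | empty => intro _; simp [hd1]
    | insert a s ha ih =>
      intro hs
      rw [prod_insert ha, sum_insert ha, hd, ih fun _ h => hs (mem_insert_of_mem h)]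
      · exact (hT a (hs (mem_insert_self _ _))).1.ne_zero
      · exact prod_ne_zero_iff.2 fun q hq => (hT q (hs (mem_insert_of_mem hq))).1.ne_zero
  obtain ⟨c, hc⟩ := h1
  rw [← h2 T subset_rfl]
  have hne := hf
  rw [hc] at hne
  rw [hc, hd _ _ (left_ne_zero_of_mul hne) (right_ne_zero_of_mul hne)]
  omega

theorem Z2_dvd (q f : MP2) (hq : Prime q) (z v : Fin 2 → ℝ) (hv : v ≠ 0)
    (h1 : ∀ j : ℕ, MvPolynomial.eval (z + (j : ℝ) • v) q = 0)
    (h2 : ∀ j : ℕ, MvPolynomial.eval (z + (j : ℝ) • v) f = 0) : q ∣ f := by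
  classical
  by_contra h
  obtain ⟨N, hN⟩ : ∃ N, N = MvPolynomial.degreeOf 0 q * MvPolynomial.degreeOf 1 f +
      MvPolynomial.degreeOf 1 q * MvPolynomial.degreeOf 0 f := ⟨_, rfl⟩
  have := Z1_bezout q f hq h ((range (N + 1)).image fun j : ℕ => z + (j : ℝ) • v) (by
    intro s hs
    obtain ⟨j, _, rfl⟩ := mem_image.1 hs
    exact ⟨h1 j, h2 j⟩)
  rw [card_image_of_injective, card_range] at this
  · omega
  · intro a b hab
    have h3 : ((a : ℝ) - b) • v = 0 := by
      rw [sub_smul, sub_eq_zero]; exact add_left_cancel hab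
    rcases smul_eq_zero.1 h3 with h4 | h4
    · exact_mod_cast sub_eq_zero.1 h4
    · exact absurd h4 hv

theorem Z2_deg_pos (q : MP2) (hq0 : Prime q) :
    1 ≤ MvPolynomial.degreeOf 0 q + MvPolynomial.degreeOf 1 q := by
  by_contra h0
  have h00 : MvPolynomial.totalDegree q = 0 := by
    rw [MvPolynomial.totalDegree_eq_zero_iff]
    intro m hm i
    have h3 := MvPolynomial.monomial_le_degreeOf i hm
    fin_cases i <;> simp only [Fin.zero_eta, Fin.mk_one] at h3 ⊢ <;> omega
  rw [MvPolynomial.totalDegree_eq_zero_iff_eq_C] at h00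
  have hp := hq0
  rw [h00] at hp
  refine hp.not_isUnit ?_
  refine (IsUnit.mk0 (MvPolynomial.coeff 0 q) ?_).map MvPolynomial.C
  intro h1
  rw [h1, map_zero] at hp
  exact hp.ne_zero rfl

theorem Z2_period (q Q : MP2) (hQ : Q ≠ 0) (hq : Prime q) (D : ℕ)
    (hD : ∀ i, MvPolynomial.degreeOf i Q ≤ D) (S : Finset (Fin 2 → ℝ)) (hS : 2 * D < S.card)
    (h : ∀ s ∈ S, q ∣ tau s Q) :
    ∃ v : Fin 2 → ℝ, v ≠ 0 ∧ ∀ z, MvPolynomial.eval z q = 0 → MvPolynomial.eval (z + v) q = 0 := by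
  classical
  obtain ⟨T, hT1, hT2, hT3, -⟩ := Z2_factors Q hQ
  have hcard : T.card ≤ 2 * D := by
    have e : ∀ i, ∑ q ∈ T, MvPolynomial.degreeOf i q ≤ D := fun i =>
      (Z2_degsum T Q hQ hT1 hT2 _ fun a b ha hb => MvPolynomial.degreeOf_mul_eq ha hb).trans (hD i)
    have : T.card ≤ ∑ q ∈ T, (MvPolynomial.degreeOf 0 q + MvPolynomial.degreeOf 1 q) := by
      rw [card_eq_sum_ones]
      refine sum_le_sum fun q hq => ?_
      exact Z2_deg_pos q (hT1 q hq).1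
    rw [sum_add_distrib] at this
    have := e 0; have := e 1; omega
  have hf : ∀ s ∈ S, ∃ q' ∈ T, Associated (tau (-s) q) q' := by
    intro s hs
    refine hT3 _ (tau_prime _ _ hq) ?_
    have := map_dvd (tau (-s)) (h s hs)
    rwa [tau_tau, neg_add_cancel, tau_zero] at this
  choose! φ hφ1 hφ2 using hf
  obtain ⟨s, hs, s', hs', hne, heq⟩ := exists_ne_map_eq_of_card_lt_of_maps_to
    (s := S) (t := T) (f := φ) (by omega) hφ1
  have ha : Associated (tau (-s) q) (tau (-s') q) := by
    have := hφ2 s hs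
    rw [heq] at this
    exact this.trans (hφ2 s' hs').symm
  have hdv := map_dvd (tau s) ha.dvd
  rw [tau_tau, tau_tau, add_neg_cancel, tau_zero] at hdv
  refine ⟨s + -s', by rwa [← sub_eq_add_neg, sub_ne_zero], fun z hz => ?_⟩
  obtain ⟨c, hc⟩ := hdv
  rw [← tau_eval, hc, map_mul, hz, zero_mul]

end

section
open Finset

/-- restriction of a polynomial to a line -/
noncomputable def resL (z v : Fin 2 → ℝ) (f : MP2) : Polynomial ℝ :=
  MvPolynomial.aeval (fun i => Polynomial.C (z i) + Polynomial.X * Polynomial.C (v i)) f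

theorem resL_eval (z v : Fin 2 → ℝ) (f : MP2) (t : ℝ) :
    (resL z v f).eval t = MvPolynomial.eval (z + t • v) f := by
  unfold resL
  induction f using MvPolynomial.induction_on <;> simp_all
  left; ring

theorem resL_deg (z v : Fin 2 → ℝ) (f : MP2) : (resL z v f).natDegree ≤ f.totalDegree := by
  unfold resL
  have := MvPolynomial.aeval_natDegree_le (F := f) (m := f.totalDegree) le_rfl
    (fun i => Polynomial.C (z i) + Polynomial.X * Polynomial.C (v i)) (n := 1) (by
      intro i; compute_degree)
  simpa using this

theorem Z2_lineb {G : Type*} [AddCommGroup G] [DecidableEq G] (x : G →+ (Fin 2 → ℝ)) (Y : G → ℝ)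
    (hY0 : ∀ g, Y g ≠ 0) (hYm : ∀ g h, Y (g + h) = Y g * Y h) (hYi : Function.Injective Y)
    {L K m : ℕ} (hm : m ≤ K) (p : Fin L → MP2)
    (hpK : ∀ l, (p l).totalDegree < K) (Full I : Finset G)
    (hv : ∀ g ∈ Full, ∑ l : Fin L, MvPolynomial.eval (x g) (p l) * Y g ^ (l : ℕ) = 0)
    (hxI : Set.InjOn x I) (cell : G → Fin m)
    (hcell : ∀ g ∈ I, ∀ h ∈ I, cell g = cell h → ∀ i ∈ I, i + (g - h) ∈ Full)
    (z0 v : Fin 2 → ℝ) (hI : ∀ g ∈ I, ∃ t : ℝ, x g = z0 + t • v)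
    (l0 : Fin L) (hl0 : resL z0 v (p l0) ≠ 0) : I.card ≤ L * K := by
  classical
  by_contra hcon
  push Not at hcon
  have hL : 0 < L := l0.pos
  obtain ⟨c, -, hc⟩ := exists_lt_card_fiber_of_mul_lt_card_of_maps_to (s := I) (t := univ)
    (f := cell) (n := L) (fun _ _ => mem_univ _) (by
      rw [card_univ, Fintype.card_fin]
      calc m * L ≤ K * L := Nat.mul_le_mul_right _ hm
        _ = L * K := mul_comm _ _
        _ < _ := hcon)
  obtain ⟨J, hJ, hJc⟩ := exists_subset_card_eq hc.le
  let e := (J.equivFinOfCardEq hJc).symm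
  let g : Fin L → G := fun j => (e j : G)
  have hg : ∀ j, g j ∈ I ∧ cell (g j) = c := fun j => by
    have := hJ (e j).2
    simpa using this
  have hginj : Function.Injective g := fun a b h => e.injective (Subtype.ext h)
  let j0 : Fin L := ⟨0, hL⟩
  let d : Fin L → G := fun j => g j - g j0
  choose! t ht using hI
  have hη : Function.Injective fun j => Y (d j) := by
    intro a b h
    exact hginj (sub_left_injective (hYi h))
  obtain ⟨C', hC'⟩ := P2_vander (RingHom.id ℝ) (fun j => Y (d j)) hη
  let pr : Fin L → Polynomial ℝ := fun l => resL z0 v (p l)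
  let zz : Fin L → ℝ := fun j => t (g j) - t (g j0)
  obtain ⟨hne, hdeg⟩ := P2_main pr zz (fun j => Y (d j)) C' (by simpa using hC')
  have hroot : ∀ i ∈ I, (P2Q pr zz (fun j => Y (d j)) C').eval (t i) = 0 := by
    intro i hi
    refine P2_vanish pr ⟨l0, hl0⟩ zz (fun j => Y (d j)) C' (Polynomial.evalRingHom (t i)) (Y i)
      (hY0 i) fun s => ?_
    have h1 := hv _ (hcell (g s) (hg s).1 (g j0) (hg j0).1 ((hg s).2.trans (hg j0).2.symm) i hi)
    rw [← h1]
    refine sum_congr rfl fun l _ => ?_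
    have h2 : x (i + (g s - g j0)) = z0 + (t i + zz s) • v := by
      rw [map_add, map_sub, ht i hi, ht _ (hg s).1, ht _ (hg j0).1]
      simp only [zz]
      module
    rw [h2, hYm, ← resL_eval]
    simp [pr, d]
  have hcard : I.card ≤ (P2Q pr zz (fun j => Y (d j)) C').natDegree := by
    have h1 : (I.image t).card ≤ (P2Q pr zz (fun j => Y (d j)) C').natDegree := by
      refine Polynomial.card_le_degree_of_subset_roots ?_
      intro a ha
      rw [Finset.mem_val, mem_image] at ha
      obtain ⟨i, hi, rfl⟩ := ha
      exact (Polynomial.mem_roots hne).2 (hroot i hi)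
    rwa [card_image_of_injOn] at h1
    intro a ha b hb hab
    refine hxI ha hb ?_
    rw [ht a ha, ht b hb]
    rw [show t a = t b from hab]
  have hsum : ∑ l, (pr l).natDegree ≤ L * K := by
    calc ∑ l, (pr l).natDegree ≤ ∑ l : Fin L, K :=
          sum_le_sum fun l _ => (resL_deg _ _ _).trans (hpK l).le
      _ = L * K := by simp
  omega

theorem Z2_main {G : Type*} [AddCommGroup G] [DecidableEq G] (x : G →+ (Fin 2 → ℝ)) (Y : G → ℝ)
    (hY0 : ∀ g, Y g ≠ 0) (hYm : ∀ g h, Y (g + h) = Y g * Y h) (hYi : Function.Injective Y)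
    {L K m M0 : ℕ} (hm : m ≤ K) (p : Fin L → MP2) (l0 : Fin L) (hl0 : p l0 ≠ 0)
    (hpK : ∀ l, (p l).totalDegree < K) (Full I S : Finset G)
    (hv : ∀ g ∈ Full, ∑ l : Fin L, MvPolynomial.eval (x g) (p l) * Y g ^ (l : ℕ) = 0)
    (Q : MP2) (hQ : Q ≠ 0) (hQd : ∀ i, MvPolynomial.degreeOf i Q ≤ L * K)
    (hQI : ∀ g ∈ I, MvPolynomial.eval (x g) Q = 0)
    (hQS : ∀ g ∈ I, ∀ s ∈ S, MvPolynomial.eval (x (g + s)) Q = 0)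
    (hxI : Set.InjOn x I) (hxS : Set.InjOn x S) (hS : 2 * (L * K) < S.card)
    (hline : ∀ a b c : ℝ, (a ≠ 0 ∨ b ≠ 0) → ∀ J ⊆ I,
      (∀ g ∈ J, a * x g 0 + b * x g 1 = c) → J.card ≤ M0)
    (cell : G → Fin m)
    (hcell : ∀ g ∈ I, ∀ h ∈ I, cell g = cell h → ∀ i ∈ I, i + (g - h) ∈ Full) :
    I.card ≤ K * M0 + 2 * (L * K) ^ 2 := by
  classical
  obtain ⟨T, hT1, hT2, hT3, hT4⟩ := Z2_factors Q hQ
  obtain ⟨D, hD⟩ : ∃ D, D = L * K := ⟨_, rfl⟩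
  let J : MP2 → Finset G := fun q => I.filter fun g => MvPolynomial.eval (x g) q = 0
  have hcover : I.card ≤ ∑ q ∈ T, (J q).card := by
    refine le_trans (card_le_card ?_) card_biUnion_le
    intro g hg
    obtain ⟨q, hq, hqz⟩ := hT4 _ (hQI g hg)
    exact mem_biUnion.2 ⟨q, hq, mem_filter.2 ⟨hg, hqz⟩⟩
  have hdiv : ∀ q ∈ T, (J q).card ≤ (if ∀ l, q ∣ p l then M0 else 0) +
      (MvPolynomial.degreeOf 0 q + MvPolynomial.degreeOf 1 q) * D := by
    intro q hqT
    have hqp := (hT1 q hqT).1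
    have hdp := Z2_deg_pos q hqp
    by_cases hc : ∃ s ∈ S, ¬ q ∣ tau (x s) Q
    · obtain ⟨s, hs, hsq⟩ := hc
      have hb := Z1_bezout q (tau (x s) Q) hqp hsq ((J q).image x) (by
        intro z hz
        obtain ⟨g, hg, rfl⟩ := mem_image.1 hz
        obtain ⟨hgI, hgq⟩ := mem_filter.1 hg
        refine ⟨hgq, ?_⟩
        rw [tau_eval, ← map_add]
        exact hQS g hgI s hs)
      rw [card_image_of_injOn (hxI.mono (by intro a ha; exact (mem_filter.1 ha).1))] at hb
      have h0 := (tau_degreeOf (x s) Q 0).trans (hQd 0)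
      have h1 := (tau_degreeOf (x s) Q 1).trans (hQd 1)
      rw [← hD] at h0 h1
      have := Nat.mul_le_mul_left (MvPolynomial.degreeOf 0 q) h1
      have := Nat.mul_le_mul_left (MvPolynomial.degreeOf 1 q) h0
      rw [add_mul]; omega
    · push Not at hc
      obtain ⟨v, hv0, hper⟩ := Z2_period q Q hQ hqp (L * K) hQd (S.image x)
        (by rwa [card_image_of_injOn hxS]) (by
          intro z hz
          obtain ⟨s, hs, rfl⟩ := mem_image.1 hz
          exact hc s hs)
      rcases (J q).eq_empty_or_nonempty with hJe | ⟨g0, hg0⟩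
      · rw [hJe]; simp
      obtain ⟨hg0I, hg0q⟩ := mem_filter.1 hg0
      obtain ⟨z0, hz0⟩ : ∃ z0, z0 = x g0 := ⟨_, rfl⟩
      rw [← hz0] at hg0q
      have hzer : ∀ j : ℕ, MvPolynomial.eval (z0 + (j : ℝ) • v) q = 0 := by
        intro j
        induction j with
        | zero => simpa using hg0q
        | succ j ih =>
          have := hper _ ih
          rw [← this]; congr 2; push_cast; module
      have hlam := Z2_dvd q (MvPolynomial.C (v 1) * (MvPolynomial.X 0 - MvPolynomial.C (z0 0)) -
        MvPolynomial.C (v 0) * (MvPolynomial.X 1 - MvPolynomial.C (z0 1))) hqp z0 v hv0 hzer (by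
          intro j; simp; ring)
      have hlin : ∀ z, MvPolynomial.eval z q = 0 → v 1 * (z 0 - z0 0) - v 0 * (z 1 - z0 1) = 0 := by
        intro z hz
        obtain ⟨c, hc⟩ := hlam
        have := congrArg (MvPolynomial.eval z) hc
        rw [map_mul, hz, zero_mul] at this
        simpa using this
      have hvv : v 0 ≠ 0 ∨ v 1 ≠ 0 := by
        by_contra h
        push Not at h
        exact hv0 (by ext i; fin_cases i <;> simp [h])
      split_ifs with hall
      · have := hline (v 1) (-v 0) (v 1 * z0 0 - v 0 * z0 1) (by
          rcases hvv with h | h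
          · right; simpa using h
          · left; exact h) (J q) (filter_subset _ _) (by
          intro g hg
          have := hlin _ (mem_filter.1 hg).2
          linarith)
        omega
      · push Not at hall
        obtain ⟨l1, hl1⟩ := hall
        have hJI : J q ⊆ I := filter_subset _ _
        have := Z2_lineb x Y hY0 hYm hYi hm p hpK Full (J q) hv
          (hxI.mono (by intro a ha; exact hJI ha)) cell
          (fun g hg h hh hgh i hi => hcell g (hJI hg) h (hJI hh) hgh i (hJI hi)) z0 v (by
            intro g hg
            have h1 := hlin _ (mem_filter.1 hg).2
            rcases hvv with h | h
            · refine ⟨(x g 0 - z0 0) / v 0, ?_⟩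
              ext i; fin_cases i
              · simp; field_simp; ring
              · simp; field_simp; linarith
            · refine ⟨(x g 1 - z0 1) / v 1, ?_⟩
              ext i; fin_cases i
              · simp; field_simp; linarith
              · simp; field_simp; ring) l1 (by
            intro h0
            refine hl1 (Z2_dvd q (p l1) hqp z0 v hv0 hzer fun j => ?_)
            rw [← resL_eval, h0, Polynomial.eval_zero])
        rw [← hD] at this
        nlinarith
  have h1 : ∑ q ∈ T, (if ∀ l, q ∣ p l then M0 else 0) ≤ K * M0 := by
    rw [← sum_filter, sum_const, smul_eq_mul]
    refine Nat.mul_le_mul_right _ ?_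
    have hle := Z2_degsum (T.filter fun q => ∀ l, q ∣ p l) (p l0) hl0
      (fun q hq => ⟨(hT1 q (mem_filter.1 hq).1).1, (mem_filter.1 hq).2 l0⟩)
      (fun q hq q' hq' => hT2 q (mem_filter.1 hq).1 q' (mem_filter.1 hq').1)
      MvPolynomial.totalDegree (fun a b ha hb => MvPolynomial.totalDegree_mul_of_isDomain ha hb)
    have : (T.filter fun q => ∀ l, q ∣ p l).card ≤
        ∑ q ∈ T.filter fun q => ∀ l, q ∣ p l, MvPolynomial.totalDegree q := by
      rw [card_eq_sum_ones]
      refine sum_le_sum fun q hq => ?_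
      have h3 := Z2_deg_pos q (hT1 q (mem_filter.1 hq).1).1
      have h4 := MvPolynomial.degreeOf_le_totalDegree q 0
      have h5 := MvPolynomial.degreeOf_le_totalDegree q 1
      omega
    have := hpK l0
    omega
  have h2 : ∑ q ∈ T, (MvPolynomial.degreeOf 0 q + MvPolynomial.degreeOf 1 q) * D ≤ 2 * D ^ 2 := by
    rw [← sum_mul, sum_add_distrib]
    have e : ∀ i, ∑ q ∈ T, MvPolynomial.degreeOf i q ≤ D := fun i => by
      rw [hD]
      exact (Z2_degsum T Q hQ hT1 hT2 _ fun a b ha hb =>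
        MvPolynomial.degreeOf_mul_eq ha hb).trans (hQd i)
    have := e 0; have := e 1
    nlinarith
  have h3 := sum_le_sum hdiv
  rw [sum_add_distrib] at h3
  rw [← hD]
  omega

end

section
open Finset Polynomial

theorem Z3_shift (c : ℝ) (f : MP2) :
    Polynomial.Bivariate.equivMvPolynomial ℝ
      (((Polynomial.Bivariate.equivMvPolynomial ℝ).symm f).comp (X + C (C c))) = tau ![0, c] f := by
  induction f using MvPolynomial.induction_on with
  | C a =>
    have h1 : (Polynomial.Bivariate.equivMvPolynomial ℝ).symm (MvPolynomial.C a) = C (C a) := by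
      rw [AlgEquiv.symm_apply_eq, Polynomial.Bivariate.equivMvPolynomial_C_C]
    rw [h1, C_comp, Polynomial.Bivariate.equivMvPolynomial_C_C]
    simp [tau]
  | add p q hp hq => rw [map_add, add_comp, map_add, hp, hq, map_add]
  | mul_X p i hp =>
    rw [map_mul, mul_comp, map_mul, hp, map_mul]
    congr 1
    fin_cases i
    · simp only [Fin.zero_eta, Polynomial.Bivariate.equivMvPolynomial_symm_X_0, C_comp,
        Polynomial.Bivariate.equivMvPolynomial_C_X]
      simp [tau]
    · simp only [Fin.mk_one, Polynomial.Bivariate.equivMvPolynomial_symm_X_1, X_comp, map_add,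
        Polynomial.Bivariate.equivMvPolynomial_X, Polynomial.Bivariate.equivMvPolynomial_C_C]
      simp [tau]

theorem Z3_detdeg {ι : Type*} [Fintype ι] [DecidableEq ι] (E : Matrix ι ι MP2) (i : Fin 2) (K : ℕ)
    (h : ∀ a b, MvPolynomial.degreeOf i (E a b) ≤ K) :
    MvPolynomial.degreeOf i E.det ≤ Fintype.card ι * K := by
  rw [Matrix.det_apply']
  refine (MvPolynomial.degreeOf_sum_le _ _ _).trans (Finset.sup_le fun σ _ => ?_)
  have e : ((((Equiv.Perm.sign σ : ℤˣ) : ℤ)) : MP2) =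
      MvPolynomial.C ((((Equiv.Perm.sign σ : ℤˣ) : ℤ)) : ℝ) := by simp
  rw [e]
  refine (MvPolynomial.degreeOf_C_mul_le _ _ _).trans ?_
  refine (MvPolynomial.degreeOf_prod_le _ _ _).trans ?_
  refine (sum_le_card_nsmul _ _ K fun j _ => h _ _).trans ?_
  simp

theorem Z3_Q {L K : ℕ} (p : Fin L → MP2) (l0 : Fin L) (hl0 : p l0 ≠ 0)
    (hpK : ∀ l, (p l).totalDegree < K) (ζ η : Fin L → ℝ) (hη : Function.Injective η) :
    ∃ Q : MP2, Q ≠ 0 ∧ (∀ i, MvPolynomial.degreeOf i Q ≤ L * K) ∧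
      ∀ (z : Fin 2 → ℝ) (y : ℝ), y ≠ 0 →
        (∀ s, ∑ l : Fin L, MvPolynomial.eval (z + ![0, ζ s]) (p l) * (y * η s) ^ (l : ℕ) = 0) →
        MvPolynomial.eval z Q = 0 := by
  classical
  obtain ⟨C', hC'⟩ := P2_vander (RingHom.id ℝ) η hη
  set e := Polynomial.Bivariate.equivMvPolynomial ℝ with he
  let p' : Fin L → ℝ[X][X] := fun l => e.symm (p l)
  let C'' : Fin L → Fin L → ℝ[X] := fun a s => C (C' a s)
  have hC'' : ∀ a l : Fin L, ∑ s, C'' a s * (fun s => C (η s)) s ^ (l : ℕ) =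
      if a = l then (1 : ℝ[X]) else 0 := by
    intro a l
    have := congrArg (C : ℝ →+* ℝ[X]) (hC' a l)
    simp only [RingHom.id_apply, map_sum, map_mul, map_pow] at this
    rw [this]; split_ifs <;> simp
  obtain ⟨hne, -⟩ := P2_main p' (fun s => C (ζ s)) (fun s => C (η s)) C'' hC''
  refine ⟨e (P2Q p' (fun s => C (ζ s)) (fun s => C (η s)) C''), ?_, ?_, ?_⟩
  · simpa using hne
  · intro i
    unfold P2Q
    have hm := RingHom.map_det (e : ℝ[X][X] →+* MP2)
      (Matrix.of fun a l : {l : Fin L // p' l ≠ 0} => P2E p' (fun s => C (ζ s)) (fun s => C (η s)) C'' a l)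
    have hm2 : e (Matrix.of fun a l : {l : Fin L // p' l ≠ 0} =>
      P2E p' (fun s => C (ζ s)) (fun s => C (η s)) C'' a l).det = _ := hm
    have : e (Matrix.det (Matrix.of fun a l : {l : Fin L // p' l ≠ 0} =>
      P2E p' (fun s => C (ζ s)) (fun s => C (η s)) C'' a l)) = _ := hm2
    have hle : MvPolynomial.degreeOf i (e (Matrix.of fun a l : {l : Fin L // p' l ≠ 0} =>
      P2E p' (fun s => C (ζ s)) (fun s => C (η s)) C'' a l).det) ≤ L * K := by
      rw [this]
      refine (Z3_detdeg _ i K ?_).trans (Nat.mul_le_mul_right _ ?_)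
      · intro a l
        simp only [RingHom.mapMatrix_apply, Matrix.map_apply, Matrix.of_apply, P2E, map_sum,
          map_mul, C'']
        refine (MvPolynomial.degreeOf_sum_le _ _ _).trans (Finset.sup_le fun s _ => ?_)
        have h1 : (e : ℝ[X][X] →+* MP2) ((p' l).comp (X + C (C (ζ s)))) = tau ![0, ζ s] (p l) :=
          Z3_shift _ _
        have h2 : (e : ℝ[X][X] →+* MP2) (C (C (C' a s))) = MvPolynomial.C (C' a s) :=
          Polynomial.Bivariate.equivMvPolynomial_C_C (R := ℝ)
        have h3 : (e : ℝ[X][X] →+* MP2) (C (C (η s) ^ (l.1 : ℕ))) = MvPolynomial.C (η s ^ (l.1 : ℕ)) := by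
          rw [← map_pow]
          exact Polynomial.Bivariate.equivMvPolynomial_C_C (R := ℝ)
        rw [h1, h2, h3, ← map_mul]
        refine (MvPolynomial.degreeOf_C_mul_le _ _ _).trans ?_
        refine (tau_degreeOf _ _ _).trans ?_
        exact (MvPolynomial.degreeOf_le_totalDegree _ _).trans (hpK _).le
      · refine (Fintype.card_subtype_le _).trans ?_
        simp
    convert hle
  · intro z y hy hs
    refine P2_vanish p' ⟨l0, by simpa [p'] using hl0⟩ _ _ C''
      ((MvPolynomial.eval z).comp (e : ℝ[X][X] →+* MP2)) y hy fun s => ?_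
    rw [← hs s]
    refine sum_congr rfl fun l _ => ?_
    have h1 : (e : ℝ[X][X] →+* MP2) ((p' l).comp (X + C (C (ζ s)))) = tau ![0, ζ s] (p l) :=
      Z3_shift _ _
    have h2 : (e : ℝ[X][X] →+* MP2) (C (C (η s))) = MvPolynomial.C (η s) :=
      Polynomial.Bivariate.equivMvPolynomial_C_C (R := ℝ)
    rw [RingHom.comp_apply, RingHom.comp_apply, h1, h2, tau_eval, MvPolynomial.eval_C]

end

section
open Finset

theorem Z4_line (n c c' : ℕ) (hc : c = 32 * c') (k l : ℤ) (hk : k ≠ 0)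
    (hθ : ∀ v1 v2 : ℤ, (v1 ≠ 0 ∨ v2 ≠ 0) → |v1| < 32 → |v2| < 32 →
      768 * c * |k| < n * |v2 * k + v1 * l|)
    (a b e : ℝ) (hab : a ≠ 0 ∨ b ≠ 0) (J : Finset (ℤ × ℤ × ℤ))
    (hJ : ∀ g ∈ J, |g.1| ≤ 6 * c ∧ |g.2.1| ≤ 6 * c ∧ |g.2.2| ≤ 6 * c)
    (hJl : ∀ g ∈ J, a * ((g.2.1 * k - g.2.2 * n * l : ℤ) : ℝ) + b * ((g.1 + g.2.2 * n : ℤ) : ℝ) = e) :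
    J.card ≤ (12 * c + 1) * (12 * c' + 1) := by
  classical
  have hkR : (k : ℝ) ≠ 0 := by exact_mod_cast hk
  -- same slice relation
  have hsl : ∀ g ∈ J, ∀ g' ∈ J, g.2.2 = g'.2.2 →
      a * k * ((g.2.1 - g'.2.1 : ℤ) : ℝ) = - (b * ((g.1 - g'.1 : ℤ) : ℝ)) := by
    intro g hg g' hg' h
    have h1 := hJl g hg
    have h2 := hJl g' hg'
    rw [h] at h1
    push_cast at h1 h2 ⊢
    linarith
  by_cases hA : ∃ g ∈ J, ∃ g' ∈ J, g ≠ g' ∧ g.2.2 = g'.2.2 ∧ |g.1 - g'.1| < 32 ∧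
      |g.2.1 - g'.2.1| < 32
  · obtain ⟨g, hg, g', hg', hne, ht, h1, h2⟩ := hA
    have hv := hsl g hg g' hg' ht
    obtain ⟨v1, hv1⟩ : ∃ v, v = g.1 - g'.1 := ⟨_, rfl⟩
    obtain ⟨v2, hv2⟩ : ∃ v, v = g.2.1 - g'.2.1 := ⟨_, rfl⟩
    rw [← hv1] at h1 hv
    rw [← hv2] at h2 hv
    have hv0 : v1 ≠ 0 ∨ v2 ≠ 0 := by
      by_contra h
      push Not at h
      apply hne
      refine Prod.ext ?_ (Prod.ext ?_ ht)
      · have := h.1; omega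
      · have := h.2; omega
    have hθv := hθ v1 v2 hv0 h1 h2
    have hsame : ∀ p ∈ J, ∀ p' ∈ J, p.2.2 = p'.2.2 := by
      intro p hp p' hp'
      by_contra hne3
      have e1 := hJl p hp
      have e2 := hJl p' hp'
      obtain ⟨w1, hw1⟩ : ∃ v, v = p.1 - p'.1 := ⟨_, rfl⟩
      obtain ⟨w2, hw2⟩ : ∃ v, v = p.2.1 - p'.2.1 := ⟨_, rfl⟩
      obtain ⟨w3, hw3⟩ : ∃ v, v = p.2.2 - p'.2.2 := ⟨_, rfl⟩
      have e3 : a * ((w2 * k - w3 * n * l : ℤ) : ℝ) + b * ((w1 + w3 * n : ℤ) : ℝ) = 0 := by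
        rw [hw1, hw2, hw3]
        push_cast at e1 e2 ⊢
        linarith
      have hw30 : w3 ≠ 0 := by omega
      have e4 : v2 * k * (w1 + w3 * n) - v1 * (w2 * k - w3 * n * l) = 0 := by
        have hR : ((v2 * k * (w1 + w3 * n) - v1 * (w2 * k - w3 * n * l) : ℤ) : ℝ) = 0 := by
          push_cast at hv e3 ⊢
          rcases hab with ha | hb
          · have : a * (v2 * k * (w1 + w3 * n) - v1 * (w2 * k - w3 * n * l) : ℝ) = 0 := by
              linear_combination ((w1 : ℝ) + w3 * n) * hv - (v1 : ℝ) * e3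
            exact (mul_eq_zero.1 this).resolve_left ha
          · have : b * (v2 * k * (w1 + w3 * n) - v1 * (w2 * k - w3 * n * l) : ℝ) = 0 := by
              linear_combination -((w2 : ℝ) * k - w3 * n * l) * hv + (v2 : ℝ) * k * e3
            exact (mul_eq_zero.1 this).resolve_left hb
        exact_mod_cast hR
      have e5 : w3 * (n * (v2 * k + v1 * l)) = k * (v1 * w2 - v2 * w1) := by linear_combination e4
      have e6 := congrArg abs e5
      rw [abs_mul, abs_mul, abs_mul k, Nat.abs_cast] at e6
      have hp1 := hJ p hp
      have hp2 := hJ p' hp'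
      have b1 : |w1| ≤ 12 * c := by
        rw [hw1]; exact (abs_sub _ _).trans (by linarith [hp1.1, hp2.1])
      have b2 : |w2| ≤ 12 * c := by
        rw [hw2]; exact (abs_sub _ _).trans (by linarith [hp1.2.1, hp2.2.1])
      have b3 : |v1 * w2 - v2 * w1| ≤ 768 * c := by
        refine (abs_sub _ _).trans ?_
        rw [abs_mul, abs_mul]
        have := mul_le_mul h1.le b2 (abs_nonneg _) (by norm_num)
        have := mul_le_mul h2.le b1 (abs_nonneg _) (by norm_num)
        linarith
      have b4 : 1 ≤ |w3| := Int.one_le_abs hw30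
      have b5 : (0:ℤ) ≤ n * |v2 * k + v1 * l| := by positivity
      have b6 := mul_le_mul_of_nonneg_right b4 b5
      have b7 := mul_le_mul_of_nonneg_left b3 (abs_nonneg k)
      linarith
    have hcard : J.card ≤ 12 * c + 1 := by
      have hI : (Icc (-(6 * c : ℤ)) (6 * c)).card = 12 * c + 1 := by
        rw [Int.card_Icc]; omega
      rw [← hI]
      by_cases hb : b = 0
      · have ha : a ≠ 0 := hab.resolve_right (by simpa using hb)
        refine card_le_card_of_injOn (fun g => g.1) ?_ ?_
        · intro g hg
          have := abs_le.1 (hJ g hg).1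
          simpa using this
        · intro g hg g' hg' h
          have h3 := hsl g hg g' hg' (hsame g hg g' hg')
          rw [hb, zero_mul, neg_zero] at h3
          have h4 := (mul_eq_zero.1 h3).resolve_left (mul_ne_zero ha hkR)
          have h5 : g.2.1 - g'.2.1 = 0 := by exact_mod_cast h4
          exact Prod.ext h (Prod.ext (by omega) (hsame g hg g' hg'))
      · refine card_le_card_of_injOn (fun g => g.2.1) ?_ ?_
        · intro g hg
          have := abs_le.1 (hJ g hg).2.1
          simpa using this
        · intro g hg g' hg' h
          have h3 := hsl g hg g' hg' (hsame g hg g' hg')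
          have h0 : g.2.1 = g'.2.1 := h
          rw [h0, sub_self, Int.cast_zero, mul_zero, eq_comm, neg_eq_zero] at h3
          have h4 := (mul_eq_zero.1 h3).resolve_left hb
          have h5 : g.1 - g'.1 = 0 := by exact_mod_cast h4
          exact Prod.ext (by omega) (Prod.ext h (hsame g hg g' hg'))
    exact hcard.trans (Nat.le_mul_of_pos_right _ (by omega))
  · push Not at hA
    have hI : (Icc (-(6 * c : ℤ)) (6 * c)).card = 12 * c + 1 := by
      rw [Int.card_Icc]; omega
    rw [← hI, mul_comm]
    refine card_le_mul_card_image_of_maps_to (f := fun g => g.2.2) ?_ _ ?_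
    · intro g hg
      have := abs_le.1 (hJ g hg).2.2
      simpa using this
    · intro t _
      have hr : (range (12 * c' + 1)).card = 12 * c' + 1 := card_range _
      rw [← hr]
      have key : ∀ D1 D2 : ℝ, ∀ m1 m2 : ℝ, m1 ≠ 0 → |m2| ≤ |m1| → m1 * D1 = -(m2 * D2) → |D1| ≤ |D2| := by
        intro D1 D2 m1 m2 hm1 hm h
        have h1 : |m1| * |D1| = |m2| * |D2| := by rw [← abs_mul, h, abs_neg, abs_mul]
        have h2 : |m1| * |D1| ≤ |m1| * |D2| := by
          rw [h1]; exact mul_le_mul_of_nonneg_right hm (abs_nonneg _)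
        exact le_of_mul_le_mul_left h2 (abs_pos.2 hm1)
      by_cases hm : |b| ≤ |a * k|
      · have hak : a * k ≠ 0 := by
          intro h0
          rw [h0, abs_zero] at hm
          have hb0 := abs_nonpos_iff.1 hm
          rcases hab with h | h
          · exact (mul_ne_zero h hkR) h0
          · exact h hb0
        refine card_le_card_of_injOn (fun g => ((g.1 + 6 * c) / 32).toNat) ?_ ?_
        · intro g hg
          have := abs_le.1 (hJ g (mem_filter.1 hg).1).1
          rw [coe_range, Set.mem_Iio]
          change ((g.1 + 6 * c) / 32).toNat < 12 * c' + 1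
          omega
        · intro g hg g' hg' h
          obtain ⟨hg, ht⟩ := mem_filter.1 hg
          obtain ⟨hg', ht'⟩ := mem_filter.1 hg'
          by_contra hne
          have h3 := hsl g hg g' hg' (ht.trans ht'.symm)
          have h4 := key _ _ _ _ hak hm h3
          have h5 : |g.2.1 - g'.2.1| ≤ |g.1 - g'.1| := by exact_mod_cast h4
          have b1 := abs_le.1 (hJ g hg).1
          have b2 := abs_le.1 (hJ g' hg').1
          have h6 : |g.1 - g'.1| < 32 := by
            simp only at h
            rw [abs_lt]; constructor <;> omega
          have := hA g hg g' hg' hne (ht.trans ht'.symm) h6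
          omega
      · push Not at hm
        have hb0 : b ≠ 0 := by rintro rfl; rw [abs_zero] at hm; exact absurd hm (not_lt.2 (abs_nonneg _))
        refine card_le_card_of_injOn (fun g => ((g.2.1 + 6 * c) / 32).toNat) ?_ ?_
        · intro g hg
          have := abs_le.1 (hJ g (mem_filter.1 hg).1).2.1
          rw [coe_range, Set.mem_Iio]
          change ((g.2.1 + 6 * c) / 32).toNat < 12 * c' + 1
          omega
        · intro g hg g' hg' h
          obtain ⟨hg, ht⟩ := mem_filter.1 hg
          obtain ⟨hg', ht'⟩ := mem_filter.1 hg'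
          by_contra hne
          have h3 := hsl g hg g' hg' (ht.trans ht'.symm)
          have h4 := key ((g.1 - g'.1 : ℤ) : ℝ) ((g.2.1 - g'.2.1 : ℤ) : ℝ) b (a * k) hb0 hm.le (by linarith)
          have h5 : |g.1 - g'.1| ≤ |g.2.1 - g'.2.1| := by exact_mod_cast h4
          have b1 := abs_le.1 (hJ g hg).2.1
          have b2 := abs_le.1 (hJ g' hg').2.1
          have h6 : |g.2.1 - g'.2.1| < 32 := by
            simp only at h
            rw [abs_lt]; constructor <;> omega
          have := hA g hg g' hg' hne (ht.trans ht'.symm) (by omega)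
          omega

end

section
open Finset

theorem Z5_phi_pow (m : ℕ) (hm : m ≠ 0) : Irrational (Real.goldenRatio ^ m) := by
  obtain ⟨j, rfl⟩ := Nat.exists_eq_succ_of_ne_zero hm
  have h : Real.goldenRatio ^ (j + 1) = Nat.fib (j + 1) * Real.goldenRatio + Nat.fib j := by
    induction j with
    | zero => simp
    | succ j ih =>
      rw [pow_succ, ih (by omega), Nat.fib_add_two]
      have := Real.goldenRatio_sq
      push_cast
      linear_combination (Nat.fib (j + 1) : ℝ) * this
  rw [Nat.succ_eq_add_one, h]
  have h1 : Irrational ((Nat.fib (j + 1) : ℝ) * Real.goldenRatio) :=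
    Real.goldenRatio_irrational.natCast_mul (Nat.fib_pos.2 (Nat.succ_pos j)).ne'
  exact h1.add_natCast _

theorem Z5_rat (r s t : ℤ) (h : Real.goldenRatio ^ r * 2 ^ s * Real.sqrt 5 ^ t = 1) :
    r = 0 ∧ s = 0 ∧ t = 0 := by
  have h5 : Real.sqrt 5 ^ 2 = 5 := Real.sq_sqrt (by norm_num)
  have hsq : Real.goldenRatio ^ (2 * r) * (((4:ℚ) ^ s * 5 ^ t : ℚ) : ℝ) = 1 := by
    have := congrArg (· ^ 2) h
    simp only [mul_pow, one_pow] at this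
    rw [← this]
    push_cast
    have e5 : (5:ℝ) ^ t = (Real.sqrt 5 ^ t) ^ 2 := by
      rw [← zpow_natCast, ← zpow_mul, mul_comm, zpow_mul, zpow_natCast, h5]
    have e4 : (4:ℝ) ^ s = (2 ^ s) ^ 2 := by
      rw [← zpow_natCast, ← zpow_mul, mul_comm, zpow_mul]; norm_num
    have e3 : Real.goldenRatio ^ (2 * r) = (Real.goldenRatio ^ r) ^ 2 := by
      rw [← zpow_natCast, ← zpow_mul, mul_comm]; norm_num
    rw [e3, e4, e5]; ring
  have hr : r = 0 := by
    by_contra hr0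
    have h1 : Irrational (Real.goldenRatio ^ (2 * r)) := by
      rcases Int.natAbs_eq r with h | h
      · rw [h, show (2 * (r.natAbs : ℤ)) = ((2 * r.natAbs : ℕ) : ℤ) by push_cast; rfl, zpow_natCast]
        exact Z5_phi_pow _ (by omega)
      · rw [h, show (2 * -(r.natAbs : ℤ)) = -((2 * r.natAbs : ℕ) : ℤ) by push_cast; ring, zpow_neg,
          zpow_natCast]
        exact (Z5_phi_pow _ (by omega)).inv
    refine h1 ⟨((4:ℚ) ^ s * 5 ^ t)⁻¹, ?_⟩
    rw [Rat.cast_inv]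
    exact (eq_inv_of_mul_eq_one_left hsq).symm
  subst hr
  rw [mul_zero, zpow_zero, one_mul] at hsq
  have hq : (4:ℚ) ^ s * 5 ^ t = 1 := by exact_mod_cast hsq
  have hcop : ∀ a b : ℕ, (4:ℚ) ^ a = 5 ^ b → a = 0 ∧ b = 0 := by
    intro a b hab
    have h1 : 4 ^ a = 5 ^ b := by exact_mod_cast hab
    have hc : Nat.Coprime (4 ^ a) (5 ^ b) := Nat.Coprime.pow _ _ (by norm_num)
    rw [← h1, Nat.coprime_self] at hc
    rw [hc] at h1
    constructor
    · by_contra h; have := Nat.one_lt_pow h (show 1 < 4 by norm_num); omega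
    · by_contra h; have := Nat.one_lt_pow h (show 1 < 5 by norm_num); omega
  have hone : ∀ a b : ℕ, (4:ℚ) ^ a * 5 ^ b = 1 → a = 0 ∧ b = 0 := by
    intro a b hab
    have h1 : 4 ^ a * 5 ^ b = 1 := by exact_mod_cast hab
    have h2 := Nat.eq_one_of_mul_eq_one_right h1
    have h3 := Nat.eq_one_of_mul_eq_one_left h1
    constructor
    · by_contra h; have := Nat.one_lt_pow h (show 1 < 4 by norm_num); omega
    · by_contra h; have := Nat.one_lt_pow h (show 1 < 5 by norm_num); omega
  refine ⟨rfl, ?_⟩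
  rcases Int.natAbs_eq s with hs | hs <;> rcases Int.natAbs_eq t with ht | ht <;>
    rw [hs, ht] at hq <;> simp only [zpow_neg, zpow_natCast] at hq
  · have := hone _ _ hq; omega
  · have := hcop _ _ (by field_simp at hq; exact hq); omega
  · have := hcop _ _ (by field_simp at hq; exact hq.symm); omega
  · have := hone s.natAbs t.natAbs (by field_simp at hq; exact hq.symm); omega

end

section
open Finset

abbrev Row (K L : ℕ) := (Σ d : Fin K, Fin (d + 1)) × Fin L

noncomputable def Z6_x (n : ℕ) (k l : ℤ) : (ℤ × ℤ × ℤ) →+ (Fin 2 → ℝ) where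
  toFun g := ![((g.2.1 * k - g.2.2 * n * l : ℤ) : ℝ), ((g.1 + g.2.2 * n : ℤ) : ℝ)]
  map_zero' := by ext i; fin_cases i <;> simp
  map_add' g h := by ext i; fin_cases i <;> simp <;> ring

noncomputable def Z6_Y (g : ℤ × ℤ × ℤ) : ℝ :=
  Real.goldenRatio ^ g.1 * 2 ^ g.2.1 * Real.sqrt 5 ^ g.2.2

theorem Z6_Y_ne (g : ℤ × ℤ × ℤ) : Z6_Y g ≠ 0 := by
  unfold Z6_Y
  have := Real.goldenRatio_pos
  positivity

theorem Z6_Y_add (g h : ℤ × ℤ × ℤ) : Z6_Y (g + h) = Z6_Y g * Z6_Y h := by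
  unfold Z6_Y
  have h5 : Real.sqrt 5 ≠ 0 := by positivity
  simp only [Prod.fst_add, Prod.snd_add]
  rw [zpow_add₀ Real.goldenRatio_ne_zero, zpow_add₀ two_ne_zero, zpow_add₀ h5]
  ring

theorem Z6_Y_inj : Function.Injective Z6_Y := by
  intro g h hgh
  have h1 : Z6_Y (g - h) = 1 := by
    have := Z6_Y_add (g - h) h
    rw [sub_add_cancel, hgh] at this
    exact (mul_eq_right₀ (Z6_Y_ne h)).1 this.symm
  obtain ⟨h2, h3, h4⟩ := Z5_rat _ _ _ h1
  simp only [Prod.fst_sub, Prod.snd_sub] at h2 h3 h4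
  exact Prod.ext (by omega) (Prod.ext (by omega) (by omega))

noncomputable def Z6_box (a b : ℤ) : Finset (ℤ × ℤ × ℤ) := Icc a b ×ˢ Icc a b ×ˢ Icc a b

theorem Z6_mem (a b : ℤ) (g : ℤ × ℤ × ℤ) : g ∈ Z6_box a b ↔
    (a ≤ g.1 ∧ g.1 ≤ b) ∧ (a ≤ g.2.1 ∧ g.2.1 ≤ b) ∧ (a ≤ g.2.2 ∧ g.2.2 ≤ b) := by
  simp [Z6_box]

theorem Z6_xinj (n c : ℕ) (k l : ℤ) (hk : k ≠ 0) (hn : 24 * c < n) (S : Finset (ℤ × ℤ × ℤ))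
    (hS : ∀ g ∈ S, -(8 * c : ℤ) ≤ g.1 ∧ g.1 ≤ 8 * c) : Set.InjOn (Z6_x n k l) S := by
  intro g hg h hh hgh
  have h0 : g.2.1 * k - g.2.2 * n * l = h.2.1 * k - h.2.2 * n * l := by
    have := congrFun hgh 0
    simp only [Z6_x, AddMonoidHom.coe_mk, ZeroHom.coe_mk, Matrix.cons_val_zero] at this
    exact_mod_cast this
  have h1 : g.1 + g.2.2 * n = h.1 + h.2.2 * n := by
    have := congrFun hgh 1
    simp only [Z6_x, AddMonoidHom.coe_mk, ZeroHom.coe_mk, Matrix.cons_val_one, Matrix.cons_val_zero] at this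
    exact_mod_cast this
  have b1 := hS g hg
  have b2 := hS h hh
  have ht : g.2.2 = h.2.2 := by
    by_contra hne
    have h3 : (g.2.2 - h.2.2) * n = h.1 - g.1 := by linarith
    rcases lt_or_gt_of_ne hne with h4 | h4
    · have h5 : (1:ℤ) ≤ h.2.2 - g.2.2 := by omega
      have := mul_le_mul_of_nonneg_right h5 (show (0:ℤ) ≤ n by positivity)
      have : (24 * c : ℤ) < n := by exact_mod_cast hn
      linarith
    · have h5 : (1:ℤ) ≤ g.2.2 - h.2.2 := by omega
      have := mul_le_mul_of_nonneg_right h5 (show (0:ℤ) ≤ n by positivity)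
      have : (24 * c : ℤ) < n := by exact_mod_cast hn
      linarith
  rw [ht] at h0 h1
  have hs : g.2.1 * k = h.2.1 * k := by linarith
  exact Prod.ext (by linarith) (Prod.ext (mul_right_cancel₀ hk hs) ht)

theorem Z6_zero (n c c' L K : ℕ) (hL : 1 ≤ L) (hc' : c' = 4 * L ^ 2) (hc : c = 32 * c')
    (hK : K + 1 = 160 * c) (hn : 24 * c < n) (k l : ℤ) (hk : k ≠ 0)
    (hθ : ∀ v1 v2 : ℤ, (v1 ≠ 0 ∨ v2 ≠ 0) → |v1| < 32 → |v2| < 32 →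
      768 * c * |k| < n * |v2 * k + v1 * l|)
    (co : Row K L → ℝ)
    (hv : ∀ g ∈ Z6_box (-(8 * c)) (8 * c), ∑ i : Row K L, co i *
      (((g.1 + g.2.2 * n : ℤ) : ℝ) ^ ((i.1.1 : ℕ) - (i.1.2 : ℕ)) *
       ((g.2.1 * k - g.2.2 * n * l : ℤ) : ℝ) ^ (i.1.2 : ℕ) * Z6_Y g ^ (i.2 : ℕ)) = 0) : co = 0 := by
  classical
  by_contra hne
  have hc'1 : 4 ≤ c' := by nlinarith
  have hLc : L ≤ c' := by nlinarith
  let ex : (Σ d : Fin K, Fin (d + 1)) → (Fin 2 →₀ ℕ) := fun di =>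
    Finsupp.equivFunOnFinite.symm ![(di.2 : ℕ), (di.1 : ℕ) - (di.2 : ℕ)]
  have hex0 : ∀ di, ex di 0 = di.2 := fun di => by simp [ex]
  have hex1 : ∀ di, ex di 1 = (di.1 : ℕ) - (di.2 : ℕ) := fun di => by simp [ex]
  have hexi : Function.Injective ex := by
    rintro ⟨d, i⟩ ⟨d', i'⟩ h
    have h0 := DFunLike.congr_fun h 0
    have h1 := DFunLike.congr_fun h 1
    rw [hex0, hex0] at h0
    rw [hex1, hex1] at h1
    have hi := i.2
    have hi' := i'.2
    simp only at h0 h1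
    have hd : d = d' := Fin.ext (by omega)
    subst hd
    congr
    exact Fin.ext h0
  let p : Fin L → MP2 := fun m => ∑ di, MvPolynomial.monomial (ex di) (co (di, m))
  have hpc : ∀ m di, MvPolynomial.coeff (ex di) (p m) = co (di, m) := by
    intro m di
    simp only [p, MvPolynomial.coeff_sum, MvPolynomial.coeff_monomial]
    rw [sum_eq_single di]
    · simp
    · intro b _ hb
      rw [if_neg (fun h => hb (hexi h))]
    · simp
  obtain ⟨l0, hl0⟩ : ∃ m, p m ≠ 0 := by
    by_contra hall
    push Not at hall
    apply hne
    ext ⟨di, m⟩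
    rw [← hpc m di, hall m]; simp
  have hpK : ∀ m, (p m).totalDegree < K := by
    intro m
    have hKpos : 0 < K := by omega
    refine lt_of_le_of_lt (MvPolynomial.totalDegree_finsetSum _ _) ?_
    rw [Finset.sup_lt_iff (by simpa using hKpos)]
    intro di _
    refine lt_of_le_of_lt (MvPolynomial.totalDegree_monomial_le _ _) ?_
    rw [Finsupp.sum_fintype _ _ (fun _ => rfl), Fin.sum_univ_two, hex0, hex1]
    have := di.1.2
    have := di.2.2
    simp only [id]
    omega
  have hpe : ∀ g m, MvPolynomial.eval (Z6_x n k l g) (p m) = ∑ di, co (di, m) *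
      (((g.1 + g.2.2 * n : ℤ) : ℝ) ^ ((di.1 : ℕ) - (di.2 : ℕ)) *
       ((g.2.1 * k - g.2.2 * n * l : ℤ) : ℝ) ^ (di.2 : ℕ)) := by
    intro g m
    simp only [p, map_sum]
    refine sum_congr rfl fun di _ => ?_
    rw [MvPolynomial.eval_monomial, Finsupp.prod_fintype _ _ (fun _ => pow_zero _),
      Fin.prod_univ_two, hex0, hex1]
    simp only [Z6_x, AddMonoidHom.coe_mk, ZeroHom.coe_mk, Matrix.cons_val_zero, Matrix.cons_val_one]
    ring
  have hv' : ∀ g ∈ Z6_box (-(8 * c)) (8 * c), ∑ m : Fin L,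
      MvPolynomial.eval (Z6_x n k l g) (p m) * Z6_Y g ^ (m : ℕ) = 0 := by
    intro g hg
    rw [← hv g hg, Fintype.sum_prod_type_right]
    refine sum_congr rfl fun m _ => ?_
    rw [hpe, sum_mul]
    exact sum_congr rfl fun di _ => by ring
  have hinj : Function.Injective fun s : Fin L => Real.goldenRatio ^ (s : ℕ) := by
    intro a b hab
    exact Fin.ext (pow_right_injective₀ Real.goldenRatio_pos Real.one_lt_goldenRatio.ne' hab)
  obtain ⟨Q, hQ, hQd, hQv⟩ := Z3_Q p l0 hl0 hpK (fun s => ((s : ℕ) : ℝ)) _ hinj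
  have hQ0 : ∀ g ∈ Z6_box (-(7 * c)) (7 * c), MvPolynomial.eval (Z6_x n k l g) Q = 0 := by
    intro g hg
    refine hQv _ (Z6_Y g) (Z6_Y_ne g) fun s => ?_
    rw [Z6_mem] at hg
    have h1 := hv' (g + (((s : ℕ) : ℤ), 0, 0)) (by
      rw [Z6_mem]
      have := s.2
      simp only [Prod.fst_add, Prod.snd_add, add_zero]
      omega)
    have e1 : Z6_x n k l (g + (((s : ℕ) : ℤ), 0, 0)) = Z6_x n k l g + ![0, ((s : ℕ) : ℝ)] := by
      rw [map_add]
      congr 1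
      ext i; fin_cases i <;> simp [Z6_x]
    have e2 : Z6_Y (g + (((s : ℕ) : ℤ), 0, 0)) = Z6_Y g * Real.goldenRatio ^ (s : ℕ) := by
      rw [Z6_Y_add]; simp [Z6_Y]
    rw [e1, e2] at h1
    exact h1
  have hcardI : (Z6_box (-(6 * c)) (6 * c)).card = (12 * c + 1) ^ 3 := by
    have : (Icc (-(6 * c : ℤ)) (6 * c)).card = 12 * c + 1 := by
      rw [Int.card_Icc]; omega
    rw [Z6_box, card_product, card_product, this]; ring
  have hcardS : (Z6_box 0 (c - 1)).card = c ^ 3 := by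
    have : (Icc (0:ℤ) (c - 1)).card = c := by
      rw [Int.card_Icc]; omega
    rw [Z6_box, card_product, card_product, this]; ring
  let cell : ℤ × ℤ × ℤ → Fin 2197 := fun g =>
    ⟨(((g.1 + 6 * c) / c).toNat + 13 * ((g.2.1 + 6 * c) / c).toNat +
      169 * ((g.2.2 + 6 * c) / c).toNat) % 2197, Nat.mod_lt _ (by norm_num)⟩
  have hcpos : (0:ℤ) < c := by omega
  have hdiv : ∀ r : ℤ, -(6 * c : ℤ) ≤ r → r ≤ 6 * c → 0 ≤ (r + 6 * c) / c ∧ (r + 6 * c) / c < 13 := by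
    intro r h1 h2
    constructor
    · exact Int.ediv_nonneg (by omega) (by omega)
    · rw [Int.ediv_lt_iff_lt_mul hcpos]; omega
  have hclose : ∀ r r' : ℤ, (r + 6 * c) / c = (r' + 6 * c) / c → r - r' ≤ c ∧ -c ≤ r - r' := by
    intro r r' h
    have h1 := Int.mul_ediv_add_emod (r + 6 * c) c
    have h2 := Int.mul_ediv_add_emod (r' + 6 * c) c
    rw [h] at h1
    have := Int.emod_nonneg (r + 6 * c) hcpos.ne'
    have := Int.emod_nonneg (r' + 6 * c) hcpos.ne'
    have := Int.emod_lt_of_pos (r + 6 * c) hcpos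
    have := Int.emod_lt_of_pos (r' + 6 * c) hcpos
    constructor <;> linarith
  have hmain := Z2_main (Z6_x n k l) Z6_Y Z6_Y_ne Z6_Y_add Z6_Y_inj (L := L) (K := K) (m := 2197)
    (M0 := (12 * c + 1) * (12 * c' + 1)) (by omega) p l0 hl0 hpK (Z6_box (-(8 * c)) (8 * c))
    (Z6_box (-(6 * c)) (6 * c)) (Z6_box 0 (c - 1)) hv' Q hQ hQd
    (fun g hg => hQ0 g (by rw [Z6_mem] at hg ⊢; omega))
    (fun g hg s hs => hQ0 _ (by
      rw [Z6_mem] at hg hs ⊢; simp only [Prod.fst_add, Prod.snd_add]; omega))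
    (Z6_xinj n c k l hk hn _ fun g hg => by rw [Z6_mem] at hg; omega)
    (Z6_xinj n c k l hk hn _ fun g hg => by rw [Z6_mem] at hg; omega)
    (by
      rw [hcardS]
      have h1 : 2 * (L * K) ≤ 320 * c * L := by
        have : K ≤ 160 * c := by omega
        nlinarith
      have h2 : 320 * L < c * c := by nlinarith
      calc 2 * (L * K) ≤ 320 * c * L := h1
        _ = c * (320 * L) := by ring
        _ < c * (c * c) := Nat.mul_lt_mul_of_pos_left h2 (by omega)
        _ = c ^ 3 := by ring)
    (by
      intro a b e hab J hJ hJl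
      refine Z4_line n c c' hc k l hk hθ a b e hab J ?_ ?_
      · intro g hg
        have := hJ hg
        rw [Z6_mem] at this
        refine ⟨abs_le.2 ?_, abs_le.2 ?_, abs_le.2 ?_⟩ <;> omega
      · intro g hg
        exact hJl g hg)
    cell
    (by
      intro g hg h hh hgh i hi
      rw [Z6_mem] at hg hh hi ⊢
      simp only [cell, Fin.mk.injEq] at hgh
      have a1 := hdiv g.1 hg.1.1 hg.1.2
      have a2 := hdiv g.2.1 hg.2.1.1 hg.2.1.2
      have a3 := hdiv g.2.2 hg.2.2.1 hg.2.2.2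
      have b1 := hdiv h.1 hh.1.1 hh.1.2
      have b2 := hdiv h.2.1 hh.2.1.1 hh.2.1.2
      have b3 := hdiv h.2.2 hh.2.2.1 hh.2.2.2
      have e1 := hclose g.1 h.1 (by omega)
      have e2 := hclose g.2.1 h.2.1 (by omega)
      have e3 := hclose g.2.2 h.2.2 (by omega)
      simp only [Prod.fst_add, Prod.snd_add, Prod.fst_sub, Prod.snd_sub]
      omega)
  rw [hcardI] at hmain
  have hK' : K ≤ 5120 * c' := by omega
  have h4 : 4 * (L * K) ^ 2 = c' * K ^ 2 := by rw [hc']; ring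
  have h5 : K ^ 2 ≤ (5120 * c') ^ 2 := Nat.pow_le_pow_left hK' 2
  have h6 : c' * K ^ 2 ≤ c' * (5120 * c') ^ 2 := Nat.mul_le_mul_left _ h5
  have h7 : K * ((12 * c + 1) * (12 * c' + 1)) ≤ 5120 * c' * ((12 * c + 1) * (12 * c' + 1)) :=
    Nat.mul_le_mul_right _ hK'
  have h8 : 4 * (12 * c + 1) ^ 3 ≤ 4 * (5120 * c' * ((12 * c + 1) * (12 * c' + 1))) +
      2 * (c' * (5120 * c') ^ 2) := by
    linarith
  rw [hc] at h8
  have h9 : 4 * c' ^ 2 ≤ c' ^ 3 := by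
    calc 4 * c' ^ 2 ≤ c' * c' ^ 2 := Nat.mul_le_mul_right _ hc'1
      _ = c' ^ 3 := by ring
  nlinarith [h8, h9]

end

section
open Finset

theorem Z7_sum (K L : ℕ) (f : (d : ℕ) → ℕ → ℕ) (g : ℕ → ℕ) :
    ∑ i : Row K L, f i.1.1 i.1.2 * g i.2 =
      (∑ d ∈ range K, ∑ i ∈ range (d + 1), f d i) * ∑ m ∈ range L, g m := by
  rw [Fintype.sum_prod_type, sum_range g, sum_range, Fintype.sum_sigma, sum_mul]
  refine sum_congr rfl fun d _ => ?_
  rw [sum_range, sum_mul]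
  refine sum_congr rfl fun i _ => ?_
  rw [mul_sum]

theorem Z7_card (K L : ℕ) : 2 * Fintype.card (Row K L) = K * (K + 1) * L := by
  have h := Z7_sum K L (fun _ _ => 1) (fun _ => 1)
  simp only [sum_const, smul_eq_mul, mul_one, card_univ, card_range] at h
  rw [h, ← mul_assoc]
  congr 1
  clear h
  induction K with
  | zero => simp
  | succ K ih => rw [sum_range_succ, mul_add, ih]; ring

theorem Z7_k2 (K L : ℕ) : 6 * (∑ i : Row K L, (i.1.2 : ℕ)) + L * K = L * K ^ 3 := by
  have h := Z7_sum K L (fun _ i => i) (fun _ => 1)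
  simp only [mul_one, sum_const, smul_eq_mul, card_range] at h
  rw [h]
  have h2 : 6 * (∑ d ∈ range K, ∑ i ∈ range (d + 1), i) + K = K ^ 3 := by
    clear h
    induction K with
    | zero => simp
    | succ K ih =>
      rw [sum_range_succ, mul_add]
      have := Finset.sum_range_id_mul_two (K + 1)
      simp only [Nat.add_sub_cancel] at this
      nlinarith
  rw [← h2]; ring

theorem Z7_k1 (K L : ℕ) : 6 * (∑ i : Row K L, ((i.1.1 : ℕ) - (i.1.2 : ℕ))) + L * K = L * K ^ 3 := by
  have h := Z7_sum K L (fun d i => d - i) (fun _ => 1)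
  simp only [mul_one, sum_const, smul_eq_mul, card_range] at h
  rw [h]
  have h2 : 6 * (∑ d ∈ range K, ∑ i ∈ range (d + 1), (d - i)) + K = K ^ 3 := by
    clear h
    induction K with
    | zero => simp
    | succ K ih =>
      rw [sum_range_succ, mul_add]
      have := Finset.sum_range_id_mul_two (K + 1)
      have h3 := Finset.sum_range_reflect (fun i => i) (K + 1)
      simp only [Nat.add_sub_cancel] at this h3
      nlinarith
  rw [← h2]; ring

theorem Z7_A (K L0 : ℕ) : 2 * (∑ i : Row K (2 * L0 + 1), (((i.2 : ℕ) : ℤ) - L0).natAbs) =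
    K * (K + 1) * (L0 * (L0 + 1)) := by
  have h := Z7_sum K (2 * L0 + 1) (fun _ _ => 1) (fun m => ((m : ℤ) - L0).natAbs)
  simp only [one_mul, sum_const, smul_eq_mul, mul_one, card_range] at h
  rw [h]
  have h1 : 2 * ∑ d ∈ range K, (d + 1) = K * (K + 1) := by
    clear h
    induction K with
    | zero => simp
    | succ K ih => rw [sum_range_succ, mul_add, ih]; ring
  have h2 : ∑ m ∈ range (2 * L0 + 1), ((m : ℤ) - L0).natAbs = L0 * (L0 + 1) := by
    have e : 2 * L0 + 1 = L0 + (L0 + 1) := by ring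
    rw [e, sum_range_add]
    have a1 : ∑ x ∈ range L0, ((x : ℤ) - L0).natAbs = ∑ x ∈ range L0, (x + 1) := by
      rw [← sum_range_reflect]
      refine sum_congr rfl fun x hx => ?_
      have := mem_range.1 hx
      omega
    have a2 : ∑ x ∈ range (L0 + 1), (((L0 + x : ℕ) : ℤ) - L0).natAbs = ∑ x ∈ range (L0 + 1), x :=
      sum_congr rfl fun x hx => by omega
    rw [a1, a2]
    have b1 := Finset.sum_range_id_mul_two (L0 + 1)
    simp only [Nat.add_sub_cancel] at b1
    rw [sum_add_distrib, sum_const, card_range, smul_eq_mul, mul_one]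
    rw [sum_range_succ] at b1 ⊢
    nlinarith
  rw [h2, ← mul_assoc, h1]

end

section
open Finset

theorem Z8_norm_zpow {a : ℂ} {B : ℝ} (hB : 1 ≤ B) (h1 : ‖a‖ ≤ B) (h2 : ‖a⁻¹‖ ≤ B) (m : ℤ) (e : ℕ)
    (hm : |m| ≤ e) : ‖a ^ m‖ ≤ B ^ e := by
  obtain ⟨p, rfl | rfl⟩ := Int.eq_nat_or_neg m
  · have hp : p ≤ e := by rw [Nat.abs_cast] at hm; exact_mod_cast hm
    rw [zpow_natCast, norm_pow]
    exact (pow_le_pow_left₀ (norm_nonneg _) h1 _).trans (pow_le_pow_right₀ hB hp)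
  · have hp : p ≤ e := by rw [abs_neg, Nat.abs_cast] at hm; exact_mod_cast hm
    rw [zpow_neg, ← inv_zpow, zpow_natCast, norm_pow]
    exact (pow_le_pow_left₀ (norm_nonneg _) h2 _).trans (pow_le_pow_right₀ hB hp)

theorem Z8_int_zpow {F : Type*} [Field F] {a : F} (h1 : IsIntegral ℤ a) (h2 : IsIntegral ℤ a⁻¹)
    (m : ℤ) : IsIntegral ℤ (a ^ m) := by
  obtain ⟨p, rfl | rfl⟩ := Int.eq_nat_or_neg m
  · rw [zpow_natCast]; exact h1.pow p
  · rw [zpow_neg, ← inv_zpow, zpow_natCast]; exact h2.pow p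

theorem Z8_emb (w : ℂ) (hw : w ^ 2 = w + 1) : ‖w‖ ≤ Real.goldenRatio ∧ ‖w⁻¹‖ ≤ Real.goldenRatio := by
  have h1 : (w - (Real.goldenRatio : ℝ)) * (w - (Real.goldenConj : ℝ)) = 0 := by
    have a1 : ((Real.goldenRatio + Real.goldenConj : ℝ) : ℂ) = 1 := by
      rw [Real.goldenRatio_add_goldenConj]; simp
    have a2 : ((Real.goldenRatio * Real.goldenConj : ℝ) : ℂ) = -1 := by
      rw [Real.goldenRatio_mul_goldenConj]; simp
    rw [Complex.ofReal_add] at a1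
    rw [Complex.ofReal_mul] at a2
    linear_combination hw - w * a1 + a2
  have hg := Real.goldenRatio_pos
  have hg1 := Real.one_lt_goldenRatio
  have hinv := Real.inv_goldenRatio
  have hinv' := Real.inv_goldenConj
  have hlt : Real.goldenRatio⁻¹ ≤ 1 := inv_le_one_of_one_le₀ hg1.le
  have hc : |Real.goldenConj| = Real.goldenRatio⁻¹ := by
    rw [hinv, abs_of_neg Real.goldenConj_neg]
  rcases mul_eq_zero.1 h1 with h | h
  · rw [sub_eq_zero.1 h, norm_inv, Complex.norm_real, Real.norm_eq_abs, abs_of_pos hg]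
    exact ⟨le_rfl, by linarith⟩
  · rw [sub_eq_zero.1 h, norm_inv, Complex.norm_real, Real.norm_eq_abs, hc, inv_inv]
    exact ⟨by linarith, le_rfl⟩

theorem Z8_order {ι : Type*} (K d p m : ℕ) (hp : p ≤ d) (hd : d < K) (x1 x2 u : ι → ℝ) (lp κ : ℝ)
    (hx2 : ∀ j, x2 j = κ * (u j - x1 j * lp)) :
    ∃ c : Fin K → ℝ, ∀ j, x1 j ^ (d - p) * x2 j ^ p * u j ^ m =
      ∑ a : Fin K, c a * (x1 j ^ (a : ℕ) * u j ^ (d + m - (a : ℕ))) := by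
  refine ⟨fun a => if d - p ≤ (a : ℕ) ∧ (a : ℕ) ≤ d then κ ^ p * (-lp) ^ ((a : ℕ) - (d - p)) *
    p.choose ((a : ℕ) - (d - p)) else 0, fun j => ?_⟩
  rw [hx2, mul_pow, sub_eq_add_neg, add_comm (u j), add_pow, mul_sum, mul_sum, sum_mul]
  have e := Fin.sum_univ_eq_sum_range (fun a => (if d - p ≤ a ∧ a ≤ d then κ ^ p *
    (-lp) ^ (a - (d - p)) * p.choose (a - (d - p)) else 0) * (x1 j ^ a * u j ^ (d + m - a))) K
  refine Eq.trans ?_ e.symm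
  refine sum_of_injOn (fun i => d - p + i) (fun a _ b _ h => by simpa using h) ?_ ?_ ?_
  · intro i hi
    simp only [coe_range, Set.mem_Iio] at hi ⊢
    omega
  · intro a ha hna
    rw [if_neg, zero_mul]
    rintro ⟨h1, h2⟩
    exact hna ⟨a - (d - p), by simp; omega, by simp; omega⟩
  · intro i hi
    have hi' := mem_range.1 hi
    rw [if_pos ⟨by omega, by omega⟩, Nat.add_sub_cancel_left]
    have e1 : d + m - (d - p + i) = (p - i) + m := by omega
    rw [e1, pow_add, pow_add, show -(x1 j * lp) = x1 j * -lp by ring, mul_pow]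
    ring

end

section
open Finset

theorem Z9_core {F : Type*} [Field F] [NumberField F] (hdeg : Module.finrank ℚ F ≤ 2)
    (σ0 : F →+* ℝ) (ϕ s5 : F) (hϕ : ϕ ^ 2 = ϕ + 1) (hs5 : s5 ^ 2 = 5)
    (hσϕ : σ0 ϕ = Real.goldenRatio) (hσs : σ0 s5 = Real.sqrt 5)
    (n c c' L0 K q M S1 S2 A : ℕ) (hc' : c' = 4 * (2 * L0 + 1) ^ 2) (hc : c = 32 * c')
    (hK : K + 1 = 160 * c) (hn : 24 * c < n) (k l : ℤ) (hk : k ≠ 0)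
    (hθ : ∀ v1 v2 : ℤ, (v1 ≠ 0 ∨ v2 ≠ 0) → |v1| < 32 → |v2| < 32 →
      768 * c * |k| < n * |v2 * k + v1 * l|)
    (hq : q = 80 * c * (2 * L0 + 1))
    (hS1 : ∑ i : Row K (2 * L0 + 1), ((i.1.1 : ℕ) - (i.1.2 : ℕ)) = S1)
    (hS2 : ∑ i : Row K (2 * L0 + 1), (i.1.2 : ℕ) = S2)
    (hA : ∑ i : Row K (2 * L0 + 1), (((i.2 : ℕ) : ℤ) - L0).natAbs = A)
    (hM : M + (S1 + S2) ≤ K * (q * (q - 1) / 2))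
    (X1 X2 : ℝ) (hX1 : ((8 * c : ℕ) : ℝ) * (1 + n) ≤ X1) (hX2 : ((8 * c : ℕ) : ℝ) * (|(k:ℝ)| + n * |(l:ℝ)|) ≤ X2)
    (hX1' : 1 ≤ X1) (hX2' : 1 ≤ X2)
    (Λ : ℝ) (hΛd : Λ = k * (n * Real.log Real.goldenRatio - Real.log (Real.sqrt 5)) - n * l * Real.log 2)
    (hΛ1 : |Λ| ≤ 1 / 10000) (hΛ2 : Real.exp 2 ^ q * |Λ| * (A * (8 * c : ℕ)) ≤ 1)
    (hlogs : Real.log Real.goldenRatio + Real.log 2 + Real.log (Real.sqrt 5) ≤ 1.9999)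
    (hlogp : 0 ≤ Real.log Real.goldenRatio) (hlogs5 : 0 ≤ Real.log (Real.sqrt 5)) :
    1 ≤ (2 * Real.sqrt 5) ^ ((8 * c) * A) * (((K * q).factorial * (X1 ^ S1 * X2 ^ S2) * (Real.exp 2 ^ M)⁻¹ *
      Real.exp (Real.exp 2 * (A * (2 * (8 * c : ℕ))) + 1)) *
      ((K * q).factorial * (X1 ^ S1 * X2 ^ S2 * (20 * Real.goldenRatio) ^ ((8 * c) * A)))) := by
  classical
  set L := 2 * L0 + 1 with hL
  set R := 8 * c with hR
  clear_value R
  have hkr : (k : ℝ) ≠ 0 := by exact_mod_cast hk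
  have hk1 : (1:ℝ) ≤ |(k:ℝ)| := by
    have : (1:ℤ) ≤ |k| := Int.one_le_abs hk
    exact_mod_cast this
  have hcard : Fintype.card (Row K L) = K * q := by
    have h1 := Z7_card K L
    have h2 : K * (K + 1) * L = 2 * (K * q) := by rw [hK, hq]; ring
    omega
  -- points
  let J := {g : ℤ × ℤ × ℤ // g ∈ Z6_box (-(8 * c)) (8 * c)}
  let x1 : J → ℤ := fun g => g.1.1 + g.1.2.2 * n
  let x2 : J → ℤ := fun g => g.1.2.1 * k - g.1.2.2 * n * l
  obtain ⟨φ, hφ⟩ := L_columns (ι := Row K L) (J := J) (F := ℝ)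
    (fun i g => (x1 g : ℝ) ^ ((i.1.1 : ℕ) - (i.1.2 : ℕ)) * (x2 g : ℝ) ^ (i.1.2 : ℕ) *
      Z6_Y g.1 ^ (((i.2 : ℕ) : ℤ) - L0)) (by
    intro co hco
    refine Z6_zero n c c' L K (by omega) hc' hc hK hn k l hk hθ co ?_
    intro g hg
    have h := hco ⟨g, hg⟩
    have h2 : (∑ i : Row K L, co i * ((x1 ⟨g, hg⟩ : ℝ) ^ ((i.1.1 : ℕ) - (i.1.2 : ℕ)) *
      (x2 ⟨g, hg⟩ : ℝ) ^ (i.1.2 : ℕ) * Z6_Y g ^ (((i.2 : ℕ) : ℤ) - L0))) * Z6_Y g ^ L0 = 0 := by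
      rw [h, zero_mul]
    rw [sum_mul] at h2
    rw [← h2]
    refine sum_congr rfl fun i _ => ?_
    have e : Z6_Y g ^ (((i.2 : ℕ) : ℤ) - L0) * Z6_Y g ^ L0 = Z6_Y g ^ (i.2 : ℕ) := by
      rw [← zpow_natCast, ← zpow_natCast, ← zpow_add₀ (Z6_Y_ne g), sub_add_cancel]
    rw [← e]; ring)
  have hbox : ∀ g : J, |(g.1.1 : ℝ)| ≤ R ∧ |(g.1.2.1 : ℝ)| ≤ R ∧ |(g.1.2.2 : ℝ)| ≤ R := by
    intro g
    have h := (Z6_mem _ _ _).1 g.2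
    have e : ∀ r : ℤ, -(8 * c : ℤ) ≤ r → r ≤ 8 * c → |(r : ℝ)| ≤ R := by
      intro r h1 h2
      have : |r| ≤ (R : ℤ) := abs_le.2 ⟨by push_cast [hR]; linarith, by push_cast [hR]; linarith⟩
      exact_mod_cast this
    exact ⟨e _ h.1.1 h.1.2, e _ h.2.1.1 h.2.1.2, e _ h.2.2.1 h.2.2.2⟩
  have hx1b : ∀ g : J, |(x1 g : ℝ)| ≤ X1 := by
    intro g
    obtain ⟨h1, h2, h3⟩ := hbox g
    refine le_trans ?_ hX1
    simp only [x1]; push_cast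
    refine (abs_add_le _ _).trans ?_
    rw [abs_mul, Nat.abs_cast]
    have := mul_le_mul_of_nonneg_right h3 (Nat.cast_nonneg (α := ℝ) n)
    push_cast at this h1 ⊢
    linarith
  have hx2b : ∀ g : J, |(x2 g : ℝ)| ≤ X2 := by
    intro g
    obtain ⟨h1, h2, h3⟩ := hbox g
    refine le_trans ?_ hX2
    simp only [x2]; push_cast
    refine (abs_sub _ _).trans ?_
    rw [abs_mul, abs_mul, abs_mul, Nat.abs_cast]
    have a1 := mul_le_mul_of_nonneg_right h2 (abs_nonneg (k : ℝ))
    have a2 := mul_le_mul_of_nonneg_right h3 (mul_nonneg (Nat.cast_nonneg (α := ℝ) n) (abs_nonneg (l : ℝ)))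
    push_cast at a1 a2 ⊢
    linarith
  have hlog2 : 0 ≤ Real.log 2 := Real.log_nonneg (by norm_num)
  have hlog2' : Real.log 2 ≠ 0 := (Real.log_pos (by norm_num)).ne'
  let u : J → ℝ := fun g => (x1 g : ℝ) * Real.log Real.goldenRatio + (x2 g : ℝ) / k * Real.log 2
  have hΛk : |Λ / k| ≤ |Λ| := by
    rw [abs_div]; exact div_le_self (abs_nonneg _) hk1
  have huY : ∀ g : J, u g = (g.1.1 : ℝ) * Real.log Real.goldenRatio + (g.1.2.1 : ℝ) * Real.log 2 +
      (g.1.2.2 : ℝ) * Real.log (Real.sqrt 5) + (g.1.2.2 : ℝ) * (Λ / k) := by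
    intro g
    simp only [u, x1, x2, hΛd]
    push_cast
    field_simp
    ring
  have hub : ∀ g : J, |u g| ≤ 2 * R := by
    intro g
    obtain ⟨h1, h2, h3⟩ := hbox g
    rw [huY]
    have a1 := mul_le_mul_of_nonneg_right h1 hlogp
    have a2 := mul_le_mul_of_nonneg_right h2 hlog2
    have a3 := mul_le_mul_of_nonneg_right h3 hlogs5
    have a4 := mul_le_mul h3 (hΛk.trans hΛ1) (abs_nonneg _) (Nat.cast_nonneg _)
    have a5 := mul_le_mul_of_nonneg_left hlogs (Nat.cast_nonneg (α := ℝ) R)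
    calc _ ≤ |(g.1.1 : ℝ)| * Real.log Real.goldenRatio + |(g.1.2.1 : ℝ)| * Real.log 2 +
      |(g.1.2.2 : ℝ)| * Real.log (Real.sqrt 5) + |(g.1.2.2 : ℝ)| * |Λ / k| := by
          refine (abs_add_le _ _).trans (add_le_add ((abs_add_le _ _).trans
            (add_le_add ((abs_add_le _ _).trans (add_le_add ?_ ?_)) ?_)) ?_)
          · rw [abs_mul, abs_of_nonneg hlogp]
          · rw [abs_mul, abs_of_nonneg hlog2]
          · rw [abs_mul, abs_of_nonneg hlogs5]
          · rw [abs_mul]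
      _ ≤ 2 * R := by linarith
  have hAr : (A : ℝ) = ∑ i : Row K L, |((((i.2 : ℕ) : ℤ) - L0 : ℤ) : ℝ)| := by
    rw [← hA, Nat.cast_sum]
    refine sum_congr rfl fun i _ => ?_
    rw [Nat.cast_natAbs, Int.cast_abs]
  have hρ : (1:ℝ) ≤ Real.exp 2 := Real.one_le_exp (by norm_num)
  have han := P1_analytic (ι := Row K L)
    (fun i j => (x1 (φ j) : ℝ) ^ ((i.1.1 : ℕ) - (i.1.2 : ℕ)) * (x2 (φ j) : ℝ) ^ (i.1.2 : ℕ))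
    (fun i => ((((i.2 : ℕ) : ℤ) - L0 : ℤ) : ℝ)) (fun j => u (φ j)) (fun j => ((φ j).1.2.2 : ℝ))
    M q (-(Λ / k)) (Real.exp 2) (X1 ^ S1 * X2 ^ S2) (A * (2 * R)) (A * R) hρ (by positivity)
    (P1_order _ _ _ K q M (fun i => i.1.1)
      (fun e a j => (x1 (φ j) : ℝ) ^ (a : ℕ) * u (φ j) ^ (e - (a : ℕ))) hcard (by
        intro i m
        refine Z8_order K i.1.1 i.1.2 m (by have := i.1.2.2; omega) i.1.1.2 (fun j => (x1 (φ j) : ℝ))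
          (fun j => (x2 (φ j) : ℝ)) (fun j => u (φ j)) (Real.log Real.goldenRatio) (k / Real.log 2) ?_
        intro j
        simp only [u]
        field_simp
        ring) (by
        have : ∑ i : Row K L, (i.1.1 : ℕ) = S1 + S2 := by
          rw [← hS1, ← hS2, ← sum_add_distrib]
          refine sum_congr rfl fun i _ => ?_
          have := i.1.2.2
          omega
        rw [this]; exact hM))
    (by
      intro π
      rw [abs_prod, ← hS1, ← hS2, ← prod_pow_eq_pow_sum, ← prod_pow_eq_pow_sum, ← prod_mul_distrib]
      refine prod_le_prod (fun _ _ => abs_nonneg _) fun i _ => ?_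
      rw [abs_mul, abs_pow, abs_pow]
      exact mul_le_mul (pow_le_pow_left₀ (abs_nonneg _) (hx1b _) _)
        (pow_le_pow_left₀ (abs_nonneg _) (hx2b _) _) (by positivity) (by positivity))
    (by
      intro π
      refine (abs_sum_le_sum_abs _ _).trans ?_
      rw [hAr, sum_mul]
      refine sum_le_sum fun i _ => ?_
      rw [abs_mul]
      exact mul_le_mul_of_nonneg_left (hub _) (abs_nonneg _))
    (by
      intro π
      refine (abs_sum_le_sum_abs _ _).trans ?_
      rw [hAr, sum_mul]
      refine sum_le_sum fun i _ => ?_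
      rw [abs_mul]
      exact mul_le_mul_of_nonneg_left (hbox _).2.2 (abs_nonneg _))
  have hent : (Matrix.of fun i j : Row K L => (x1 (φ j) : ℝ) ^ ((i.1.1 : ℕ) - (i.1.2 : ℕ)) *
      (x2 (φ j) : ℝ) ^ (i.1.2 : ℕ) * Real.exp (((((i.2 : ℕ) : ℤ) - L0 : ℤ) : ℝ) *
        (u (φ j) + -(Λ / k) * ((φ j).1.2.2 : ℝ)))) =
      Matrix.of fun i j => (x1 (φ j) : ℝ) ^ ((i.1.1 : ℕ) - (i.1.2 : ℕ)) * (x2 (φ j) : ℝ) ^ (i.1.2 : ℕ) *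
      Z6_Y (φ j).1 ^ (((i.2 : ℕ) : ℤ) - L0) := by
    ext i j
    simp only [Matrix.of_apply]
    congr 1
    have hY0 : 0 < Z6_Y (φ j).1 := by
      unfold Z6_Y
      have := Real.goldenRatio_pos
      positivity
    have hlogY : Real.log (Z6_Y (φ j).1) = u (φ j) + -(Λ / k) * ((φ j).1.2.2 : ℝ) := by
      have hg := Real.goldenRatio_pos
      rw [huY]
      unfold Z6_Y
      rw [Real.log_mul (by positivity) (by positivity), Real.log_mul (by positivity) (by positivity),
        Real.log_zpow, Real.log_zpow, Real.log_zpow]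
      ring
    rw [← hlogY, ← Real.log_zpow, Real.exp_log (zpow_pos hY0 _)]
  rw [hent, hcard] at han
  set Δ := (Matrix.of fun i j : Row K L => (x1 (φ j) : ℝ) ^ ((i.1.1 : ℕ) - (i.1.2 : ℕ)) *
    (x2 (φ j) : ℝ) ^ (i.1.2 : ℕ) * Z6_Y (φ j).1 ^ (((i.2 : ℕ) : ℤ) - L0)).det with hΔ
  -- arithmetic
  let lam : Row K L → ℤ := fun i => ((i.2 : ℕ) : ℤ) - L0
  set z : F := (Matrix.of fun i j : Row K L => ((x1 (φ j) : ℤ) : F) ^ ((i.1.1 : ℕ) - (i.1.2 : ℕ)) *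
    ((x2 (φ j) : ℤ) : F) ^ (i.1.2 : ℕ) * (ϕ ^ ((φ j).1.1 * lam i) *
      2 ^ ((φ j).1.2.1 * lam i + R * (lam i).natAbs).toNat *
      s5 ^ ((φ j).1.2.2 * lam i + R * (lam i).natAbs).toNat)).det with hz
  have hϕ0 : ϕ ≠ 0 := by
    intro h; rw [h] at hϕ; norm_num at hϕ
  have hϕinv : ϕ⁻¹ = ϕ - 1 := by
    refine inv_eq_of_mul_eq_one_right ?_
    linear_combination hϕ
  have hcast : ∀ m : ℤ, IsIntegral ℤ (m : F) := fun m => by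
    simpa using isIntegral_algebraMap (R := ℤ) (A := F) (x := m)
  have hϕi : IsIntegral ℤ ϕ := by
    refine ⟨Polynomial.X ^ 2 - Polynomial.X - 1, ?_, ?_⟩
    · monicity!
    · simp [hϕ]
  have hϕi' : IsIntegral ℤ ϕ⁻¹ := by
    rw [hϕinv]; exact hϕi.sub isIntegral_one
  have hs5i : IsIntegral ℤ s5 := by
    refine ⟨Polynomial.X ^ 2 - Polynomial.C 5, ?_, ?_⟩
    · monicity!
    · simp [hs5]
  have hzi : IsIntegral ℤ z := by
    refine IsIntegral.det fun i j => ?_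
    simp only [Matrix.of_apply]
    refine IsIntegral.mul (IsIntegral.mul ((hcast _).pow _) ((hcast _).pow _))
      (IsIntegral.mul (IsIntegral.mul (Z8_int_zpow hϕi hϕi' _) (IsIntegral.pow ?_ _)) (hs5i.pow _))
    exact_mod_cast hcast 2
  have hexp : ∀ (i : Row K L) (r : ℤ), |(r : ℝ)| ≤ R →
      0 ≤ r * lam i + R * (lam i).natAbs ∧ r * lam i + R * (lam i).natAbs ≤ (2 * (R * (lam i).natAbs) : ℕ)
      ∧ |r * lam i| ≤ (R * (lam i).natAbs : ℕ) := by
    intro i r hr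
    have h1 : |r| ≤ (R : ℤ) := by exact_mod_cast hr
    have h2 : |r * lam i| ≤ R * (lam i).natAbs := by
      rw [abs_mul, ← Int.abs_eq_natAbs]
      exact mul_le_mul_of_nonneg_right h1 (abs_nonneg _)
    have h3 := abs_le.1 h2
    refine ⟨by linarith, ?_, ?_⟩
    · rw [Nat.cast_mul, Nat.cast_mul, Nat.cast_two]; linarith
    · rw [Nat.cast_mul]; exact h2
  have hsum : ∑ i : Row K L, R * (lam i).natAbs = R * A := by rw [← hA, mul_sum]
  have hσz : σ0 z = (2 * Real.sqrt 5) ^ (R * A) * Δ := by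
    rw [hz, RingHom.map_det, hΔ, ← hsum, ← prod_pow_eq_pow_sum, ← Matrix.det_mul_column]
    congr 1
    ext i j
    simp only [RingHom.mapMatrix_apply, Matrix.map_apply, Matrix.of_apply, map_mul, map_pow,
      map_intCast, map_ofNat, map_zpow₀, hσϕ, hσs]
    have hb := hbox (φ j)
    have h2 := (hexp i _ hb.2.1).1
    have h3 := (hexp i _ hb.2.2).1
    have h5 : Real.sqrt 5 ≠ 0 := by positivity
    have e2 : (2:ℝ) ^ ((φ j).1.2.1 * lam i + R * (lam i).natAbs).toNat =
        (2 ^ (φ j).1.2.1) ^ lam i * 2 ^ (R * (lam i).natAbs) := by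
      rw [← zpow_natCast, Int.toNat_of_nonneg h2, zpow_add₀ two_ne_zero, zpow_mul, ← zpow_natCast (2:ℝ) (R * _)]
      push_cast; rfl
    have e3 : (Real.sqrt 5) ^ ((φ j).1.2.2 * lam i + R * (lam i).natAbs).toNat =
        (Real.sqrt 5 ^ (φ j).1.2.2) ^ lam i * Real.sqrt 5 ^ (R * (lam i).natAbs) := by
      rw [← zpow_natCast, Int.toNat_of_nonneg h3, zpow_add₀ h5, zpow_mul, ← zpow_natCast (Real.sqrt 5) (R * _)]
      push_cast; rfl
    have e4 : Z6_Y (φ j).1 ^ (((i.2 : ℕ) : ℤ) - L0) = Real.goldenRatio ^ ((φ j).1.1 * lam i) *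
        (2 ^ (φ j).1.2.1) ^ lam i * (Real.sqrt 5 ^ (φ j).1.2.2) ^ lam i := by
      unfold Z6_Y
      rw [mul_zpow, mul_zpow, zpow_mul]
    rw [e2, e3, e4, mul_pow]
    ring
  have hz0 : z ≠ 0 := by
    intro h0
    rw [h0, map_zero] at hσz
    have : (2 * Real.sqrt 5) ^ (R * A) * Δ ≠ 0 := mul_ne_zero (by positivity) hφ
    exact this hσz.symm
  have hg1 := Real.one_lt_goldenRatio
  set H : ℝ := (K * q).factorial * (X1 ^ S1 * X2 ^ S2 * (20 * Real.goldenRatio) ^ (R * A)) with hH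
  have hH1 : 1 ≤ H := by
    have a1 : (1:ℝ) ≤ (K * q).factorial := by exact_mod_cast Nat.factorial_pos _
    have a2 : 1 ≤ X1 ^ S1 := one_le_pow₀ hX1'
    have a3 : 1 ≤ X2 ^ S2 := one_le_pow₀ hX2'
    have a4 : 1 ≤ (20 * Real.goldenRatio) ^ (R * A) := one_le_pow₀ (by linarith)
    exact one_le_mul_of_one_le_of_one_le a1 (one_le_mul_of_one_le_of_one_le
      (one_le_mul_of_one_le_of_one_le a2 a3) a4)
  have hHb : ∀ σ : F →+* ℂ, ‖σ z‖ ≤ H := by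
    intro σ
    rw [hz, RingHom.map_det]
    have hw := Z8_emb (σ ϕ) (by rw [← map_pow, hϕ, map_add, map_one])
    have hs : ‖σ s5‖ = Real.sqrt 5 := by
      have : ‖σ s5‖ ^ 2 = 5 := by
        rw [← norm_pow, ← map_pow, hs5, map_ofNat, Complex.norm_ofNat]
      rw [← this, Real.sqrt_sq (norm_nonneg _)]
    have h51 : 1 ≤ Real.sqrt 5 := Real.one_le_sqrt.2 (by norm_num)
    refine (L_detbound _ (fun i => X1 ^ ((i.1.1 : ℕ) - (i.1.2 : ℕ)) * X2 ^ (i.1.2 : ℕ) *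
      (20 * Real.goldenRatio) ^ (R * (lam i).natAbs)) ?_).trans ?_
    · intro i j
      simp only [RingHom.mapMatrix_apply, Matrix.map_apply, Matrix.of_apply, map_mul, map_pow,
        map_intCast, map_ofNat, map_zpow₀, norm_mul, norm_pow, hs]
      have hb := hbox (φ j)
      have h1 := (hexp i _ hb.1).2.2
      have h2 := (hexp i _ hb.2.1).2.1
      have h3 := (hexp i _ hb.2.2).2.1
      have n1 : ‖((x1 (φ j) : ℤ) : ℂ)‖ ≤ X1 := by rw [Complex.norm_intCast]; exact hx1b _
      have n2 : ‖((x2 (φ j) : ℤ) : ℂ)‖ ≤ X2 := by rw [Complex.norm_intCast]; exact hx2b _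
      have n3 := Z8_norm_zpow hg1.le hw.1 hw.2 _ _ h1
      have n4 : ‖(2:ℂ)‖ ^ ((φ j).1.2.1 * lam i + R * (lam i).natAbs).toNat ≤ 4 ^ (R * (lam i).natAbs) := by
        rw [Complex.norm_two]
        refine (pow_le_pow_right₀ (by norm_num) (Int.toNat_le.2 h2)).trans ?_
        rw [pow_mul]; norm_num
      have n5 : Real.sqrt 5 ^ ((φ j).1.2.2 * lam i + R * (lam i).natAbs).toNat ≤ 5 ^ (R * (lam i).natAbs) := by
        refine (pow_le_pow_right₀ h51 (Int.toNat_le.2 h3)).trans ?_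
        rw [pow_mul, Real.sq_sqrt (by norm_num)]
      have e : (20 * Real.goldenRatio) ^ (R * (lam i).natAbs) = Real.goldenRatio ^ (R * (lam i).natAbs) *
        4 ^ (R * (lam i).natAbs) * 5 ^ (R * (lam i).natAbs) := by
        rw [← mul_pow, ← mul_pow]; congr 1; ring
      rw [e]
      gcongr
    · rw [prod_mul_distrib, prod_mul_distrib, prod_pow_eq_pow_sum, prod_pow_eq_pow_sum,
        prod_pow_eq_pow_sum, hS1, hS2, hsum, hcard]
  have hlio := L_liouville (Complex.ofRealHom.comp σ0) z hzi hz0 H hH1 hHb 1 (by omega)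
  have hnn : ‖(Complex.ofRealHom.comp σ0) z‖ = |σ0 z| := by simp
  rw [hnn, hσz, abs_mul, abs_of_pos (by positivity), pow_one] at hlio
  refine hlio.trans ?_
  rw [mul_assoc]
  have hH0 : 0 ≤ H := by linarith
  have hΔb : |Δ| ≤ (K * q).factorial * (X1 ^ S1 * X2 ^ S2) * (Real.exp 2 ^ M)⁻¹ *
      Real.exp (Real.exp 2 * (A * (2 * (R : ℕ))) + 1) := by
    refine han.trans ?_
    gcongr
    refine le_trans ?_ hΛ2
    refine mul_le_mul_of_nonneg_right (mul_le_mul_of_nonneg_left ?_ (by positivity)) (by positivity)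
    rw [abs_neg]; exact hΛk
  gcongr

end

section
open Finset

theorem Z10_phi : 1.618 < Real.goldenRatio ∧ Real.goldenRatio < 1.6181 ∧ 2.236 < Real.sqrt 5 ∧
    Real.sqrt 5 < 2.2361 := by
  have h1 : 2.236 < Real.sqrt 5 := Real.lt_sqrt_of_sq_lt (by norm_num)
  have h2 : Real.sqrt 5 < 2.2361 := (Real.sqrt_lt' (by norm_num)).2 (by norm_num)
  unfold Real.goldenRatio
  refine ⟨by linarith, by linarith, h1, h2⟩

theorem Z10_theta : 84 / 121 * Real.log 2 < Real.log Real.goldenRatio ∧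
    Real.log Real.goldenRatio < 109 / 157 * Real.log 2 := by
  have hg := Real.goldenRatio_pos
  have h1 : Real.sqrt 5 ^ 2 = 5 := Real.sq_sqrt (by norm_num)
  have hf : ∀ m : ℕ, Real.goldenRatio ^ (m + 1) = Nat.fib (m + 1) * Real.goldenRatio + Nat.fib m := by
    intro m
    induction m with
    | zero => simp
    | succ m ih =>
      rw [pow_succ, ih, Nat.fib_add_two (n := m)]
      push_cast
      have := Real.goldenRatio_sq
      linear_combination (Nat.fib (m + 1) : ℝ) * this
  obtain ⟨b1, b2, -, -⟩ := Z10_phi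
  constructor
  · have h : Real.log (2 ^ 84) < Real.log (Real.goldenRatio ^ 121) := by
      refine Real.log_lt_log (by positivity) ?_
      rw [hf 120]
      have e1 : Nat.fib (120 + 1) = 8670007398507948658051921 := by norm_num
      have e2 : Nat.fib 120 = 5358359254990966640871840 := by norm_num
      rw [e1, e2]
      norm_num
      linarith
    rw [Real.log_pow, Real.log_pow] at h
    push_cast at h
    linarith
  · have h : Real.log (Real.goldenRatio ^ 157) < Real.log (2 ^ 109) := by
      refine Real.log_lt_log (by positivity) ?_
      rw [hf 156]
      have e1 : Nat.fib (156 + 1) = 289450641941273985495088042104137 := by norm_num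
      have e2 : Nat.fib 156 = 178890334785183168257455287891792 := by norm_num
      rw [e1, e2]
      norm_num
      linarith
    rw [Real.log_pow, Real.log_pow] at h
    push_cast at h
    linarith

theorem Z10_fin (v1 v2 : ℤ) (h1 : 0 < v1) (h2 : v1 < 32) :
    3 ≤ 84 * v1 + 121 * v2 ∨ 109 * v1 + 157 * v2 ≤ -4 := by
  interval_cases v1 <;> omega

theorem Z10_lin (v1 v2 : ℤ) (hv : v1 ≠ 0 ∨ v2 ≠ 0) (h1 : |v1| < 32) (h2 : |v2| < 32) :
    0.0138 ≤ |(v2 : ℝ) * Real.log 2 + v1 * Real.log Real.goldenRatio| := by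
  obtain ⟨t1, t2⟩ := Z10_theta
  have l2 := Real.log_two_gt_d9
  have key : ∀ v1 v2 : ℤ, 0 < v1 → v1 < 32 →
      0.0138 ≤ |(v2 : ℝ) * Real.log 2 + v1 * Real.log Real.goldenRatio| := by
    intro v1 v2 h1 h2
    have h1' : (0:ℝ) < v1 := by exact_mod_cast h1
    rw [le_abs]
    rcases Z10_fin v1 v2 h1 h2 with h | h
    · left
      have h' : (3:ℝ) ≤ 84 * v1 + 121 * v2 := by exact_mod_cast h
      have a := mul_lt_mul_of_pos_left t1 h1'
      have b := mul_le_mul_of_nonneg_right h' (by linarith : 0 ≤ Real.log 2)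
      linarith
    · right
      have h' : (109:ℝ) * v1 + 157 * v2 ≤ -4 := by exact_mod_cast h
      have a := mul_lt_mul_of_pos_left t2 h1'
      have b := mul_le_mul_of_nonneg_right h' (by linarith : 0 ≤ Real.log 2)
      linarith
  rcases lt_trichotomy v1 0 with h | h | h
  · have := key (-v1) (-v2) (by omega) (by have := (abs_lt.1 h1).1; omega)
    rw [← abs_neg]
    push_cast at this
    convert this using 2
    ring
  · subst h
    have hv2 : v2 ≠ 0 := by simpa using hv
    have : (1:ℝ) ≤ |(v2:ℝ)| := by exact_mod_cast Int.one_le_abs hv2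
    rw [Int.cast_zero, zero_mul, add_zero, abs_mul, abs_of_pos (by linarith : 0 < Real.log 2)]
    have := mul_le_mul_of_nonneg_right this (by linarith : 0 ≤ Real.log 2)
    linarith
  · exact key v1 v2 h (abs_lt.1 h1).2

theorem Z10_logs : Real.log Real.goldenRatio + Real.log 2 + Real.log (Real.sqrt 5) ≤ 1.9999 ∧
    0 ≤ Real.log Real.goldenRatio ∧ 0 ≤ Real.log (Real.sqrt 5) ∧ Real.log (2 * Real.sqrt 5) ≤ 1.5 ∧
    Real.log (20 * Real.goldenRatio) ≤ 3.5 ∧ Real.exp 2 ≤ 7.5 ∧ Real.log (Real.sqrt 5) ≤ 1 := by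
  obtain ⟨b1, b2, b3, b4⟩ := Z10_phi
  have e1 := Real.exp_one_gt_d9
  have e2 := Real.exp_one_lt_d9
  have hsq : Real.sqrt 5 ^ 2 = 5 := Real.sq_sqrt (by norm_num)
  have x2 : Real.exp 2 = Real.exp 1 ^ 2 := by rw [← Real.exp_nat_mul]; norm_num
  refine ⟨?_, Real.log_nonneg (by linarith), Real.log_nonneg (by linarith), ?_, ?_, ?_, ?_⟩
  · rw [← Real.log_mul (by linarith) (by norm_num), ← Real.log_mul (by linarith) (by linarith)]
    rw [Real.log_le_iff_le_exp (by nlinarith)]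
    have h1 : Real.exp 1.9999 = Real.exp 2 * Real.exp (-0.0001) := by
      rw [← Real.exp_add]; norm_num
    have h2 : 0.9999 ≤ Real.exp (-0.0001) := by
      have := Real.add_one_le_exp (-0.0001 : ℝ); linarith
    have h3 : 7.38 ≤ Real.exp 2 := by rw [x2]; nlinarith
    rw [h1]; nlinarith
  · have h : Real.log ((2 * Real.sqrt 5) ^ 2) ≤ 3 := by
      rw [mul_pow, hsq, Real.log_le_iff_le_exp (by norm_num)]
      have : Real.exp 3 = Real.exp 1 ^ 3 := by rw [← Real.exp_nat_mul]; norm_num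
      rw [this]
      have : (2.7182 : ℝ) ^ 3 ≤ Real.exp 1 ^ 3 := pow_le_pow_left₀ (by norm_num) (by linarith) 3
      norm_num at this ⊢; linarith
    rw [Real.log_pow] at h; push_cast at h; linarith
  · have h : Real.log ((20 * Real.goldenRatio) ^ 2) ≤ 7 := by
      rw [Real.log_le_iff_le_exp (by nlinarith)]
      have : Real.exp 7 = Real.exp 1 ^ 7 := by rw [← Real.exp_nat_mul]; norm_num
      rw [this]
      have : (2.71 : ℝ) ^ 7 ≤ Real.exp 1 ^ 7 := pow_le_pow_left₀ (by norm_num) (by linarith) 7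
      norm_num at this ⊢; nlinarith
    rw [Real.log_pow] at h; push_cast at h; linarith
  · rw [x2]; nlinarith
  · rw [Real.log_le_iff_le_exp (by linarith)]; linarith

theorem Z10_ind (h : ℕ) (hh : 49 ≤ h) : 110000 * (30 * h + 1) ^ 3 ≤ 2 ^ h := by
  induction h, hh using Nat.le_induction with
  | base => norm_num
  | succ h hh ih =>
    rw [pow_succ 2 h]
    have : (30 * (h + 1) + 1) ^ 3 ≤ 2 * (30 * h + 1) ^ 3 := by nlinarith [pow_pos (show 0 < h by omega) 3, mul_le_mul hh hh (by omega) (by omega), mul_le_mul_of_nonneg_right hh (show 0 ≤ h*h by positivity)]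
    linarith

end

section
open Finset

theorem Z11_num (h : ℕ) (hh : 49 ≤ h) (K q L c A S M N lN lX : ℝ) (hL : L = 30 * h + 1)
    (hc : c = 128 * L ^ 2) (hK : K + 1 = 160 * c) (hq : q = 80 * c * L)
    (hA : A = 20 * c * K * (L ^ 2 - 1)) (hS : 6 * S + L * K = L * K ^ 3)
    (hM : M = K * (q * (q - 1) / 2) - 2 * S) (hN : N = K * q) (hlN : lN ≤ 4 * c)
    (hlX : lX ≤ 7 * h)
    (hmain : 0 ≤ 1.5 * (8 * c * A) + 2 * (N * lN) + 2 * (S * lX) - 2 * M + 7.5 * (A * (2 * (8 * c))) + 1 +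
      3.5 * (8 * c * A)) : False := by
  have hhr : (49:ℝ) ≤ h := by exact_mod_cast hh
  have hL1 : 1471 ≤ L := by rw [hL]; linarith
  have hc1 : 128 ≤ c := by rw [hc]; nlinarith
  have hK1 : 1 ≤ K := by linarith
  have hS0 : 6 * S ≤ L * K * (160 * c) ^ 2 := by
    have : K ^ 2 ≤ (160 * c) ^ 2 := pow_le_pow_left₀ (by linarith) (by linarith) 2
    have := mul_le_mul_of_nonneg_left this (show 0 ≤ L * K by positivity)
    have h0 : 0 ≤ L * K := by positivity
    nlinarith
  have hSlX : S * lX ≤ S * (7 * h) := by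
    refine mul_le_mul_of_nonneg_left hlX ?_
    have h1 : L * K * 1 ≤ L * K * K ^ 2 := mul_le_mul_of_nonneg_left (one_le_pow₀ hK1) (by positivity)
    nlinarith
  have hNlN : N * lN ≤ N * (4 * c) := mul_le_mul_of_nonneg_left hlN (by rw [hN, hq]; positivity)
  have h2 : S * (2 + 7 * h) * 6 ≤ L * K * (160 * c) ^ 2 * (2 + 7 * h) := by
    have := mul_le_mul_of_nonneg_right hS0 (show (0:ℝ) ≤ 2 + 7 * h by positivity)
    linarith
  have h3 : 0 ≤ 20 * (8 * c * A) + 8 * N * c + 2 * (S * (2 + 7 * h)) - K * (q * (q - 1)) + 1 := by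
    rw [hM] at hmain
    linarith
  have h4 : 0 ≤ 3 * (20 * (8 * c * A) + 8 * N * c - K * (q * (q - 1)) + 1) +
      L * K * (160 * c) ^ 2 * (2 + 7 * h) := by linarith
  rw [hA, hN, hq] at h4
  have hP : 1 ≤ K * c := by nlinarith
  have h5 : 0 ≤ (K * c) * (3 * (3200 * c * (L ^ 2 - 1) + 640 * c * L - 6400 * c * L ^ 2 + 80 * L + 1) +
      25600 * L * c * (2 + 7 * h)) := by
    have e : (K * c) * (3 * (3200 * c * (L ^ 2 - 1) + 640 * c * L - 6400 * c * L ^ 2 + 80 * L + 1) +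
      25600 * L * c * (2 + 7 * h)) = 3 * (20 * (8 * c * (20 * c * K * (L ^ 2 - 1))) + 8 * (K * (80 * c * L)) * c
        - K * (80 * c * L * (80 * c * L - 1)) + 1) +
      L * K * (160 * c) ^ 2 * (2 + 7 * h) + 3 * (K * c - 1) := by ring
    rw [e]; linarith
  have h6 := nonneg_of_mul_nonneg_right h5 (by linarith : 0 < K * c)
  have h7 : 3 * (3200 * c * (L ^ 2 - 1) + 640 * c * L - 6400 * c * L ^ 2 + 80 * L + 1) +
      25600 * L * c * (2 + 7 * h) = L * c * (- 9600 * L + 1920 + 25600 * (2 + 7 * h)) + 240 * L + 3 - 9600 * c := by ring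
  rw [h7, hL] at h6
  rw [← hL] at h6
  have h8 : L * c * (- 9600 * L + 1920 + 25600 * (2 + 7 * h)) ≤ L * c * (-1000) := by
    refine mul_le_mul_of_nonneg_left ?_ (by positivity)
    rw [hL]; linarith
  nlinarith

set_option maxHeartbeats 1000000 in
theorem P5_final0 {F : Type*} [Field F] [NumberField F] (hdeg : Module.finrank ℚ F ≤ 2)
    (σ0 : F →+* ℝ) (ϕ s5 : F) (hϕ : ϕ ^ 2 = ϕ + 1) (hs5 : s5 ^ 2 = 5)
    (hσϕ : σ0 ϕ = Real.goldenRatio) (hσs : σ0 s5 = Real.sqrt 5)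
    (n h : ℕ) (hh : 49 ≤ h) (hn1 : 2 ^ h ≤ n) (hn2 : n < 2 ^ (h + 1)) (k l : ℤ) (hk : k ≠ 0)
    (hkb : |k| ≤ 2 ^ (6 * h + 14)) (hlb : |l| ≤ 2 ^ (6 * h + 14))
    (hΛ : |k * (n * Real.log Real.goldenRatio - Real.log (Real.sqrt 5)) - n * l * Real.log 2| ≤
      Real.exp (-(n / 5))) : False := by
  obtain ⟨g1, g2, g3, g4, g5, g6, g7⟩ := Z10_logs
  have hind := Z10_ind h hh
  obtain ⟨L0, hL0⟩ : ∃ L0, L0 = 15 * h := ⟨_, rfl⟩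
  obtain ⟨c', hc'⟩ : ∃ c', c' = 4 * (2 * L0 + 1) ^ 2 := ⟨_, rfl⟩
  obtain ⟨c, hc⟩ : ∃ c, c = 32 * c' := ⟨_, rfl⟩
  obtain ⟨K, hK⟩ : ∃ K, K + 1 = 160 * c := ⟨160 * c - 1, by
    have : 1 ≤ (2 * L0 + 1) ^ 2 := Nat.one_le_pow _ _ (by omega)
    omega⟩
  obtain ⟨q, hq⟩ : ∃ q, q = 80 * c * (2 * L0 + 1) := ⟨_, rfl⟩
  have hL : 2 * L0 + 1 = 30 * h + 1 := by omega
  have hcL : c = 128 * (2 * L0 + 1) ^ 2 := by omega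
  obtain ⟨S, hS⟩ : ∃ S, S = ∑ i : Row K (2 * L0 + 1), (i.1.2 : ℕ) := ⟨_, rfl⟩
  obtain ⟨A, hA⟩ : ∃ A, A = ∑ i : Row K (2 * L0 + 1), (((i.2 : ℕ) : ℤ) - L0).natAbs := ⟨_, rfl⟩
  have hS2 := Z7_k2 K (2 * L0 + 1)
  have hS1 := Z7_k1 K (2 * L0 + 1)
  have hA2 := Z7_A K L0
  rw [← hS] at hS2
  rw [← hA] at hA2
  have hS1' : ∑ i : Row K (2 * L0 + 1), ((i.1.1 : ℕ) - (i.1.2 : ℕ)) = S := by omega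
  have hAc : A = 80 * c * K * (L0 * (L0 + 1)) := by
    have : 2 * A = 2 * (80 * c * K * (L0 * (L0 + 1))) := by rw [hA2, hK]; ring
    omega
  obtain ⟨L, hLdef⟩ : ∃ L, L = 2 * L0 + 1 := ⟨_, rfl⟩
  have hL1471 : 1471 ≤ L := by omega
  rw [← hLdef] at hcL hL hS2
  rw [← hL] at hind
  have hnL : 110000 * L ^ 3 ≤ n := hind.trans hn1
  have hA4 : A + 20 * c * K = 20 * c * K * L ^ 2 := by rw [hAc, hLdef]; ring
  have hLL : 1471 * L ≤ L ^ 2 := by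
    rw [pow_two]; exact Nat.mul_le_mul_right _ hL1471
  have hc1 : 1471 ≤ c := by omega
  have hLc : L ^ 2 ≤ c := by omega
  have hLc1 : L ≤ c := by omega
  have hq2 : 2 * (q * (q - 1) / 2) = q * (q - 1) := Nat.mul_div_cancel' (Nat.even_mul_pred_self q).two_dvd
  have hcL2 : c * L = 128 * L ^ 3 := by rw [hcL]; ring
  have hcn : 1471 * 128 * L ^ 2 ≤ 128 * L ^ 3 := by
    have := Nat.mul_le_mul_right (L ^ 2) hL1471
    have e : L ^ 3 = L * L ^ 2 := by ring
    omega
  have hcn' : 1471 * c ≤ 128 * L ^ 3 := by omega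
  have hnpos : 0 < n := by omega
  have hMle : S + S ≤ K * (q * (q - 1) / 2) := by
    have a1 : 6 * (S + S) ≤ 2 * (L * K * (160 * c) ^ 2) := by
      have : L * K ^ 3 ≤ L * K * (160 * c) ^ 2 := by
        have := Nat.pow_le_pow_left (show K ≤ 160 * c by omega) 2
        calc L * K ^ 3 = L * K * K ^ 2 := by ring
          _ ≤ _ := Nat.mul_le_mul_left _ this
      omega
    have a2 : 40 * c * L ≤ q - 1 := by rw [hq, ← hLdef]; have : 1 ≤ c * L := Nat.mul_pos (by omega) (by omega)
                                       have e : 80 * c * L = 80 * (c * L) := by ring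
                                       have e' : 40 * c * L = 40 * (c * L) := by ring
                                       omega
    have a3 : 80 * c * L * (40 * c * L) ≤ q * (q - 1) := by
      refine Nat.mul_le_mul (by rw [hq, hLdef]) a2
    have a4 : K * (80 * c * L * (40 * c * L)) ≤ K * (q * (q - 1)) := Nat.mul_le_mul_left _ a3
    have a5 : L * K * (160 * c) ^ 2 ≤ K * (80 * c * L * (40 * c * L)) := by
      calc L * K * (160 * c) ^ 2 = K * c ^ 2 * L * 25600 := by ring
        _ ≤ K * c ^ 2 * L * (3200 * L) := Nat.mul_le_mul_left _ (by omega)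
        _ = _ := by ring
    rw [← hq2] at a4
    have e : K * (2 * (q * (q - 1) / 2)) = 2 * (K * (q * (q - 1) / 2)) := by ring
    omega
  obtain ⟨M, hM⟩ : ∃ M, M + (S + S) = K * (q * (q - 1) / 2) := ⟨_, Nat.sub_add_cancel hMle⟩
  obtain ⟨Λ, hΛd⟩ : ∃ Λ : ℝ, Λ = k * (n * Real.log Real.goldenRatio - Real.log (Real.sqrt 5)) -
    n * l * Real.log 2 := ⟨_, rfl⟩
  rw [← hΛd] at hΛ
  have hkr1 : (1:ℝ) ≤ |(k:ℝ)| := by exact_mod_cast Int.one_le_abs hk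
  have hcr : (1471:ℝ) ≤ c := by exact_mod_cast hc1
  have hn5 : (166:ℝ) * (c * L) ≤ n / 5 := by
    have : 830 * (c * L) ≤ n := by rw [hcL2]; omega
    have : (830:ℝ) * (c * L) ≤ n := by exact_mod_cast this
    linarith
  have hLr : (1471:ℝ) ≤ L := by exact_mod_cast hL1471
  have hcLr : (c:ℝ) * 1471 ≤ c * L := mul_le_mul_of_nonneg_left hLr (by linarith)
  have hΛ1 : |Λ| ≤ 1 / 10000 := by
    refine hΛ.trans ?_
    rw [Real.exp_neg, one_div]
    refine inv_anti₀ (by norm_num) ?_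
    have := Real.add_one_le_exp ((n:ℝ) / 5)
    linarith
  have hΛ2 : Real.exp 2 ^ q * |Λ| * (A * (8 * c : ℕ)) ≤ 1 := by
    have hAb : A * (8 * c) ≤ c ^ 6 := by
      have b1 : A ≤ 20 * c * (160 * c) * c := by
        have : 20 * c * K * L ^ 2 ≤ 20 * c * (160 * c) * c :=
          Nat.mul_le_mul (Nat.mul_le_mul_left _ (by omega)) hLc
        omega
      calc A * (8 * c) ≤ 20 * c * (160 * c) * c * (8 * c) := Nat.mul_le_mul_right _ b1
        _ = c ^ 4 * 25600 := by ring
        _ ≤ c ^ 4 * c ^ 2 := Nat.mul_le_mul_left _ ((show 25600 ≤ 1471 ^ 2 by norm_num).trans (Nat.pow_le_pow_left hc1 2))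
        _ = c ^ 6 := by ring
    have hAr : (A:ℝ) * (8 * c : ℕ) ≤ Real.exp (6 * c) := by
      have h1 : (A:ℝ) * (8 * c : ℕ) ≤ (c:ℝ) ^ 6 := by exact_mod_cast hAb
      have h2 : (c:ℝ) ^ 6 ≤ Real.exp c ^ 6 := by
        have := Real.add_one_le_exp (c:ℝ)
        exact pow_le_pow_left₀ (by positivity) (by linarith) 6
      refine h1.trans (h2.trans (le_of_eq ?_))
      rw [← Real.exp_nat_mul]; norm_num
    calc Real.exp 2 ^ q * |Λ| * (A * (8 * c : ℕ)) ≤ Real.exp 2 ^ q * Real.exp (-(n/5)) * Real.exp (6 * c) := by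
          gcongr
      _ = Real.exp (q * 2 + -(n/5) + 6 * c) := by
          rw [← Real.exp_nat_mul, Real.exp_add, Real.exp_add]
      _ ≤ 1 := by
          rw [Real.exp_le_one_iff]
          have : (q:ℝ) = 80 * (c * L) := by rw [hq, ← hLdef]; push_cast; ring
          rw [this]
          linarith
  have hθ : ∀ v1 v2 : ℤ, (v1 ≠ 0 ∨ v2 ≠ 0) → |v1| < 32 → |v2| < 32 →
      768 * c * |k| < n * |v2 * k + v1 * l| := by
    intro v1 v2 hv h1 h2
    have hlin := Z10_lin v1 v2 hv h1 h2
    have l2 := Real.log_two_gt_d9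
    have l2' := Real.log_two_lt_d9
    have e : (n:ℝ) * Real.log 2 * (v2 * k + v1 * l) = n * k * (v2 * Real.log 2 + v1 * Real.log Real.goldenRatio) -
        v1 * (k * Real.log (Real.sqrt 5) + Λ) := by rw [hΛd]; ring
    have hv1 : |(v1:ℝ)| ≤ 32 := by exact_mod_cast h1.le
    have e1 : |(v1:ℝ) * (k * Real.log (Real.sqrt 5) + Λ)| ≤ 64 * |(k:ℝ)| := by
      rw [abs_mul]
      have : |k * Real.log (Real.sqrt 5) + Λ| ≤ 2 * |(k:ℝ)| := by
        refine (abs_add_le _ _).trans ?_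
        rw [abs_mul, abs_of_nonneg g3]
        have := mul_le_mul_of_nonneg_left g7 (abs_nonneg (k:ℝ))
        linarith
      calc _ ≤ 32 * (2 * |(k:ℝ)|) := mul_le_mul hv1 this (abs_nonneg _) (by norm_num)
        _ = _ := by ring
    have e2 : (n:ℝ) * |(k:ℝ)| * 0.0138 ≤ |n * k * (v2 * Real.log 2 + v1 * Real.log Real.goldenRatio)| := by
      rw [abs_mul, abs_mul, Nat.abs_cast]
      exact mul_le_mul_of_nonneg_left hlin (by positivity)
    have e3 : |(n:ℝ) * Real.log 2 * (v2 * k + v1 * l)| ≤ n * |(v2:ℝ) * k + v1 * l| := by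
      rw [abs_mul, abs_mul, Nat.abs_cast, abs_of_pos (by linarith : 0 < Real.log 2)]
      have : (n:ℝ) * Real.log 2 ≤ n * 1 := mul_le_mul_of_nonneg_left (by linarith) (by positivity)
      calc _ ≤ (n:ℝ) * 1 * |(v2:ℝ) * k + v1 * l| := mul_le_mul_of_nonneg_right this (abs_nonneg _)
        _ = _ := by ring
    have e4 : (n:ℝ) * |(k:ℝ)| * 0.0138 - 64 * |(k:ℝ)| ≤ |(n:ℝ) * Real.log 2 * (v2 * k + v1 * l)| := by
      rw [e]
      have := abs_sub_abs_le_abs_sub (n * k * (v2 * Real.log 2 + v1 * Real.log Real.goldenRatio))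
        ((v1:ℝ) * (k * Real.log (Real.sqrt 5) + Λ))
      linarith
    have e5 : (768:ℝ) * c < n * 0.0138 - 64 := by linarith
    have e6 := mul_lt_mul_of_pos_right e5 (by linarith : 0 < |(k:ℝ)|)
    have : (768:ℝ) * c * |(k:ℝ)| < n * |(v2:ℝ) * k + v1 * l| := by linarith
    exact_mod_cast this
  have hR : 8 * c * 2 ^ 17 ≤ 2 ^ h := by
    refine le_trans ?_ hind
    rw [hcL]
    calc 8 * (128 * L ^ 2) * 2 ^ 17 = L ^ 2 * 134217728 := by ring
      _ ≤ L ^ 2 * (110000 * L) := Nat.mul_le_mul_left _ (by omega)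
      _ = _ := by ring
  have hR' : 8 * c ≤ 2 ^ (h - 17) := by
    have : 2 ^ h = 2 ^ (h - 17) * 2 ^ 17 := by rw [← pow_add]; congr 1; omega
    rw [this] at hR
    exact Nat.le_of_mul_le_mul_right hR (by norm_num)
  have hRr : ((8 * c : ℕ) : ℝ) ≤ 2 ^ (h - 17) := by exact_mod_cast hR'
  have hn1r : 1 + (n:ℝ) ≤ 2 ^ (h + 1) := by
    have : 1 + n ≤ 2 ^ (h + 1) := by omega
    exact_mod_cast this
  have hkbr : |(k:ℝ)| ≤ 2 ^ (6 * h + 14) := by exact_mod_cast hkb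
  have hlbr : |(l:ℝ)| ≤ 2 ^ (6 * h + 14) := by exact_mod_cast hlb
  have hcore := Z9_core hdeg σ0 ϕ s5 hϕ hs5 hσϕ hσs n c c' L0 K q M S S A hc' hc hK (by omega) k l hk hθ
    hq hS1' hS.symm hA.symm hM.le (2 ^ (2 * h - 16)) (2 ^ (8 * h - 2))
    (by
      calc _ ≤ (2:ℝ) ^ (h - 17) * 2 ^ (h + 1) := mul_le_mul hRr hn1r (by positivity) (by positivity)
        _ = _ := by rw [← pow_add]; congr 1; omega)
    (by
      have : |(k:ℝ)| + n * |(l:ℝ)| ≤ 2 ^ (6 * h + 14) * 2 ^ (h + 1) := by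
        calc _ ≤ (2:ℝ) ^ (6 * h + 14) + n * 2 ^ (6 * h + 14) := by gcongr
          _ = (2:ℝ) ^ (6 * h + 14) * (1 + n) := by ring
          _ ≤ _ := by gcongr
      calc _ ≤ (2:ℝ) ^ (h - 17) * (2 ^ (6 * h + 14) * 2 ^ (h + 1)) := mul_le_mul hRr this (by positivity) (by positivity)
        _ = _ := by rw [← pow_add, ← pow_add]; congr 1; omega)
    (one_le_pow₀ (by norm_num)) (one_le_pow₀ (by norm_num)) Λ hΛd hΛ1 hΛ2 g1 g2 g3
  have hlog := Real.log_nonneg hcore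
  have hg0 := Real.goldenRatio_pos
  have hfpos : (0:ℝ) < (K * q).factorial := by exact_mod_cast Nat.factorial_pos _
  have p1 : (0:ℝ) < 2 * Real.sqrt 5 := by positivity
  have p2 : (0:ℝ) < 20 * Real.goldenRatio := by positivity
  have lgf : Real.log ((K * q).factorial) ≤ (K * q : ℕ) * Real.log (K * q : ℕ) := by
    rw [← Real.log_pow]
    refine Real.log_le_log hfpos ?_
    exact_mod_cast Nat.factorial_le_pow (K * q)
  have el : Real.log ((2 * Real.sqrt 5) ^ ((8 * c) * A) * (((K * q).factorial *
      (((2:ℝ) ^ (2 * h - 16)) ^ S * (2 ^ (8 * h - 2)) ^ S) * (Real.exp 2 ^ M)⁻¹ *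
      Real.exp (Real.exp 2 * (A * (2 * (8 * c : ℕ))) + 1)) *
      ((K * q).factorial * (((2:ℝ) ^ (2 * h - 16)) ^ S * (2 ^ (8 * h - 2)) ^ S *
        (20 * Real.goldenRatio) ^ ((8 * c) * A))))) =
      ((8 * c * A : ℕ) : ℝ) * Real.log (2 * Real.sqrt 5) + 2 * Real.log ((K * q).factorial) +
      2 * (S * (((2 * h - 16 : ℕ) : ℝ) * Real.log 2 + ((8 * h - 2 : ℕ) : ℝ) * Real.log 2)) - 2 * M +
      (Real.exp 2 * (A * (2 * (8 * c : ℕ))) + 1) + ((8 * c * A : ℕ) : ℝ) * Real.log (20 * Real.goldenRatio) := by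
    have x1 : ((2:ℝ) ^ (2 * h - 16)) ^ S ≠ 0 := by positivity
    have x2 : ((2:ℝ) ^ (8 * h - 2)) ^ S ≠ 0 := by positivity
    have x3 : (Real.exp 2 ^ M) ≠ 0 := by positivity
    have x4 := (Real.exp_pos (Real.exp 2 * (A * (2 * (8 * c : ℕ))) + 1)).ne'
    have x5 : (2 * Real.sqrt 5) ^ ((8 * c) * A) ≠ 0 := by positivity
    have x6 : (20 * Real.goldenRatio) ^ ((8 * c) * A) ≠ 0 := by positivity
    have x7 := hfpos.ne'
    generalize hf : ((K * q).factorial : ℝ) = f at *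
    rw [Real.log_mul x5 (mul_ne_zero (mul_ne_zero (mul_ne_zero (mul_ne_zero x7 (mul_ne_zero x1 x2)) (inv_ne_zero x3)) x4) (mul_ne_zero x7 (mul_ne_zero (mul_ne_zero x1 x2) x6))),
      Real.log_mul (mul_ne_zero (mul_ne_zero (mul_ne_zero x7 (mul_ne_zero x1 x2)) (inv_ne_zero x3)) x4) (mul_ne_zero x7 (mul_ne_zero (mul_ne_zero x1 x2) x6)),
      Real.log_mul (mul_ne_zero (mul_ne_zero x7 (mul_ne_zero x1 x2)) (inv_ne_zero x3)) x4,
      Real.log_mul (mul_ne_zero x7 (mul_ne_zero x1 x2)) (inv_ne_zero x3),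
      Real.log_mul x7 (mul_ne_zero x1 x2),
      Real.log_mul x7 (mul_ne_zero (mul_ne_zero x1 x2) x6), Real.log_mul (mul_ne_zero x1 x2) x6,
      Real.log_mul x1 x2, Real.log_inv, Real.log_exp, Real.log_pow, Real.log_pow, Real.log_pow, Real.log_pow,
      Real.log_pow, Real.log_pow, Real.log_pow, Real.log_exp]
    ring
  rw [el] at hlog
  have hNb : K * q ≤ c ^ 4 := by
    calc K * q ≤ 160 * c * (80 * c * c) := by
          rw [hq, ← hLdef]
          exact Nat.mul_le_mul (by omega) (Nat.mul_le_mul_left _ hLc1)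
      _ = c ^ 3 * 12800 := by ring
      _ ≤ c ^ 3 * c := Nat.mul_le_mul_left _ (by omega)
      _ = c ^ 4 := by ring
  have hNpos : 0 < K * q := Nat.mul_pos (by omega) (by rw [hq]; positivity)
  have hlN : Real.log (K * q : ℕ) ≤ 4 * c := by
    have h1 : Real.log (K * q : ℕ) ≤ Real.log ((c:ℝ) ^ 4) := by
      refine Real.log_le_log (by exact_mod_cast hNpos) ?_
      exact_mod_cast hNb
    rw [Real.log_pow] at h1
    have h2 := Real.log_le_sub_one_of_pos (by linarith : (0:ℝ) < c)
    have h4 : ((4:ℕ):ℝ) = 4 := by norm_num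
    rw [h4] at h1
    linarith
  have hlX : ((2 * h - 16 : ℕ) : ℝ) * Real.log 2 + ((8 * h - 2 : ℕ) : ℝ) * Real.log 2 ≤ 7 * h := by
    have l2' := Real.log_two_lt_d9
    have : (((2 * h - 16 : ℕ) : ℝ)) + ((8 * h - 2 : ℕ) : ℝ) ≤ 10 * h := by
      have : 2 * h - 16 + (8 * h - 2) ≤ 10 * h := by omega
      exact_mod_cast this
    rw [← add_mul]
    calc _ ≤ (10 * h : ℝ) * 0.7 := mul_le_mul this (by linarith) (Real.log_nonneg (by norm_num)) (by positivity)
      _ = 7 * h := by ring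
  have hA0 : (0:ℝ) ≤ 8 * c * A := by positivity
  refine Z11_num h hh K q L c A S M (K * q : ℕ) _ _ ?_ ?_ ?_ ?_ ?_ ?_ ?_ ?_ hlN hlX ?_
  · rw [hL]; push_cast; ring
  · rw [hcL]; push_cast; ring
  · exact_mod_cast hK
  · rw [hq, ← hLdef]; push_cast; ring
  · have : (A:ℝ) + 20 * c * K = 20 * c * K * L ^ 2 := by exact_mod_cast hA4
    linarith
  · exact_mod_cast hS2
  · have a1 : (M:ℝ) + (S + S) = K * ((q * (q - 1) / 2 : ℕ) : ℝ) := by exact_mod_cast hM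
    have a2 : (2:ℝ) * ((q * (q - 1) / 2 : ℕ) : ℝ) = q * (q - 1) := by
      have : (1:ℕ) ≤ q := Nat.pos_of_mul_pos_left hNpos
      have h3 : (2:ℝ) * ((q * (q - 1) / 2 : ℕ) : ℝ) = ((q * (q - 1) : ℕ) : ℝ) := by exact_mod_cast hq2
      rw [h3]; push_cast [this]; ring
    have a3 : ((q * (q - 1) / 2 : ℕ) : ℝ) = q * (q - 1) / 2 := by linarith
    rw [a3] at a1
    linarith
  · push_cast; ring
  · refine hlog.trans ?_
    have b1 : ((8 * c * A : ℕ) : ℝ) = 8 * c * A := by push_cast; ring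
    have b2 : ((8 * c : ℕ) : ℝ) = 8 * c := by push_cast; ring
    rw [b1, b2]
    have c1 := mul_le_mul_of_nonneg_left g4 hA0
    have c2 := mul_le_mul_of_nonneg_left g5 hA0
    have c3 := mul_le_mul_of_nonneg_right g6 (show (0:ℝ) ≤ A * (2 * (8 * c)) by positivity)
    linarith

end

section
open Finset Polynomial

theorem P5_final (n h : ℕ) (hh : 49 ≤ h) (hn1 : 2 ^ h ≤ n) (hn2 : n < 2 ^ (h + 1)) (k l : ℤ)
    (hk : k ≠ 0) (hkb : |k| ≤ 2 ^ (6 * h + 14)) (hlb : |l| ≤ 2 ^ (6 * h + 14))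
    (hΛ : |k * (n * Real.log Real.goldenRatio - Real.log (Real.sqrt 5)) - n * l * Real.log 2| ≤
      Real.exp (-(n / 5))) : False := by
  have hsq : Real.sqrt 5 ^ 2 = 5 := Real.sq_sqrt (by norm_num)
  have hmonic : (X ^ 2 - C (5:ℚ)).Monic := monic_X_pow_sub_C _ (by norm_num)
  have heval : aeval (Real.sqrt 5) (X ^ 2 - C (5:ℚ)) = 0 := by
    simp
  have hIntg : IsIntegral ℚ (Real.sqrt 5) := ⟨_, hmonic, heval⟩
  have hfr : Module.finrank ℚ (IntermediateField.adjoin ℚ {Real.sqrt 5}) ≤ 2 := by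
    rw [IntermediateField.adjoin.finrank hIntg]
    have h1 := natDegree_le_of_dvd (minpoly.dvd ℚ _ heval) hmonic.ne_zero
    rwa [natDegree_X_pow_sub_C] at h1
  haveI : FiniteDimensional ℚ (IntermediateField.adjoin ℚ {Real.sqrt 5}) :=
    IntermediateField.adjoin.finiteDimensional hIntg
  haveI : NumberField (IntermediateField.adjoin ℚ {Real.sqrt 5}) := { }
  let s5 : IntermediateField.adjoin ℚ {Real.sqrt 5} :=
    ⟨Real.sqrt 5, IntermediateField.mem_adjoin_simple_self ℚ _⟩
  have hs5 : s5 ^ 2 = 5 := by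
    apply Subtype.ext
    show Real.sqrt 5 ^ 2 = ((5 : IntermediateField.adjoin ℚ {Real.sqrt 5}) : ℝ)
    rw [hsq]; rfl
  refine P5_final0 hfr (algebraMap _ ℝ) ((1 + s5) / 2) s5 ?_ hs5 ?_ rfl n h hh hn1 hn2 k l hk hkb hlb hΛ
  · field_simp
    linear_combination hs5
  · rw [map_div₀, map_add, map_one, map_ofNat]
    rfl

end

section
open Finset

theorem E1_vieta (A B a0 a1 a2 : ℝ) (h01 : a0 < a1) (h12 : a1 < a2)
    (r0 : a0 * (a0 - A) * (a0 - B) = 1) (r1 : a1 * (a1 - A) * (a1 - B) = 1)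
    (r2 : a2 * (a2 - A) * (a2 - B) = 1) :
    a0 + a1 + a2 = A + B ∧ a0 * a1 + a0 * a2 + a1 * a2 = A * B ∧ a0 * a1 * a2 = 1 := by
  have e1 : a0 ^ 2 + a0 * a1 + a1 ^ 2 - (A + B) * (a0 + a1) + A * B = 0 := by
    have : (a1 - a0) * (a0 ^ 2 + a0 * a1 + a1 ^ 2 - (A + B) * (a0 + a1) + A * B) = 0 := by
      linear_combination r1 - r0
    rcases mul_eq_zero.1 this with h | h
    · linarith
    · exact h
  have e2 : a0 ^ 2 + a0 * a2 + a2 ^ 2 - (A + B) * (a0 + a2) + A * B = 0 := by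
    have : (a2 - a0) * (a0 ^ 2 + a0 * a2 + a2 ^ 2 - (A + B) * (a0 + a2) + A * B) = 0 := by
      linear_combination r2 - r0
    rcases mul_eq_zero.1 this with h | h
    · linarith
    · exact h
  have e3 : a0 + a1 + a2 = A + B := by
    have : (a2 - a1) * (a0 + a1 + a2 - (A + B)) = 0 := by
      linear_combination e2 - e1
    rcases mul_eq_zero.1 this with h | h
    · linarith
    · linarith
  have e4 : a0 * a1 + a0 * a2 + a1 * a2 = A * B := by
    linear_combination (a0 + a1) * e3 - e1
  refine ⟨e3, e4, ?_⟩
  linear_combination r0 + a0 * e4 - a0 ^ 2 * e3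

theorem E1_roots (A B a0 a1 a2 : ℝ) (hA : 100 ≤ A) (hAB : 100 * A ≤ B) (h01 : a0 < a1)
    (h12 : a1 < a2)
    (r0 : a0 * (a0 - A) * (a0 - B) = 1) (r1 : a1 * (a1 - A) * (a1 - B) = 1)
    (r2 : a2 * (a2 - A) * (a2 - B) = 1) :
    0 < a0 ∧ a0 ≤ 4 / (A * B) ∧ a1 < A ∧ A - a1 ≤ 4 / (A * B) ∧ B < a2 ∧ a2 - B ≤ 2 / B ^ 2 := by
  obtain ⟨v1, v2, v3⟩ := E1_vieta A B a0 a1 a2 h01 h12 r0 r1 r2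
  have hloc : ∀ t : ℝ, t * (t - A) * (t - B) = 1 → (0 < t ∧ t < A) ∨ B < t := by
    intro t ht
    by_contra hcon
    push Not at hcon
    obtain ⟨h1, h2⟩ := hcon
    rcases le_or_gt t 0 with h | h
    · have := mul_nonneg (mul_nonneg (neg_nonneg.2 h) (by linarith : 0 ≤ A - t)) (by linarith : 0 ≤ B - t)
      linarith
    · have h3 := h1 h
      have := mul_nonneg (mul_nonneg h.le (by linarith : 0 ≤ t - A)) (by linarith : 0 ≤ B - t)
      linarith
  have h2B : B < a2 := by
    rcases hloc a2 r2 with h | h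
    · linarith
    · exact h
  have h0 : 0 < a0 ∧ a0 < A := by
    rcases hloc a0 r0 with h | h
    · exact h
    · linarith
  have h1 : 0 < a1 ∧ a1 < A := by
    rcases hloc a1 r1 with h | h
    · exact h
    · linarith
  have hB0 : 0 < B := by linarith
  have hA0 : 0 < A := by linarith
  have hd2 : a2 - B ≤ 2 / B ^ 2 := by
    rw [le_div_iff₀ (by positivity)]
    have h3 : B ^ 2 ≤ 2 * (a2 * (a2 - A)) := by nlinarith
    have := mul_le_mul_of_nonneg_left h3 (by linarith : 0 ≤ a2 - B)
    linarith
  have hd2' : a2 - B ≤ 1 := by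
    refine hd2.trans ?_
    rw [div_le_one (by positivity)]
    nlinarith
  have h0A : a0 ≤ A / 2 := by linarith
  have h0' : a0 ≤ 4 / (A * B) := by
    rw [le_div_iff₀ (by positivity)]
    have h3 : A * B ≤ 4 * ((A - a0) * (B - a0)) := by
      have := mul_le_mul (by linarith : A ≤ 2 * (A - a0)) (by linarith : B ≤ 2 * (B - a0)) hB0.le (by linarith)
      linarith
    have := mul_le_mul_of_nonneg_left h3 h0.1.le
    linarith
  have h1A : A / 2 ≤ a1 + 1 := by linarith
  have h1' : A - a1 ≤ 4 / (A * B) := by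
    rw [le_div_iff₀ (by positivity)]
    have h3 : A * B ≤ 4 * (a1 * (B - a1)) := by
      have := mul_le_mul (by linarith : A * 2 ≤ 5 * a1) (by linarith : 5 * B ≤ 6 * (B - a1)) (by linarith) (by linarith)
      nlinarith
    have := mul_le_mul_of_nonneg_left h3 (by linarith : 0 ≤ A - a1)
    linarith
  exact ⟨h0.1, h0', h1.2, h1', h2B, hd2⟩

theorem E1_logaux (t r δ : ℝ) (hr : 0 < r) (hδ : δ ≤ 1 / 2) (h : |t - r| ≤ δ * r) :
    |Real.log t - Real.log r| ≤ 2 * δ := by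
  have h1 := abs_le.1 h
  have ht : 0 < t := by nlinarith
  have hδ0 : 0 ≤ δ := by
    by_contra hc
    push Not at hc
    have := mul_pos (neg_pos.2 hc) hr
    have := abs_nonneg (t - r)
    linarith
  rw [← Real.log_div ht.ne' hr.ne', abs_le]
  have hq : 0 < t / r := by positivity
  have hq1 : t / r ≤ 1 + δ := by rw [div_le_iff₀ hr]; linarith
  have hq2 : 1 - δ ≤ t / r := by rw [le_div_iff₀ hr]; linarith
  constructor
  · have := Real.one_sub_inv_le_log_of_pos hq
    have h2 : (t / r)⁻¹ ≤ 1 + 2 * δ := by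
      rw [inv_le_iff_one_le_mul₀ hq]
      nlinarith
    linarith
  · have := Real.log_le_sub_one_of_pos hq
    linarith

theorem E1_logs (A B a0 a1 a2 : ℝ) (hA : 100 ≤ A) (hAB : 100 * A ≤ B) (h01 : a0 < a1)
    (h12 : a1 < a2)
    (r0 : a0 * (a0 - A) * (a0 - B) = 1) (r1 : a1 * (a1 - A) * (a1 - B) = 1)
    (r2 : a2 * (a2 - A) * (a2 - B) = 1) :
    (|Real.log a0 + (Real.log A + Real.log B)| ≤ 8 * A / B ∧ |Real.log a1 - Real.log A| ≤ 8 * A / B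
      ∧ |Real.log a2 - Real.log B| ≤ 8 * A / B) ∧
    (|Real.log (a0 - A) - Real.log A| ≤ 8 * A / B ∧
      |Real.log (a1 - A) + (Real.log A + Real.log B)| ≤ 8 * A / B
      ∧ |Real.log (a2 - A) - Real.log B| ≤ 8 * A / B) ∧
    (|Real.log (a1 - a0) - Real.log A| ≤ 8 * A / B ∧
      |Real.log (a2 - a0) - Real.log B| ≤ 8 * A / B ∧
      |Real.log (a2 - a1) - Real.log B| ≤ 8 * A / B) := by
  obtain ⟨p0, p0', p1, p1', p2, p2'⟩ := E1_roots A B a0 a1 a2 hA hAB h01 h12 r0 r1 r2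
  have hB0 : 0 < B := by linarith
  have hA0 : 0 < A := by linarith
  set d := A / B with hd
  have hd0 : 0 < d := by positivity
  have hdB : d * B = A := by rw [hd]; field_simp
  have hd1 : d ≤ 1 / 100 := by rw [hd, div_le_iff₀ hB0]; linarith
  have hs1 : 4 / (A * B) ≤ d / 2 := by
    rw [hd, div_div, div_le_div_iff₀ (by positivity) (by positivity)]
    have : 100 * (100 * B) ≤ A * (A * B) :=
      mul_le_mul hA (mul_le_mul_of_nonneg_right hA hB0.le) (by positivity) hA0.le
    linarith
  have hs2 : 2 / B ^ 2 ≤ d / 2 := by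
    rw [hd, div_div, div_le_div_iff₀ (by positivity) (by positivity)]
    nlinarith
  have hdA : d ≤ d * A := by nlinarith
  have e8 : 8 * A / B = 8 * d := by rw [hd]; ring
  have f1 := E1_logaux a1 A d hA0 (by linarith) (abs_le.2 ⟨by linarith, by linarith⟩)
  have f2 := E1_logaux a2 B d hB0 (by linarith) (abs_le.2 ⟨by linarith, by linarith⟩)
  have g0 := E1_logaux (A - a0) A d hA0 (by linarith) (abs_le.2 ⟨by linarith, by linarith⟩)
  have g2 := E1_logaux (a2 - A) B d hB0 (by linarith) (abs_le.2 ⟨by linarith, by linarith⟩)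
  have k0 := E1_logaux (a1 - a0) A d hA0 (by linarith) (abs_le.2 ⟨by linarith, by linarith⟩)
  have k1 := E1_logaux (a2 - a0) B d hB0 (by linarith) (abs_le.2 ⟨by linarith, by linarith⟩)
  have k2 := E1_logaux (a2 - a1) B (2 * d) hB0 (by linarith) (abs_le.2 ⟨by linarith, by linarith⟩)
  have m0 := E1_logaux (B - a0) B d hB0 (by linarith) (abs_le.2 ⟨by linarith, by linarith⟩)
  have m1 := E1_logaux (B - a1) B d hB0 (by linarith) (abs_le.2 ⟨by linarith, by linarith⟩)
  have f0 : Real.log a0 = - Real.log (A - a0) - Real.log (B - a0) := by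
    have h3 : Real.log (a0 * (A - a0) * (B - a0)) = 0 := by
      rw [show a0 * (A - a0) * (B - a0) = 1 by linear_combination r0, Real.log_one]
    rw [Real.log_mul (by nlinarith) (by linarith), Real.log_mul (by linarith) (by linarith)] at h3
    linarith
  have g1 : Real.log (A - a1) = - Real.log a1 - Real.log (B - a1) := by
    have h3 : Real.log (a1 * (A - a1) * (B - a1)) = 0 := by
      rw [show a1 * (A - a1) * (B - a1) = 1 by linear_combination r1, Real.log_one]
    have : 0 < a1 := by linarith
    rw [Real.log_mul (by nlinarith) (by linarith), Real.log_mul (by linarith) (by linarith)] at h3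
    linarith
  have n0 : Real.log (a0 - A) = Real.log (A - a0) := by rw [← Real.log_neg_eq_log, neg_sub]
  have n1 : Real.log (a1 - A) = Real.log (A - a1) := by rw [← Real.log_neg_eq_log, neg_sub]
  rw [n0, n1, f0, g1, e8]
  rw [abs_le] at f1 f2 g0 g2 k0 k1 k2 m0 m1
  refine ⟨⟨?_, ?_, ?_⟩, ⟨?_, ?_, ?_⟩, ?_, ?_, ?_⟩ <;> rw [abs_le] <;> constructor <;> linarith

end

section
open Finset

theorem E2_pos (A B w p q r : ℤ) (hA : 100 ≤ A) (hAB : 100 * A ≤ B) (hw : 1 ≤ w) (hp : 1 ≤ p)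
    (hq : 1 ≤ q) (hr : 1 ≤ r) (hpq : A * w ≤ p + q) (hpr : B * w ≤ p + r)
    (hqr : (B - A) * w ≤ q + r) (h : p * q * r ≤ 2 * w ^ 3) : A * B ≤ 8 * w := by
  have hAw : 0 < A * w := by positivity
  have hB : 0 < B := by linarith
  have hBw : 0 < B * w := by positivity
  have hABw : 100 * (A * w) ≤ B * w := by
    have := mul_le_mul_of_nonneg_right hAB (by linarith : 0 ≤ w)
    linarith
  have hexp : (B - A) * w = B * w - A * w := by ring
  have hfin : A * w * (B * w) ≤ 4 * (p * q * r) → A * B ≤ 8 * w := by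
    intro h1
    have h2 : A * B * w ^ 2 ≤ 8 * w * w ^ 2 := by nlinarith
    exact le_of_mul_le_mul_right h2 (by positivity)
  by_cases c1 : 2 * p < A * w
  · apply hfin
    have h1 : A * w * (B * w) ≤ (2 * q) * (2 * r) :=
      mul_le_mul (by linarith) (by linarith) hBw.le (by linarith)
    have h2 : 1 * (q * r) ≤ p * (q * r) := mul_le_mul_of_nonneg_right hp (by positivity)
    linarith
  · push Not at c1
    by_cases c2 : 2 * q < A * w
    · apply hfin
      have h1 : A * w * (B * w) ≤ (2 * p) * (2 * r) :=
        mul_le_mul (by linarith) (by linarith) hBw.le (by linarith)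
      have h2 : 1 * (p * r) ≤ q * (p * r) := mul_le_mul_of_nonneg_right hq (by positivity)
      linarith
    · push Not at c2
      by_cases c3 : 2 * r < B * w
      · apply hfin
        have h1 : (B * w) * (2 * (A * w)) ≤ (2 * p) * (4 * q) :=
          mul_le_mul (by linarith) (by linarith) (by linarith) (by linarith)
        have h2 : 1 * (p * q) ≤ r * (p * q) := mul_le_mul_of_nonneg_right hr (by positivity)
        linarith
      · push Not at c3
        exfalso
        have h1 : (A * w) * (A * w) ≤ (2 * p) * (2 * q) :=
          mul_le_mul (by linarith) (by linarith) hAw.le (by linarith)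
        have h2 : (A * w) * (A * w) * (B * w) ≤ (2 * p) * (2 * q) * (2 * r) :=
          mul_le_mul h1 (by linarith) hBw.le (by positivity)
        have hw3 : 0 < w ^ 3 := by positivity
        have h3 : 100 * 100 * 100 ≤ A * A * B :=
          mul_le_mul (mul_le_mul hA hA (by norm_num) (by linarith)) (by linarith) (by norm_num) (by positivity)
        have h4 := mul_le_mul_of_nonneg_right h3 hw3.le
        have h5 : (A * w) * (A * w) * (B * w) = A * A * B * w ^ 3 := by ring
        linarith

theorem E2_thue (A B x y : ℤ) (hA : 100 ≤ A) (hAB : 100 * A ≤ B)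
    (h : x * (x - A * y) * (x - B * y) - y ^ 3 = 1 ∨ x * (x - A * y) * (x - B * y) - y ^ 3 = -1) :
    A * B ≤ 8 * |y| ∨ (y = 0 ∧ (x = 1 ∨ x = -1)) ∨
      ((y = 1 ∨ y = -1) ∧ (x = 0 ∨ x = A * y ∨ x = B * y)) := by
  have hcube : ∀ t : ℤ, t ^ 3 = 1 ∨ t ^ 3 = -1 → t = 1 ∨ t = -1 := by
    intro t ht
    have h1 : IsUnit (t ^ 3) := by
      rcases ht with h | h <;> rw [h] <;> decide
    exact Int.isUnit_iff.1 ((isUnit_pow_iff (by norm_num)).1 h1)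
  by_cases hy : y = 0
  · right; left
    refine ⟨hy, hcube x ?_⟩
    subst hy
    rcases h with h | h
    · left; linarith
    · right; linarith
  by_cases hz : x = 0 ∨ x = A * y ∨ x = B * y
  · right; right
    refine ⟨hcube y ?_, hz⟩
    have h0 : x * (x - A * y) * (x - B * y) = 0 := by
      rcases hz with h | h | h <;> rw [h] <;> ring
    rw [h0] at h
    rcases h with h | h
    · right; linarith
    · left; linarith
  · left
    push Not at hz
    obtain ⟨z1, z2, z3⟩ := hz
    have hw : 1 ≤ |y| := Int.one_le_abs hy
    refine E2_pos A B |y| |x| |x - A * y| |x - B * y| hA hAB hw (Int.one_le_abs z1)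
      (Int.one_le_abs (sub_ne_zero.2 z2)) (Int.one_le_abs (sub_ne_zero.2 z3)) ?_ ?_ ?_ ?_
    · have := abs_sub x (x - A * y)
      rw [sub_sub_cancel, abs_mul, abs_of_nonneg (by linarith : (0:ℤ) ≤ A)] at this
      exact this
    · have := abs_sub x (x - B * y)
      rw [sub_sub_cancel, abs_mul, abs_of_nonneg (by linarith : (0:ℤ) ≤ B)] at this
      exact this
    · have := abs_sub (x - A * y) (x - B * y)
      rw [show x - A * y - (x - B * y) = (B - A) * y by ring, abs_mul,
        abs_of_nonneg (by linarith : (0:ℤ) ≤ B - A)] at this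
      exact this
    · rw [← abs_mul, ← abs_mul]
      have h3 : |x * (x - A * y) * (x - B * y)| ≤ |y ^ 3| + 1 := by
        rcases h with h | h
        · rw [show x * (x - A * y) * (x - B * y) = y ^ 3 + 1 by linarith]
          exact (abs_add_le _ _).trans (by simp)
        · rw [show x * (x - A * y) * (x - B * y) = y ^ 3 + (-1) by linarith]
          exact (abs_add_le _ _).trans (by simp)
      rw [abs_pow] at h3
      have : 1 ≤ |y| ^ 3 := one_le_pow₀ hw
      linarith

end

section
open Finset

/-- A triple of conjugates of an element of the order generated by a root. -/
def E3Rep (α w : Fin 3 → ℝ) : Prop :=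
  ∃ c0 c1 c2 : ℤ, ∀ i, w i = c0 + c1 * α i + c2 * α i ^ 2

theorem E3_mul (A B : ℤ) (α w : Fin 3 → ℝ) (hroot : ∀ i, α i * (α i - A) * (α i - B) = 1)
    (m : ℤ) (h : E3Rep α w) : E3Rep α (fun i => (α i - m) * w i) := by
  obtain ⟨c0, c1, c2, h⟩ := h
  refine ⟨-m * c0 + c2, c0 - m * c1 - A * B * c2, c1 - m * c2 + (A + B) * c2, fun i => ?_⟩
  push_cast
  rw [h i]
  linear_combination (c2 : ℝ) * hroot i

theorem E3_ne (A B : ℤ) (α : Fin 3 → ℝ) (hroot : ∀ i, α i * (α i - A) * (α i - B) = 1) (i : Fin 3) :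
    α i ≠ 0 ∧ α i - A ≠ 0 ∧ α i - B ≠ 0 := by
  refine ⟨?_, ?_, ?_⟩ <;> intro h <;> have h1 := hroot i <;> rw [h] at h1 <;> norm_num at h1

theorem E3_rep1 (A B : ℤ) (α : Fin 3 → ℝ) (hroot : ∀ i, α i * (α i - A) * (α i - B) = 1)
    (a : ℤ) (w : Fin 3 → ℝ) (h : E3Rep α w) : E3Rep α (fun i => α i ^ a * w i) := by
  induction a using Int.induction_on with
  | zero => simpa using h
  | succ k ih =>
    have := E3_mul A B α _ hroot 0 ih
    convert this using 2 with i
    rw [zpow_add_one₀ (E3_ne A B α hroot i).1]; push_cast; ring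
  | pred k ih =>
    have := E3_mul A B α _ hroot A (E3_mul A B α _ hroot B ih)
    convert this using 2 with i
    have h0 := (E3_ne A B α hroot i).1
    rw [zpow_sub_one₀ h0]
    have h1 : (α i)⁻¹ = (α i - A) * (α i - B) := by
      rw [inv_eq_iff_eq_inv, eq_comm, inv_eq_iff_eq_inv, eq_comm]
      exact inv_eq_of_mul_eq_one_right (by linarith [hroot i])
    rw [h1]; ring

theorem E3_rep2 (A B : ℤ) (α : Fin 3 → ℝ) (hroot : ∀ i, α i * (α i - A) * (α i - B) = 1)
    (a : ℤ) (w : Fin 3 → ℝ) (h : E3Rep α w) : E3Rep α (fun i => (α i - A) ^ a * w i) := by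
  induction a using Int.induction_on with
  | zero => simpa using h
  | succ k ih =>
    have := E3_mul A B α _ hroot A ih
    convert this using 2 with i
    rw [zpow_add_one₀ (E3_ne A B α hroot i).2.1]; ring
  | pred k ih =>
    have := E3_mul A B α _ hroot 0 (E3_mul A B α _ hroot B ih)
    convert this using 2 with i
    have h0 := (E3_ne A B α hroot i).2.1
    rw [zpow_sub_one₀ h0]
    have h1 : (α i - A)⁻¹ = α i * (α i - B) :=
      inv_eq_of_mul_eq_one_right (by linarith [hroot i])
    rw [h1]; push_cast; ring

theorem E3_small (A B : ℤ) (hA : 100 ≤ A) (hAB : 100 * A ≤ B) (α w : Fin 3 → ℝ)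
    (hord : α 0 < α 1 ∧ α 1 < α 2) (hroot : ∀ i, α i * (α i - A) * (α i - B) = 1)
    (h : E3Rep α w) (hw0 : |w 0| ≤ 2 * A * Real.sqrt B) (hw1 : |w 1| ≤ 2 * A * Real.sqrt B)
    (hw2 : |w 2| ≤ 2 * B) (hprod : w 0 * w 1 * w 2 = 1 ∨ w 0 * w 1 * w 2 = -1) :
    ∃ e : ℤ, (e = 1 ∨ e = -1) ∧ ∃ a b : ℤ, ∀ i, w i = e * α i ^ a * (α i - A) ^ b := by
  obtain ⟨c0, c1, c2, h⟩ := h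
  have hA' : (100:ℝ) ≤ A := by exact_mod_cast hA
  have hAB' : (100:ℝ) * A ≤ B := by exact_mod_cast hAB
  obtain ⟨v1, v2, v3⟩ := E1_vieta A B _ _ _ hord.1 hord.2 (hroot 0) (hroot 1) (hroot 2)
  obtain ⟨p0, p0', p1, p1', p2, p2'⟩ := E1_roots A B _ _ _ hA' hAB' hord.1 hord.2 (hroot 0) (hroot 1) (hroot 2)
  have hB' : (10000:ℝ) ≤ B := by linarith
  set s := Real.sqrt B with hs
  have hs2 : s * s = B := Real.mul_self_sqrt (by linarith)
  have hs100 : 100 ≤ s := by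
    rw [hs]; exact Real.le_sqrt_of_sq_le (by linarith)
  have q1 : (4:ℝ) / (A * B) ≤ 1 := by
    rw [div_le_one (by positivity)]
    have := mul_le_mul hA' hB' (by norm_num) (by linarith)
    linarith
  have q2 : (2:ℝ) / B ^ 2 ≤ 1 := by
    rw [div_le_one (by positivity)]
    have := mul_le_mul hB' hB' (by norm_num) (by linarith)
    rw [sq]; linarith
  have d01 : (A:ℝ) / 2 ≤ α 1 - α 0 := by linarith
  have d01' : α 1 - α 0 ≤ A := by linarith
  have d02 : (B:ℝ) / 2 ≤ α 2 - α 0 := by linarith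
  have d02' : α 2 - α 0 ≤ 2 * B := by linarith
  have d12 : (B:ℝ) / 2 ≤ α 2 - α 1 := by linarith
  have d12' : α 2 - α 1 ≤ 2 * B := by linarith
  have hc2 : c2 = 0 := by
    by_contra hne
    have h1 : (1:ℝ) ≤ |(c2:ℝ)| := by exact_mod_cast Int.one_le_abs hne
    have id1 : (c2:ℝ) * ((α 1 - α 0) * ((α 2 - α 0) * (α 2 - α 1))) =
        w 0 * (α 2 - α 1) - w 1 * (α 2 - α 0) + w 2 * (α 1 - α 0) := by
      rw [h 0, h 1, h 2]; ring
    have l1 : (A:ℝ) / 2 * ((B:ℝ) / 2 * ((B:ℝ) / 2)) ≤ (α 1 - α 0) * ((α 2 - α 0) * (α 2 - α 1)) := by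
      apply mul_le_mul d01 _ (by positivity) (by linarith)
      exact mul_le_mul d02 d12 (by positivity) (by linarith)
    have l2 : (A:ℝ) / 2 * ((B:ℝ) / 2 * ((B:ℝ) / 2)) ≤
        |(c2:ℝ) * ((α 1 - α 0) * ((α 2 - α 0) * (α 2 - α 1)))| := by
      rw [abs_mul, abs_of_nonneg (a := (α 1 - α 0) * ((α 2 - α 0) * (α 2 - α 1)))
        (le_trans (by positivity) l1)]
      refine l1.trans ?_
      exact le_mul_of_one_le_left (le_trans (by positivity) l1) h1
    have l3 : |w 0 * (α 2 - α 1) - w 1 * (α 2 - α 0) + w 2 * (α 1 - α 0)| ≤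
        2 * A * s * (2 * B) + 2 * A * s * (2 * B) + 2 * B * A := by
      refine (abs_add_le _ _).trans (add_le_add ((abs_sub _ _).trans (add_le_add ?_ ?_)) ?_)
      · rw [abs_mul, abs_of_nonneg (by linarith : 0 ≤ α 2 - α 1)]
        exact mul_le_mul hw0 d12' (by linarith) (by positivity)
      · rw [abs_mul, abs_of_nonneg (by linarith : 0 ≤ α 2 - α 0)]
        exact mul_le_mul hw1 d02' (by linarith) (by positivity)
      · rw [abs_mul, abs_of_nonneg (by linarith : 0 ≤ α 1 - α 0)]
        exact mul_le_mul hw2 d01' (by linarith) (by positivity)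
    rw [id1] at l2
    have l4 := l2.trans l3
    have hABp : (0:ℝ) < A * B := by positivity
    have l5 : (A * B : ℝ) * (s * s) ≤ (A * B) * (64 * s + 16) := by
      rw [hs2]; linarith
    have l6 := le_of_mul_le_mul_left l5 hABp
    have l7 := mul_le_mul_of_nonneg_right hs100 (by linarith : 0 ≤ s)
    linarith
  have hw : ∀ i, w i = c0 - α i * ((-c1 : ℤ) : ℝ) := by
    intro i
    rw [h i, hc2]; push_cast; ring
  have hc1 : |(c1:ℝ)| ≤ 8 * s := by
    have id1 : (c1:ℝ) * (α 1 - α 0) = w 1 - w 0 := by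
      rw [hw 1, hw 0]; push_cast; ring
    have l1 : |(c1:ℝ)| * (α 1 - α 0) ≤ 4 * A * s := by
      have := abs_sub (w 1) (w 0)
      rw [← id1, abs_mul, abs_of_nonneg (by linarith : 0 ≤ α 1 - α 0)] at this
      linarith
    have l2 := mul_le_mul_of_nonneg_left d01 (abs_nonneg (c1:ℝ))
    have l3 : (A:ℝ) * |(c1:ℝ)| ≤ A * (8 * s) := by linarith
    exact le_of_mul_le_mul_left l3 (by linarith)
  have hthue : c0 * (c0 - A * (-c1)) * (c0 - B * (-c1)) - (-c1) ^ 3 = 1 ∨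
      c0 * (c0 - A * (-c1)) * (c0 - B * (-c1)) - (-c1) ^ 3 = -1 := by
    have id1 : w 0 * w 1 * w 2 = ((c0 * (c0 - A * (-c1)) * (c0 - B * (-c1)) - (-c1) ^ 3 : ℤ) : ℝ) := by
      rw [hw 0, hw 1, hw 2]; push_cast
      linear_combination (c0:ℝ) ^ 2 * c1 * v1 + (c0:ℝ) * c1 ^ 2 * v2 + (c1:ℝ) ^ 3 * v3
    rw [id1] at hprod
    exact_mod_cast hprod
  rcases E2_thue A B c0 (-c1) hA hAB hthue with h1 | ⟨h1, h2⟩ | ⟨h1, h2⟩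
  · exfalso
    rw [abs_neg] at h1
    have h2 : (A:ℝ) * B ≤ 8 * |(c1:ℝ)| := by exact_mod_cast h1
    rw [← hs2] at h2
    have h3 : (A * s) * s ≤ 64 * s := by linarith
    have h4 := le_of_mul_le_mul_right h3 (by linarith)
    have := mul_le_mul hA' hs100 (by norm_num) (by linarith)
    linarith
  · refine ⟨c0, h2, 0, 0, fun i => ?_⟩
    rw [hw i, h1]; simp
  · refine ⟨c1, by omega, ?_⟩
    rcases h2 with h2 | h2 | h2
    · refine ⟨1, 0, fun i => ?_⟩
      rw [hw i, h2]; push_cast; simp; ring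
    · refine ⟨0, 1, fun i => ?_⟩
      rw [hw i, h2]; push_cast; simp; ring
    · refine ⟨-1, -1, fun i => ?_⟩
      rw [hw i, h2]
      have h3 := E3_ne A B α hroot i
      have h4 : α i - B = (α i)⁻¹ * (α i - A)⁻¹ := by
        rw [← mul_inv]
        exact (inv_eq_of_mul_eq_one_right (hroot i)).symm
      rw [zpow_neg_one, zpow_neg_one, mul_assoc, ← h4]
      push_cast; ring

end

section
open Finset

theorem E3_norm (A B : ℤ) (α : Fin 3 → ℝ)
    (hord : α 0 < α 1 ∧ α 1 < α 2) (hroot : ∀ i, α i * (α i - A) * (α i - B) = 1) (x y : ℤ) :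
    ((x:ℝ) - α 0 * y) * (x - α 1 * y) * (x - α 2 * y) =
      ((x * (x - A * y) * (x - B * y) - y ^ 3 : ℤ) : ℝ) := by
  obtain ⟨v1, v2, v3⟩ := E1_vieta A B _ _ _ hord.1 hord.2 (hroot 0) (hroot 1) (hroot 2)
  push_cast
  linear_combination -(x:ℝ) ^ 2 * y * v1 + (x:ℝ) * y ^ 2 * v2 - (y:ℝ) ^ 3 * v3

theorem E3_unit (A B : ℤ) (hA : 100 ≤ A) (hAB : 100 * A ≤ B) (α : Fin 3 → ℝ)
    (hord : α 0 < α 1 ∧ α 1 < α 2) (hroot : ∀ i, α i * (α i - A) * (α i - B) = 1) (x y : ℤ)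
    (h : x * (x - A * y) * (x - B * y) - y ^ 3 = 1 ∨ x * (x - A * y) * (x - B * y) - y ^ 3 = -1) :
    ∃ e : ℤ, (e = 1 ∨ e = -1) ∧ ∃ a b : ℤ, ∀ i, (x:ℝ) - α i * y = e * α i ^ a * (α i - A) ^ b := by
  have hA' : (100:ℝ) ≤ A := by exact_mod_cast hA
  have hAB' : (100:ℝ) * A ≤ B := by exact_mod_cast hAB
  obtain ⟨v1, v2, v3⟩ := E1_vieta A B _ _ _ hord.1 hord.2 (hroot 0) (hroot 1) (hroot 2)
  obtain ⟨⟨l0, l1, l2⟩, ⟨m0, m1, m2⟩, -⟩ :=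
    E1_logs A B _ _ _ hA' hAB' hord.1 hord.2 (hroot 0) (hroot 1) (hroot 2)
  have hne := E3_ne A B α hroot
  have hB0 : (0:ℝ) < B := by linarith
  have heps : 8 * (A:ℝ) / B ≤ 8 / 100 := by
    rw [div_le_iff₀ hB0]; linarith
  have hN := E3_norm A B α hord hroot x y
  have hpm : ((x:ℝ) - α 0 * y) * (x - α 1 * y) * (x - α 2 * y) = 1 ∨
      ((x:ℝ) - α 0 * y) * (x - α 1 * y) * (x - α 2 * y) = -1 := by
    rw [hN]; exact_mod_cast h
  set u := Real.log (A:ℝ) with hu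
  set v := Real.log (B:ℝ) with hv
  have hu0 : 1 ≤ u := by
    rw [hu, Real.le_log_iff_exp_le (by linarith)]
    linarith [Real.exp_one_lt_d9]
  have hv0 : 1 ≤ v := by
    rw [hv, Real.le_log_iff_exp_le (by linarith)]
    linarith [Real.exp_one_lt_d9]
  have hβ : ∀ i, (x:ℝ) - α i * y ≠ 0 := by
    intro i hi
    fin_cases i <;> simp only [Fin.zero_eta, Fin.mk_one, Fin.reduceFinMk] at hi <;>
      rw [hi] at hpm <;> norm_num at hpm
  rw [abs_le] at l0 l1 l2 m0 m1 m2
  have hD : 0 < Real.log (α 0) * Real.log (α 1 - A) - Real.log (α 0 - A) * Real.log (α 1) := by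
    have h1 : (u + v - 8 / 100) * (u + v - 8 / 100) ≤ (- Real.log (α 0)) * (- Real.log (α 1 - A)) :=
      mul_le_mul (by linarith) (by linarith) (by linarith) (by linarith)
    have h2 : Real.log (α 0 - A) * Real.log (α 1) ≤ (u + 8 / 100) * (u + 8 / 100) :=
      mul_le_mul (by linarith) (by linarith) (by linarith) (by linarith)
    nlinarith
  set D := Real.log (α 0) * Real.log (α 1 - A) - Real.log (α 0 - A) * Real.log (α 1) with hDdef
  set ℓ : Fin 3 → ℝ := fun i => Real.log ((x:ℝ) - α i * y) with hℓ
  set s := (ℓ 0 * Real.log (α 1 - A) - ℓ 1 * Real.log (α 0 - A)) / D with hs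
  set t := (ℓ 1 * Real.log (α 0) - ℓ 0 * Real.log (α 1)) / D with ht
  have e0 : Real.log (α 0) * s + Real.log (α 0 - A) * t = ℓ 0 := by
    rw [hs, ht]; field_simp; rw [hDdef]; ring
  have e1 : Real.log (α 1) * s + Real.log (α 1 - A) * t = ℓ 1 := by
    rw [hs, ht]; field_simp; rw [hDdef]; ring
  have sP : Real.log (α 0) + Real.log (α 1) + Real.log (α 2) = 0 := by
    rw [← Real.log_mul (hne 0).1 (hne 1).1, ← Real.log_mul (mul_ne_zero (hne 0).1 (hne 1).1) (hne 2).1,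
      v3, Real.log_one]
  have vQ : (α 0 - A) * (α 1 - A) * (α 2 - A) = 1 := by
    linear_combination (A:ℝ) ^ 2 * v1 - (A:ℝ) * v2 + v3
  have sQ : Real.log (α 0 - A) + Real.log (α 1 - A) + Real.log (α 2 - A) = 0 := by
    rw [← Real.log_mul (hne 0).2.1 (hne 1).2.1,
      ← Real.log_mul (mul_ne_zero (hne 0).2.1 (hne 1).2.1) (hne 2).2.1, vQ, Real.log_one]
  have sL : ℓ 0 + ℓ 1 + ℓ 2 = 0 := by
    rw [hℓ]
    simp only
    rw [← Real.log_mul (hβ 0) (hβ 1), ← Real.log_mul (mul_ne_zero (hβ 0) (hβ 1)) (hβ 2)]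
    rcases hpm with h | h <;> rw [h] <;> simp
  have e2 : Real.log (α 2) * s + Real.log (α 2 - A) * t = ℓ 2 := by
    linear_combination s * sP + t * sQ - sL - e0 - e1
  set a := round s with ha
  set b := round t with hb
  have ra := abs_sub_round s
  have rb := abs_sub_round t
  rw [← ha] at ra
  rw [← hb] at rb
  set w : Fin 3 → ℝ := fun i => α i ^ (-a) * ((α i - A) ^ (-b) * ((x:ℝ) - α i * y)) with hw
  have hrep : E3Rep α w := by
    refine E3_rep1 A B α hroot (-a) _ (E3_rep2 A B α hroot (-b) _ ?_)
    exact ⟨x, -y, 0, fun i => by push_cast; ring⟩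
  have hlogw : ∀ i, Real.log (w i) = ℓ i - a * Real.log (α i) - b * Real.log (α i - A) := by
    intro i
    rw [hw]
    simp only
    rw [Real.log_mul (zpow_ne_zero _ (hne i).1) (mul_ne_zero (zpow_ne_zero _ (hne i).2.1) (hβ i)),
      Real.log_mul (zpow_ne_zero _ (hne i).2.1) (hβ i), Real.log_zpow, Real.log_zpow, hℓ]
    push_cast; ring
  have hw0 : ∀ i, w i ≠ 0 := fun i =>
    mul_ne_zero (zpow_ne_zero _ (hne i).1) (mul_ne_zero (zpow_ne_zero _ (hne i).2.1) (hβ i))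
  have habs : ∀ (i : Fin 3) (M : ℝ), 0 < M → Real.log (w i) ≤ Real.log M → |w i| ≤ M := by
    intro i M hM hle
    rw [← Real.log_abs] at hle
    exact (Real.log_le_log_iff (abs_pos.2 (hw0 i)) hM).1 hle
  have hbd : ∀ (P Q M N : ℝ), |P| ≤ M → |Q| ≤ N → P * (s - a) + Q * (t - b) ≤ (M + N) / 2 := by
    intro P Q M N hP hQ
    have h1 : |P * (s - a)| ≤ M * (1 / 2) := by
      rw [abs_mul]; exact mul_le_mul hP ra (abs_nonneg _) ((abs_nonneg P).trans hP)
    have h2 : |Q * (t - b)| ≤ N * (1 / 2) := by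
      rw [abs_mul]; exact mul_le_mul hQ rb (abs_nonneg _) ((abs_nonneg Q).trans hQ)
    have h3 := le_abs_self (P * (s - a))
    have h4 := le_abs_self (Q * (t - b))
    linarith
  have l2' := Real.log_two_gt_d9
  have hlogM : Real.log (2 * A * Real.sqrt B) = Real.log 2 + u + v / 2 := by
    rw [Real.log_mul (by positivity) (by positivity), Real.log_mul (by norm_num) (by positivity),
      Real.log_sqrt hB0.le]
  have hlogB : Real.log (2 * B) = Real.log 2 + v := by
    rw [Real.log_mul (by norm_num) (by positivity)]
  have b0 : |w 0| ≤ 2 * A * Real.sqrt B := by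
    apply habs 0 _ (by positivity)
    rw [hlogM, hlogw]
    have := hbd (Real.log (α 0)) (Real.log (α 0 - A)) (u + v + 8 / 100) (u + 8 / 100)
      (abs_le.2 ⟨by linarith, by linarith⟩) (abs_le.2 ⟨by linarith, by linarith⟩)
    rw [← e0]
    linarith
  have b1 : |w 1| ≤ 2 * A * Real.sqrt B := by
    apply habs 1 _ (by positivity)
    rw [hlogM, hlogw]
    have := hbd (Real.log (α 1)) (Real.log (α 1 - A)) (u + 8 / 100) (u + v + 8 / 100)
      (abs_le.2 ⟨by linarith, by linarith⟩) (abs_le.2 ⟨by linarith, by linarith⟩)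
    rw [← e1]
    linarith
  have b2 : |w 2| ≤ 2 * B := by
    apply habs 2 _ (by positivity)
    rw [hlogB, hlogw]
    have := hbd (Real.log (α 2)) (Real.log (α 2 - A)) (v + 8 / 100) (v + 8 / 100)
      (abs_le.2 ⟨by linarith, by linarith⟩) (abs_le.2 ⟨by linarith, by linarith⟩)
    rw [← e2]
    linarith
  have hprod : w 0 * w 1 * w 2 = 1 ∨ w 0 * w 1 * w 2 = -1 := by
    have : w 0 * w 1 * w 2 = (α 0 * α 1 * α 2) ^ (-a) * ((α 0 - A) * (α 1 - A) * (α 2 - A)) ^ (-b) *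
        (((x:ℝ) - α 0 * y) * (x - α 1 * y) * (x - α 2 * y)) := by
      rw [hw]
      simp only [mul_zpow]
      ring
    rw [this, v3, vQ, one_zpow, one_zpow, one_mul, one_mul]
    exact hpm
  obtain ⟨e, he, a', b', hfin⟩ := E3_small A B hA hAB α w hord hroot hrep b0 b1 b2 hprod
  refine ⟨e, he, a + a', b + b', fun i => ?_⟩
  have h1 := hfin i
  rw [hw] at h1
  simp only [zpow_neg] at h1
  rw [zpow_add₀ (hne i).1, zpow_add₀ (hne i).2.1]
  have h2 : α i ^ a ≠ 0 := zpow_ne_zero _ (hne i).1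
  have h3 : (α i - A) ^ b ≠ 0 := zpow_ne_zero _ (hne i).2.1
  field_simp at h1
  rw [h1]; ring

end

section
open Finset Polynomial

/-- Symmetric data on the root triple. -/
structure E4Data (n : ℕ) (A B : ℤ) (r : Fin 3 → ℝ) : Prop where
  hA : 100 ≤ A
  hAB : 100 * A ≤ B
  hn : 1 ≤ n
  root : ∀ i, r i * (r i - A) * (r i - B) = 1
  inj : Function.Injective r
  fac : ∀ z : ℂ, z * (z - A) * (z - B) = 1 → ∃ m, z = (r m : ℂ)
  sum : ∑ i, r i = A + B
  sP : ∑ i, Real.log (r i) = 0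
  sQ : ∑ i, Real.log (r i - A) = 0
  bP : ∀ i, |Real.log (r i)| ≤ 2 * n
  bQ : ∀ i, |Real.log (r i - A)| ≤ 2 * n
  d1 : ∀ i j, i ≠ j → 1 ≤ |r i - r j|
  d2 : ∀ i j, |r i - r j| ≤ Real.exp (4 * n)
  ind : ∀ i m : ℤ, (∀ k, i * Real.log (r k) + m * Real.log (r k - A) = 0) → i = 0 ∧ m = 0

theorem E4Data.perm {n : ℕ} {A B : ℤ} {r : Fin 3 → ℝ} (h : E4Data n A B r) (π : Equiv.Perm (Fin 3)) :
    E4Data n A B (fun i => r (π i)) where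
  hA := h.hA
  hAB := h.hAB
  hn := h.hn
  root := fun i => h.root _
  inj := h.inj.comp π.injective
  fac := fun z hz => by
    obtain ⟨m, hm⟩ := h.fac z hz
    exact ⟨π.symm m, by rw [hm, Equiv.apply_symm_apply]⟩
  sum := by rw [← h.sum]; exact Equiv.sum_comp π r
  sP := by rw [← h.sP]; exact Equiv.sum_comp π (fun i => Real.log (r i))
  sQ := by rw [← h.sQ]; exact Equiv.sum_comp π (fun i => Real.log (r i - A))
  bP := fun i => h.bP _
  bQ := fun i => h.bQ _
  d1 := fun i j hij => h.d1 _ _ (fun hc => hij (π.injective hc))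
  d2 := fun i j => h.d2 _ _
  ind := fun i m hk => h.ind i m (fun k => by
    have := hk (π.symm k)
    simpa only [Equiv.apply_symm_apply] using this)

theorem E4_notrat (A B : ℤ) (hA : 100 ≤ A) (z : ℝ)
    (hz : z * (z - A) * (z - B) = 1) (c d : ℤ) (hc : c ≠ 0) (h : (c:ℝ) * z = d) : False := by
  set p : ℤ[X] := X * (X - C A) * (X - C B) - 1 with hp
  have hm : p.Monic := by rw [hp]; monicity!
  have hc' : (c:ℝ) ≠ 0 := by exact_mod_cast hc
  have hcq : (c:ℚ) ≠ 0 := by exact_mod_cast hc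
  have hzq : z = (((d:ℚ) / c : ℚ) : ℝ) := by push_cast; field_simp; linarith
  have hr : aeval ((d:ℚ) / c) p = 0 := by
    rw [hp]
    simp only [map_sub, map_mul, aeval_X, map_one, eq_intCast, map_intCast]
    rw [hzq] at hz
    have : ((d:ℚ) / c) * ((d:ℚ) / c - A) * ((d:ℚ) / c - B) = 1 := by exact_mod_cast hz
    linarith
  obtain ⟨m, hm2⟩ := isInteger_of_is_root_of_monic hm hr
  have hzm : z = m := by rw [hzq, ← hm2]; simp
  rw [hzm] at hz
  have hzi : m * ((m - A) * (m - B)) = 1 := by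
    have : (m * (m - A) * (m - B)) = (1:ℤ) := by exact_mod_cast hz
    linarith
  have hzi2 : (m - A) * (m * (m - B)) = 1 := by linarith
  have h1 := Int.isUnit_iff.1 (IsUnit.of_mul_eq_one _ hzi)
  have h2 := Int.isUnit_iff.1 (IsUnit.of_mul_eq_one _ hzi2)
  omega

theorem E4_indep {n : ℕ} {A B : ℤ} {r : Fin 3 → ℝ} (h : E4Data n A B r) (i m : ℤ)
    (he : (r 1 / r 2) ^ (2 * i) * ((r 1 - A) / (r 2 - A)) ^ (2 * m) = 1) : i = 0 ∧ m = 0 := by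
  have hne := E3_ne A B r h.root
  have hrep : E3Rep r (fun k => r k ^ (2 * i) * ((r k - A) ^ (2 * m) * 1)) :=
    E3_rep1 A B r h.root _ _ (E3_rep2 A B r h.root _ _ ⟨1, 0, 0, fun k => by simp⟩)
  obtain ⟨c0, c1, c2, hc⟩ := hrep
  simp only [mul_one] at hc
  have h12 : r 1 ^ (2 * i) * (r 1 - A) ^ (2 * m) = r 2 ^ (2 * i) * (r 2 - A) ^ (2 * m) := by
    rw [div_zpow, div_zpow] at he
    have h1 : r 2 ^ (2 * i) ≠ 0 := zpow_ne_zero _ (hne 2).1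
    have h2 : (r 2 - A) ^ (2 * m) ≠ 0 := zpow_ne_zero _ (hne 2).2.1
    field_simp at he
    exact he
  rw [hc 1, hc 2] at h12
  have hsum := h.sum
  rw [Fin.sum_univ_three] at hsum
  have h3 : (c1:ℝ) + c2 * (A + B - r 0) = 0 := by
    have : (r 1 - r 2) * ((c1:ℝ) + c2 * (A + B - r 0)) = 0 := by
      rw [← hsum]; linear_combination h12
    rcases mul_eq_zero.1 this with h4 | h4
    · exact absurd (h.inj (sub_eq_zero.1 h4)) (by decide)
    · exact h4
  have hc2 : c2 = 0 := by
    by_contra hne2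
    refine E4_notrat A B h.hA (r 0) (h.root 0) c2 (c1 + c2 * (A + B)) hne2 ?_
    push_cast; linear_combination -h3
  have hc1 : c1 = 0 := by
    rw [hc2] at h3
    simpa using h3
  have hlog : ∀ k, 2 * (i * Real.log (r k) + m * Real.log (r k - A)) = Real.log c0 := by
    intro k
    have h5 := hc k
    rw [hc1, hc2] at h5
    simp only [Int.cast_zero, zero_mul, add_zero] at h5
    rw [← h5, Real.log_mul (zpow_ne_zero _ (hne k).1) (zpow_ne_zero _ (hne k).2.1),
      Real.log_zpow, Real.log_zpow]
    push_cast; ring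
  have h0 : Real.log c0 = 0 := by
    have sP := h.sP
    have sQ := h.sQ
    rw [Fin.sum_univ_three] at sP sQ
    have := hlog 0
    have := hlog 1
    have := hlog 2
    have : 3 * Real.log c0 = 0 := by
      linear_combination -hlog 0 - hlog 1 - hlog 2 + 2 * i * sP + 2 * m * sQ
    linarith
  refine h.ind i m (fun k => ?_)
  have := hlog k
  rw [h0] at this
  linarith

end

section
open Finset Polynomial

theorem E5_field {n : ℕ} {A B : ℤ} {r : Fin 3 → ℝ} (h : E4Data n A B r) (a b : ℤ) (X t0 : ℕ)
    (haX : |a| ≤ X) (hbX : |b| ≤ X) (hab : |a| = X ∨ |b| = X)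
    (ht : ∀ t ≥ t0, 20000000000 * (8 * n) * (t + 1) ^ 2 ≤ 2 ^ t)
    (hΛ : |Real.log ((r 2 - r 0) ^ 2 / (r 1 - r 0) ^ 2) + a * Real.log ((r 1 / r 2) ^ 2) +
      b * Real.log (((r 1 - A) / (r 2 - A)) ^ 2)| ≤ Real.exp (-((X:ℝ) * (8 * n : ℕ) / 32))) :
    X < 2 ^ (3 * t0) := by
  have hne := E3_ne A B r h.root
  set p : ℤ[X] := Polynomial.X * (Polynomial.X - C A) * (Polynomial.X - C B) - 1 with hp
  have hm : p.Monic := by rw [hp]; monicity!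
  have hIntgR : ∀ i, IsIntegral ℤ (r i) := by
    intro i
    refine ⟨p, hm, ?_⟩
    rw [← aeval_def, hp]
    simp only [map_sub, map_mul, aeval_X, map_one, eq_intCast, map_intCast]
    rw [h.root i, sub_self]
  have hfd : FiniteDimensional ℚ (IntermediateField.adjoin ℚ (Set.range r)) := by
    apply IntermediateField.finiteDimensional_adjoin
    rintro x ⟨i, rfl⟩
    exact (hIntgR i).tower_top
  have hnf : NumberField (IntermediateField.adjoin ℚ (Set.range r)) := { }
  set F := IntermediateField.adjoin ℚ (Set.range r) with hF
  let θ : Fin 3 → F := fun i => ⟨r i, IntermediateField.subset_adjoin ℚ _ ⟨i, rfl⟩⟩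
  let σ0 : F →+* ℝ := algebraMap F ℝ
  have hσ0 : ∀ i, σ0 (θ i) = r i := fun i => rfl
  have hσinj : Function.Injective σ0 := σ0.injective
  have hroot : ∀ i, θ i * (θ i - A) * (θ i - B) = 1 := by
    intro i
    apply hσinj
    rw [map_mul, map_mul, map_sub, map_sub, hσ0, map_intCast, map_intCast, map_one]
    exact h.root i
  have hθinj : Function.Injective θ := by
    intro i j hij
    apply h.inj
    rw [← hσ0 i, ← hσ0 j, hij]
  have hIntg : ∀ i, IsIntegral ℤ (θ i) := by
    intro i
    refine ⟨p, hm, ?_⟩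
    rw [← aeval_def, hp]
    simp only [map_sub, map_mul, aeval_X, map_one, eq_intCast, map_intCast]
    rw [hroot i, sub_self]
  have hIntgA : ∀ (i : Fin 3) (m : ℤ), IsIntegral ℤ (θ i - m) := fun i m =>
    (hIntg i).sub (isIntegral_algebraMap (R := ℤ) (A := F) (x := m))
  have hinv1 : ∀ i, (θ i)⁻¹ = (θ i - A) * (θ i - B) := by
    intro i
    have h1 : θ i ≠ 0 := by
      intro h0
      have := hroot i
      rw [h0] at this; simp at this
    rw [inv_eq_iff_eq_inv]
    symm
    rw [inv_eq_iff_eq_inv]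
    exact eq_inv_of_mul_eq_one_left (by rw [mul_comm, ← mul_assoc]; exact hroot i)
  have hinv2 : ∀ i, (θ i - A)⁻¹ = θ i * (θ i - B) := by
    intro i
    exact inv_eq_of_mul_eq_one_right (by rw [← hroot i]; ring)
  have hint1 : ∀ i, IsIntegral ℤ (θ i)⁻¹ := fun i => by
    rw [hinv1 i]; exact (hIntgA i A).mul (hIntgA i B)
  have hint2 : ∀ i, IsIntegral ℤ (θ i - A)⁻¹ := fun i => by
    rw [hinv2 i]; exact (hIntg i).mul (hIntgA i B)
  -- embeddings
  have hemb : ∀ σ : F →+* ℂ, ∀ i, ∃ m, σ (θ i) = (r m : ℂ) := by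
    intro σ i
    apply h.fac
    rw [← map_intCast σ A, ← map_intCast σ B, ← map_sub, ← map_sub, ← map_mul, ← map_mul, hroot i, map_one]
  choose f hf using hemb
  have hfinj : ∀ σ, Function.Injective (f σ) := by
    intro σ i j hij
    apply hθinj
    apply σ.injective
    rw [hf σ i, hf σ j, hij]
  have hdeg : Module.finrank ℚ F ≤ 6 := by
    rw [← NumberField.Embeddings.card F ℂ]
    let g : (F →+* ℂ) → (Fin 3 ↪ Fin 3) := fun σ => ⟨f σ, hfinj σ⟩
    have hg : Function.Injective g := by
      intro σ τ hστ
      have h1 : f σ = f τ := congrArg (fun e : Fin 3 ↪ Fin 3 => (e : Fin 3 → Fin 3)) hστ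
      have h2 : RingHom.equivRatAlgHom F ℂ σ = RingHom.equivRatAlgHom F ℂ τ := by
        apply IntermediateField.adjoin_algHom_ext
        rintro x ⟨i, rfl⟩
        show σ (θ i) = τ (θ i)
        rw [hf σ i, hf τ i, h1]
      exact (RingHom.equivRatAlgHom F ℂ).injective h2
    have := Fintype.card_le_of_injective g hg
    rwa [show Fintype.card (Fin 3 ↪ Fin 3) = 6 by rw [Fintype.card_embedding_eq]; decide] at this
  have hn1 : (1:ℝ) ≤ n := by exact_mod_cast h.hn
  have hnormr : ∀ (σ : F →+* ℂ) (i : Fin 3), ‖σ (θ i)‖ = |r (f σ i)| := by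
    intro σ i; rw [hf σ i, Complex.norm_real, Real.norm_eq_abs]
  have hnormA : ∀ (σ : F →+* ℂ) (i : Fin 3), ‖σ (θ i - A)‖ = |r (f σ i) - A| := by
    intro σ i
    rw [map_sub, hf σ i, map_intCast, ← Complex.ofReal_intCast, ← Complex.ofReal_sub,
      Complex.norm_real, Real.norm_eq_abs]
  have hlogq : ∀ s t : ℝ, s ≠ 0 → t ≠ 0 → |Real.log s| ≤ 2 * n → |Real.log t| ≤ 2 * n →
      |Real.log ((|s| / |t|) ^ 2)| ≤ ((8 * n : ℕ) : ℝ) := by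
    intro s t hs ht h1 h2
    rw [Real.log_pow, Real.log_div (abs_ne_zero.2 hs) (abs_ne_zero.2 ht), Real.log_abs, Real.log_abs]
    rw [abs_le] at *
    push_cast
    constructor <;> linarith
  have hdiff : ∀ (σ : F →+* ℂ) (i j : Fin 3), ‖σ ((θ i - θ j) ^ 2)‖ ≤ Real.exp ((8 * n : ℕ) : ℝ) := by
    intro σ i j
    rw [map_pow, map_sub, hf σ i, hf σ j, ← Complex.ofReal_sub, norm_pow, Complex.norm_real, Real.norm_eq_abs]
    calc |r (f σ i) - r (f σ j)| ^ 2 ≤ Real.exp (4 * n) ^ 2 :=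
          pow_le_pow_left₀ (abs_nonneg _) (h.d2 _ _) 2
      _ = Real.exp ((8 * n : ℕ) : ℝ) := by
          rw [← Real.exp_nat_mul]; push_cast; ring_nf
  have hpos : ∀ i j, i ≠ j → 0 < (r i - r j) ^ 2 := by
    intro i j hij
    have := h.d1 i j hij
    exact sq_pos_of_ne_zero (by intro h0; rw [h0] at this; norm_num at this)
  have hlogd : ∀ i j, i ≠ j → |Real.log ((r i - r j) ^ 2)| ≤ 8 * n := by
    intro i j hij
    have h1 := h.d1 i j hij
    have h2 := h.d2 i j
    rw [Real.log_pow, ← Real.log_abs, abs_of_nonneg (by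
      have := Real.log_nonneg h1
      positivity)]
    have h3 := Real.log_le_log (by linarith) h2
    rw [Real.log_exp] at h3
    push_cast
    linarith
  refine P4_final hdeg σ0 ((θ 1 / θ 2) ^ 2) (((θ 1 - A) / (θ 2 - A)) ^ 2) ((θ 2 - θ 0) ^ 2)
    ((θ 1 - θ 0) ^ 2) ?_ ?_ ?_ ?_ ?_ ?_ ?_ ?_ ?_ ?_ (8 * n) (by have := h.hn; omega) ?_ ?_ ?_ ?_ ?_ ?_ a b X t0
    haX hbX hab ht ?_
  · rw [div_eq_mul_inv]; exact ((hIntg 1).mul (hint1 2)).pow 2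
  · rw [← inv_pow, inv_div, div_eq_mul_inv]; exact ((hIntg 2).mul (hint1 1)).pow 2
  · rw [div_eq_mul_inv]; exact ((hIntgA 1 A).mul (hint2 2)).pow 2
  · rw [← inv_pow, inv_div, div_eq_mul_inv]; exact ((hIntgA 2 A).mul (hint2 1)).pow 2
  · exact ((hIntg 2).sub (hIntg 0)).pow 2
  · exact ((hIntg 1).sub (hIntg 0)).pow 2
  · rw [map_pow, map_div₀, hσ0, hσ0]
    have := div_ne_zero (hne 1).1 (hne 2).1
    positivity
  · rw [map_pow, map_div₀, map_sub, map_sub, hσ0, hσ0, map_intCast]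
    have := div_ne_zero (hne 1).2.1 (hne 2).2.1
    positivity
  · rw [map_pow, map_sub, hσ0, hσ0]; exact hpos _ _ (by decide)
  · rw [map_pow, map_sub, hσ0, hσ0]; exact hpos _ _ (by decide)
  · intro σ
    rw [map_pow, map_div₀, norm_pow, norm_div, hnormr, hnormr]
    exact hlogq _ _ (hne _).1 (hne _).1 (h.bP _) (h.bP _)
  · intro σ
    rw [map_pow, map_div₀, norm_pow, norm_div, hnormA, hnormA]
    exact hlogq _ _ (hne _).2.1 (hne _).2.1 (h.bQ _) (h.bQ _)
  · intro σ; exact hdiff σ 2 0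
  · intro σ; exact hdiff σ 1 0
  · rw [map_pow, map_pow, map_sub, map_sub, hσ0, hσ0, hσ0,
      Real.log_div (hpos 2 0 (by decide)).ne' (hpos 1 0 (by decide)).ne']
    have h1 := hlogd 2 0 (by decide)
    have h2 := hlogd 1 0 (by decide)
    rw [abs_le] at *
    push_cast
    constructor <;> linarith
  · intro i m him
    apply E4_indep h i m
    have h1 := congrArg σ0 him
    rw [map_mul, map_zpow₀, map_zpow₀, map_pow, map_pow, map_div₀, map_div₀, map_sub, map_sub, hσ0, hσ0,
      map_intCast, map_one] at h1
    rw [zpow_mul, zpow_mul]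
    exact h1
  · rw [map_pow, map_pow, map_pow, map_pow, map_div₀, map_div₀, map_sub, map_sub, map_sub, map_sub,
      hσ0, hσ0, hσ0, map_intCast]
    exact hΛ

end

section
open Finset

theorem E6_tau (r0 r1 r2 x y : ℝ) (hy : 16 ≤ |y|) (h10 : 1 ≤ |r1 - r0|) (h20 : 1 ≤ |r2 - r0|)
    (hm1 : |x - r0 * y| ≤ |x - r1 * y|) (hm2 : |x - r0 * y| ≤ |x - r2 * y|)
    (hprod : |x - r0 * y| * |x - r1 * y| * |x - r2 * y| = 1) :
    |(x - r1 * y) * (r2 - r0) / ((x - r2 * y) * (r1 - r0)) - 1| ≤ 1 / y ^ 2 := by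
  have g1 : |r1 - r0| * |y| ≤ 2 * |x - r1 * y| := by
    rw [← abs_mul, show (r1 - r0) * y = (x - r0 * y) - (x - r1 * y) by ring]
    have := abs_sub (x - r0 * y) (x - r1 * y)
    linarith
  have g2 : |r2 - r0| * |y| ≤ 2 * |x - r2 * y| := by
    rw [← abs_mul, show (r2 - r0) * y = (x - r0 * y) - (x - r2 * y) by ring]
    have := abs_sub (x - r0 * y) (x - r2 * y)
    linarith
  set d1 := |r1 - r0| with hd1
  set d2 := |r2 - r0| with hd2
  set w := |y| with hw
  set b0 := |x - r0 * y| with hb0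
  set b1 := |x - r1 * y| with hb1
  set b2 := |x - r2 * y| with hb2
  have hd1p : 0 < d1 := by linarith
  have hd2p : 0 < d2 := by linarith
  have hwp : 0 < w := by linarith
  have hb1p : 0 < b1 := by nlinarith
  have hb2p : 0 < b2 := by nlinarith
  have hr12 : |r1 - r2| ≤ 2 * (d1 * d2) := by
    have h1 : |r1 - r2| ≤ d1 + d2 := by
      rw [show r1 - r2 = (r1 - r0) - (r2 - r0) by ring]
      exact abs_sub _ _
    nlinarith [mul_nonneg (sub_nonneg.2 h10) (sub_nonneg.2 h20)]
  have hx2 : x - r2 * y ≠ 0 := by rw [← abs_pos]; exact hb2p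
  have hr1 : r1 - r0 ≠ 0 := by rw [← abs_pos]; exact hd1p
  have e1 : (x - r1 * y) * (r2 - r0) / ((x - r2 * y) * (r1 - r0)) - 1 =
      -((x - r0 * y) * (r1 - r2)) / ((x - r2 * y) * (r1 - r0)) := by
    rw [div_sub_one (mul_ne_zero hx2 hr1)]; congr 1; ring
  rw [e1, abs_div, abs_neg, abs_mul, abs_mul, ← hb0, ← hb2, ← hd1, ← sq_abs y, ← hw,
    div_le_div_iff₀ (by positivity) (by positivity), one_mul]
  have h3 : (d1 * w) * ((d2 * w) * (d2 * w)) ≤ (2 * b1) * ((2 * b2) * (2 * b2)) := by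
    apply mul_le_mul g1 _ (by positivity) (by positivity)
    exact mul_le_mul g2 g2 (by positivity) (by positivity)
  have h4 : 16 ≤ w * (d1 * d2) := by
    have : 1 ≤ d1 * d2 := one_le_mul_of_one_le_of_one_le h10 h20
    nlinarith
  have h5 : 2 * (d1 * d2) * w ^ 2 ≤ b1 * b2 * (b2 * d1) := by
    have h6 := mul_le_mul_of_nonneg_left h3 hd1p.le
    have h7 : 16 * (d1 * d2 * w ^ 2) ≤ w * (d1 * d2) * (d1 * d2 * w ^ 2) :=
      mul_le_mul_of_nonneg_right h4 (by positivity)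
    linarith
  have h8 : |r1 - r2| * w ^ 2 ≤ b1 * b2 * (b2 * d1) :=
    (mul_le_mul_of_nonneg_right hr12 (by positivity)).trans h5
  have h9 := mul_le_mul_of_nonneg_left h8 (by positivity : 0 ≤ b0)
  calc b0 * |r1 - r2| * w ^ 2 = b0 * (|r1 - r2| * w ^ 2) := by ring
    _ ≤ b0 * (b1 * b2 * (b2 * d1)) := h9
    _ = (b0 * b1 * b2) * (b2 * d1) := by ring
    _ = b2 * d1 := by rw [hprod, one_mul]

/-- bound of exponents. -/
theorem E6_X (u v P0 P1 Q0 Q1 ε a b X Y l0 l1 : ℝ) (hu : 0 < u) (hv : 0 < v)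
    (h1 : |P0 + (u + v)| ≤ ε) (h2 : |P1 - u| ≤ ε) (h3 : |Q0 - u| ≤ ε) (h4 : |Q1 + (u + v)| ≤ ε)
    (ha : |a| ≤ X) (hb : |b| ≤ X) (hab : |a| = X ∨ |b| = X) (hl0 : |l0| ≤ Y) (hl1 : |l1| ≤ Y)
    (e0 : l0 = a * P0 + b * Q0) (e1 : l1 = a * P1 + b * Q1) : X * v ≤ Y + 2 * ε * X := by
  have hp : ∀ c z : ℝ, |c| ≤ X → |z| ≤ ε → |c * z| ≤ X * ε := by
    intro c z hc hz
    rw [abs_mul]; exact mul_le_mul hc hz (abs_nonneg _) ((abs_nonneg c).trans hc)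
  have k1 := abs_le.1 (hp a _ ha h1)
  have k2 := abs_le.1 (hp a _ ha h2)
  have k3 := abs_le.1 (hp b _ hb h3)
  have k4 := abs_le.1 (hp b _ hb h4)
  have j0 : |u * b - (u + v) * a| ≤ Y + 2 * ε * X := by
    rw [abs_le] at *; constructor <;> linarith
  have j1 : |u * a - (u + v) * b| ≤ Y + 2 * ε * X := by
    rw [abs_le] at *; constructor <;> linarith
  set M := Y + 2 * ε * X
  have hs : 0 < v + 2 * u := by linarith
  have m0 : |(u + v) * (u * b - (u + v) * a)| ≤ (u + v) * M := by
    rw [abs_mul, abs_of_pos (by linarith : 0 < u + v)]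
    exact mul_le_mul_of_nonneg_left j0 (by linarith)
  have m1 : |u * (u * a - (u + v) * b)| ≤ u * M := by
    rw [abs_mul, abs_of_pos hu]; exact mul_le_mul_of_nonneg_left j1 hu.le
  have m0' : |u * (u * b - (u + v) * a)| ≤ u * M := by
    rw [abs_mul, abs_of_pos hu]; exact mul_le_mul_of_nonneg_left j0 hu.le
  have m1' : |(u + v) * (u * a - (u + v) * b)| ≤ (u + v) * M := by
    rw [abs_mul, abs_of_pos (by linarith : 0 < u + v)]
    exact mul_le_mul_of_nonneg_left j1 (by linarith)
  have fa : |a| * v * (v + 2 * u) ≤ M * (v + 2 * u) := by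
    have : |a| * v * (v + 2 * u) = |(u + v) * (u * b - (u + v) * a) + u * (u * a - (u + v) * b)| := by
      rw [show (u + v) * (u * b - (u + v) * a) + u * (u * a - (u + v) * b) = -(a * (v * (v + 2 * u))) by ring,
        abs_neg, abs_mul, abs_of_pos (by positivity : 0 < v * (v + 2 * u)), mul_assoc]
    rw [this]
    refine (abs_add_le _ _).trans ?_
    linarith
  have fb : |b| * v * (v + 2 * u) ≤ M * (v + 2 * u) := by
    have : |b| * v * (v + 2 * u) = |u * (u * b - (u + v) * a) + (u + v) * (u * a - (u + v) * b)| := by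
      rw [show u * (u * b - (u + v) * a) + (u + v) * (u * a - (u + v) * b) = -(b * (v * (v + 2 * u))) by ring,
        abs_neg, abs_mul, abs_of_pos (by positivity : 0 < v * (v + 2 * u)), mul_assoc]
    rw [this]
    refine (abs_add_le _ _).trans ?_
    linarith
  rcases hab with h | h
  · rw [← h]; exact le_of_mul_le_mul_right fa hs
  · rw [← h]; exact le_of_mul_le_mul_right fb hs

end

section
open Finset

theorem E7_data (n : ℕ) (hn : 1000 < n) (A B : ℤ) (hA : 100 ≤ A) (hAB : 100 * A ≤ B)
    (hB : (B:ℝ) = 2 ^ n) (α : Fin 3 → ℝ)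
    (hord : α 0 < α 1 ∧ α 1 < α 2) (hroot : ∀ i, α i * (α i - A) * (α i - B) = 1) :
    E4Data n A B α := by
  have hA' : (100:ℝ) ≤ A := by exact_mod_cast hA
  have hAB' : (100:ℝ) * A ≤ B := by exact_mod_cast hAB
  have hn' : (1000:ℝ) < n := by exact_mod_cast hn
  obtain ⟨v1, v2, v3⟩ := E1_vieta A B _ _ _ hord.1 hord.2 (hroot 0) (hroot 1) (hroot 2)
  obtain ⟨p0, p0', p1, p1', p2, p2'⟩ := E1_roots A B _ _ _ hA' hAB' hord.1 hord.2 (hroot 0) (hroot 1) (hroot 2)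
  obtain ⟨⟨l0, l1, l2⟩, ⟨m0, m1, m2⟩, -⟩ :=
    E1_logs A B _ _ _ hA' hAB' hord.1 hord.2 (hroot 0) (hroot 1) (hroot 2)
  have hne := E3_ne A B α hroot
  have hB' : (10000:ℝ) ≤ B := by linarith
  have hB0 : (0:ℝ) < B := by linarith
  have heps : 8 * (A:ℝ) / B ≤ 8 / 100 := by
    rw [div_le_iff₀ hB0]; linarith
  have hv : Real.log (B:ℝ) = n * Real.log 2 := by rw [hB, Real.log_pow]
  have lt := Real.log_two_lt_d9
  have lg := Real.log_two_gt_d9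
  have hv1 : Real.log (B:ℝ) ≤ 0.7 * n := by
    rw [hv]; have := mul_le_mul_of_nonneg_left lt.le (by linarith : (0:ℝ) ≤ n); linarith
  have hv2 : 1 ≤ Real.log (B:ℝ) := by
    rw [hv]; have := mul_le_mul hn'.le lg.le (by norm_num) (by linarith); linarith
  have huv : Real.log (A:ℝ) ≤ Real.log B := Real.log_le_log (by linarith) (by linarith)
  have hu : 0 < Real.log (A:ℝ) := Real.log_pos (by linarith)
  have q1 : (4:ℝ) / (A * B) ≤ 1 := by
    rw [div_le_one (by positivity)]
    have := mul_le_mul hA' hB' (by norm_num) (by linarith)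
    linarith
  have q2 : (2:ℝ) / B ^ 2 ≤ 1 := by
    rw [div_le_one (by positivity)]
    have := mul_le_mul hB' hB' (by norm_num) (by linarith)
    rw [sq]; linarith
  have sP : Real.log (α 0) + Real.log (α 1) + Real.log (α 2) = 0 := by
    rw [← Real.log_mul (hne 0).1 (hne 1).1, ← Real.log_mul (mul_ne_zero (hne 0).1 (hne 1).1) (hne 2).1,
      v3, Real.log_one]
  have vQ : (α 0 - A) * (α 1 - A) * (α 2 - A) = 1 := by
    linear_combination (A:ℝ) ^ 2 * v1 - (A:ℝ) * v2 + v3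
  have sQ : Real.log (α 0 - A) + Real.log (α 1 - A) + Real.log (α 2 - A) = 0 := by
    rw [← Real.log_mul (hne 0).2.1 (hne 1).2.1,
      ← Real.log_mul (mul_ne_zero (hne 0).2.1 (hne 1).2.1) (hne 2).2.1, vQ, Real.log_one]
  have hd : ∀ i j : Fin 3, i < j → 1 ≤ α j - α i ∧ α j - α i ≤ 2 * B := by
    intro i j hij
    fin_cases i <;> fin_cases j <;> simp only [Fin.zero_eta, Fin.mk_one, Fin.reduceFinMk] at hij ⊢ <;>
      first
        | exact absurd hij (by decide)
        | (constructor <;> linarith)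
  have h2B : 2 * (B:ℝ) ≤ Real.exp (4 * n) := by
    rw [← Real.log_le_iff_le_exp (by linarith), Real.log_mul (by norm_num) hB0.ne']
    linarith
  refine ⟨hA, hAB, by omega, hroot, ?_, ?_, ?_, ?_, ?_, ?_, ?_, ?_, ?_, ?_⟩
  · intro i j hij
    by_contra hne2
    rcases lt_or_gt_of_ne hne2 with h | h
    · have := (hd i j h).1; linarith
    · have := (hd j i h).1; linarith
  · intro z hz
    have v1' : (α 0 : ℂ) + α 1 + α 2 = A + B := by exact_mod_cast v1
    have v2' : (α 0 : ℂ) * α 1 + α 0 * α 2 + α 1 * α 2 = A * B := by exact_mod_cast v2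
    have v3' : (α 0 : ℂ) * α 1 * α 2 = 1 := by exact_mod_cast v3
    have : (z - α 0) * (z - α 1) * (z - α 2) = 0 := by
      linear_combination hz - z ^ 2 * v1' + z * v2' - v3'
    rcases mul_eq_zero.1 this with h | h
    · rcases mul_eq_zero.1 h with h | h
      · exact ⟨0, sub_eq_zero.1 h⟩
      · exact ⟨1, sub_eq_zero.1 h⟩
    · exact ⟨2, sub_eq_zero.1 h⟩
  · rw [Fin.sum_univ_three, v1]
  · rw [Fin.sum_univ_three, sP]
  · rw [Fin.sum_univ_three, sQ]
  · rw [abs_le] at l0 l1 l2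
    intro i
    fin_cases i <;> simp only [Fin.zero_eta, Fin.mk_one, Fin.reduceFinMk] <;> rw [abs_le] <;>
      constructor <;> linarith
  · rw [abs_le] at m0 m1 m2
    intro i
    fin_cases i <;> simp only [Fin.zero_eta, Fin.mk_one, Fin.reduceFinMk] <;> rw [abs_le] <;>
      constructor <;> linarith
  · intro i j hij
    rcases lt_or_gt_of_ne hij with h | h
    · rw [abs_sub_comm]; exact (hd i j h).1.trans (le_abs_self _)
    · exact (hd j i h).1.trans (le_abs_self _)
  · intro i j
    refine le_trans ?_ h2B
    rcases lt_trichotomy i j with h | h | h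
    · rw [abs_sub_comm, abs_of_nonneg (by have := (hd i j h).1; linarith)]; exact (hd i j h).2
    · rw [h, sub_self, abs_zero]; linarith
    · rw [abs_of_nonneg (by have := (hd j i h).1; linarith)]; exact (hd j i h).2
  · intro i m him
    have h1 : max |(i:ℝ)| |(m:ℝ)| * Real.log B ≤ 0 + 2 * (8 * A / B) * max |(i:ℝ)| |(m:ℝ)| := by
      refine E6_X (Real.log A) (Real.log B) _ _ _ _ (8 * A / B) i m _ 0 0 0 hu (by linarith) l0 l1 m0 m1
        (le_max_left _ _) (le_max_right _ _) ?_ (by simp) (by simp) (him 0).symm (him 1).symm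
      rcases max_choice |(i:ℝ)| |(m:ℝ)| with h | h
      · left; exact h.symm
      · right; exact h.symm
    have h2 : max |(i:ℝ)| |(m:ℝ)| ≤ 0 := by
      have h3 := le_max_left |(i:ℝ)| |(m:ℝ)|
      have h4 : 0 ≤ max |(i:ℝ)| |(m:ℝ)| := (abs_nonneg _).trans h3
      have h5 := mul_le_mul_of_nonneg_left hv2 h4
      have h6 := mul_le_mul_of_nonneg_right heps h4
      linarith only [h1, h5, h6]
    have h3 := (le_max_left _ _).trans h2
    have h4 := (le_max_right _ _).trans h2
    constructor
    · have := abs_nonpos_iff.1 h3; exact_mod_cast this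
    · have := abs_nonpos_iff.1 h4; exact_mod_cast this

end

section
open Finset

theorem E8_master (n : ℕ) (hn : 1000 < n) (A B : ℤ) (hA : 100 ≤ A) (hAB : 100 * A ≤ B)
    (hB : (B:ℝ) = 2 ^ n) (α : Fin 3 → ℝ)
    (hord : α 0 < α 1 ∧ α 1 < α 2) (hroot : ∀ i, α i * (α i - A) * (α i - B) = 1) (x y : ℤ)
    (h : x * (x - A * y) * (x - B * y) - y ^ 3 = 1 ∨ x * (x - A * y) * (x - B * y) - y ^ 3 = -1)
    (hy : 2 ≤ |y|) (π : Equiv.Perm (Fin 3))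
    (hmin : ∀ i, |(x:ℝ) - α (π 0) * y| ≤ |(x:ℝ) - α i * y|) :
    A * B ≤ 8 * |y| ∧ ∃ (e a b : ℤ) (X : ℕ), (e = 1 ∨ e = -1) ∧
      (∀ i, (x:ℝ) - α i * y = e * α i ^ a * (α i - A) ^ b) ∧ |a| ≤ X ∧ |b| ≤ X ∧
      |Real.log (α (π 2) - α (π 0)) - Real.log (α (π 1) - α (π 0)) +
        a * (Real.log (α (π 1)) - Real.log (α (π 2))) +
        b * (Real.log (α (π 1) - A) - Real.log (α (π 2) - A))| ≤ 2 / (y:ℝ) ^ 2 ∧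
      (∀ t0 : ℕ, (∀ t ≥ t0, 20000000000 * (8 * n) * (t + 1) ^ 2 ≤ 2 ^ t) → X < 2 ^ (3 * t0)) := by
  have hA' : (100:ℝ) ≤ A := by exact_mod_cast hA
  have hAB' : (100:ℝ) * A ≤ B := by exact_mod_cast hAB
  have hn' : (1001:ℝ) ≤ n := by exact_mod_cast hn
  have hyAB : A * B ≤ 8 * |y| := by
    rcases E2_thue A B x y hA hAB h with h1 | ⟨h1, -⟩ | ⟨h1 | h1, -⟩
    · exact h1
    all_goals rw [h1] at hy; norm_num at hy
  refine ⟨hyAB, ?_⟩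
  obtain ⟨e, he, a, b, hrep⟩ := E3_unit A B hA hAB α hord hroot x y h
  have hD := E7_data n hn A B hA hAB hB α hord hroot
  have hDp := hD.perm π
  obtain ⟨⟨l0, l1, l2⟩, ⟨m0, m1, m2⟩, -⟩ :=
    E1_logs A B _ _ _ hA' hAB' hord.1 hord.2 (hroot 0) (hroot 1) (hroot 2)
  obtain ⟨p0, p0', p1, p1', p2, p2'⟩ := E1_roots A B _ _ _ hA' hAB' hord.1 hord.2 (hroot 0) (hroot 1) (hroot 2)
  have hne := E3_ne A B α hroot
  have hB' : (10000:ℝ) ≤ B := by linarith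
  have hB0 : (0:ℝ) < B := by linarith
  have heps : 8 * (A:ℝ) / B ≤ 8 / 100 := by
    rw [div_le_iff₀ hB0]; linarith
  have hv : Real.log (B:ℝ) = n * Real.log 2 := by rw [hB, Real.log_pow]
  have lg := Real.log_two_gt_d9
  have hv1 : 0.69 * n + 1 ≤ Real.log (B:ℝ) := by
    rw [hv]
    have := mul_le_mul_of_nonneg_left lg.le (by linarith : (0:ℝ) ≤ n)
    linarith
  have hyR : (A:ℝ) * B ≤ 8 * |(y:ℝ)| := by exact_mod_cast hyAB
  have hyB : 12 * (B:ℝ) ≤ |(y:ℝ)| := by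
    have := mul_le_mul_of_nonneg_right hA' hB0.le
    linarith
  have hy0 : 0 < |(y:ℝ)| := by linarith
  have hpm : |(x:ℝ) - α 0 * y| * |(x:ℝ) - α 1 * y| * |(x:ℝ) - α 2 * y| = 1 := by
    rw [← abs_mul, ← abs_mul, E3_norm A B α hord hroot x y]
    rcases h with h | h <;> rw [h] <;> norm_num
  have hprod : ∏ i, |(x:ℝ) - α i * y| = 1 := by rw [Fin.prod_univ_three]; exact hpm
  have hprodπ : |(x:ℝ) - α (π 0) * y| * |(x:ℝ) - α (π 1) * y| * |(x:ℝ) - α (π 2) * y| = 1 := by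
    rw [← Fin.prod_univ_three (fun i => |(x:ℝ) - α (π i) * y|), ← hprod]
    exact Equiv.prod_comp π (fun i => |(x:ℝ) - α i * y|)
  have hβ : ∀ i, (x:ℝ) - α i * y ≠ 0 := by
    intro i hi
    have := Finset.prod_eq_zero (f := fun i => |(x:ℝ) - α i * y|) (Finset.mem_univ i) (by simp [hi])
    rw [hprod] at this
    exact one_ne_zero this
  have hlog : ∀ i, Real.log ((x:ℝ) - α i * y) = a * Real.log (α i) + b * Real.log (α i - A) := by
    intro i
    have he' : Real.log (e:ℝ) = 0 := by rcases he with h | h <;> rw [h] <;> simp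
    have he0 : (e:ℝ) ≠ 0 := by rcases he with h | h <;> rw [h] <;> norm_num
    rw [hrep i, Real.log_mul (mul_ne_zero he0 (zpow_ne_zero _ (hne i).1)) (zpow_ne_zero _ (hne i).2.1),
      Real.log_mul he0 (zpow_ne_zero _ (hne i).1), Real.log_zpow, Real.log_zpow, he', zero_add]
  -- the linear form
  have hd10 := hDp.d1 1 0 (by decide)
  have hd20 := hDp.d1 2 0 (by decide)
  have hτ := E6_tau (α (π 0)) (α (π 1)) (α (π 2)) x y (by linarith) hd10 hd20 (hmin _) (hmin _) hprodπ
  have hT : |Real.log (α (π 2) - α (π 0)) - Real.log (α (π 1) - α (π 0)) +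
        a * (Real.log (α (π 1)) - Real.log (α (π 2))) +
        b * (Real.log (α (π 1) - A) - Real.log (α (π 2) - A))| ≤ 2 / (y:ℝ) ^ 2 := by
    have hsm : 1 / (y:ℝ) ^ 2 ≤ 1 / 2 := by
      rw [← sq_abs]
      apply one_div_le_one_div_of_le (by norm_num)
      nlinarith
    have h1 := E1_logaux _ 1 (1 / (y:ℝ) ^ 2) one_pos hsm (by rw [mul_one]; exact hτ)
    have n1 : α (π 1) - α (π 0) ≠ 0 := by intro h0; simp only [h0] at hd10; norm_num at hd10
    have n2 : α (π 2) - α (π 0) ≠ 0 := by intro h0; simp only [h0] at hd20; norm_num at hd20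
    rw [Real.log_one, sub_zero, Real.log_div (mul_ne_zero (hβ _) n2) (mul_ne_zero (hβ _) n1),
      Real.log_mul (hβ _) n2, Real.log_mul (hβ _) n1, hlog, hlog] at h1
    rw [show 2 / (y:ℝ) ^ 2 = 2 * (1 / (y:ℝ) ^ 2) by ring]
    convert h1 using 2
    ring
  refine ⟨e, a, b, max a.natAbs b.natAbs, he, hrep, ?_, ?_, hT, ?_⟩
  · rw [Int.abs_eq_natAbs]; exact_mod_cast le_max_left _ _
  · rw [Int.abs_eq_natAbs]; exact_mod_cast le_max_right _ _
  intro t0 ht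
  set X := max a.natAbs b.natAbs with hX
  have haX : |a| ≤ X := by rw [Int.abs_eq_natAbs]; exact_mod_cast le_max_left _ _
  have hbX : |b| ≤ X := by rw [Int.abs_eq_natAbs]; exact_mod_cast le_max_right _ _
  have habX : |a| = X ∨ |b| = X := by
    rcases max_choice a.natAbs b.natAbs with h | h
    · left; rw [Int.abs_eq_natAbs, hX, h]
    · right; rw [Int.abs_eq_natAbs, hX, h]
  rcases Nat.eq_zero_or_pos X with hX0 | hXpos
  · rw [hX0]; positivity
  have hX1 : (1:ℝ) ≤ X := by exact_mod_cast hXpos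
  -- upper bound of `X`
  have hb1 : |(x:ℝ) - α (π 0) * y| ≤ 1 := by
    by_contra hc
    push Not at hc
    have c1 := hmin (π 1)
    have c2 := hmin (π 2)
    have := one_lt_mul_of_lt_of_le (one_lt_mul_of_lt_of_le hc (by linarith : 1 ≤ |(x:ℝ) - α (π 1) * y|))
      (by linarith : 1 ≤ |(x:ℝ) - α (π 2) * y|)
    linarith
  have q1 : (4:ℝ) / (A * B) ≤ 1 := by
    rw [div_le_one (by positivity)]
    have := mul_le_mul hA' hB' (by norm_num) (by linarith)
    linarith
  have q2 : (2:ℝ) / B ^ 2 ≤ 1 := by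
    rw [div_le_one (by positivity)]
    have := mul_le_mul hB' hB' (by norm_num) (by linarith)
    rw [sq]; linarith
  have hrange : ∀ i, 0 ≤ α i ∧ α i ≤ 2 * B := by
    intro i
    fin_cases i <;> simp only [Fin.zero_eta, Fin.mk_one, Fin.reduceFinMk] <;> constructor <;> linarith
  have hup : ∀ i, Real.log ((x:ℝ) - α i * y) ≤ 2 * Real.log |(y:ℝ)| := by
    intro i
    have h1 : |(x:ℝ) - α i * y| ≤ 3 * B * |(y:ℝ)| := by
      have h2 : (x:ℝ) - α i * y = ((x:ℝ) - α (π 0) * y) + (α (π 0) - α i) * y := by ring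
      rw [h2]
      refine (abs_add_le _ _).trans ?_
      rw [abs_mul]
      have h3 : |α (π 0) - α i| ≤ 2 * B := by
        have := hrange i
        have := hrange (π 0)
        rw [abs_le]; constructor <;> linarith
      have h4 := mul_le_mul_of_nonneg_right h3 hy0.le
      have h5 : 1 ≤ B * |(y:ℝ)| := one_le_mul_of_one_le_of_one_le (by linarith) (by linarith)
      linarith
    have h6 : |(x:ℝ) - α i * y| ≤ |(y:ℝ)| ^ 2 := by
      refine h1.trans ?_
      rw [sq]
      exact mul_le_mul_of_nonneg_right (by linarith) hy0.le
    have h7 := Real.log_le_log (abs_pos.2 (hβ i)) h6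
    rw [Real.log_abs, Real.log_pow] at h7
    exact_mod_cast h7
  have hsum0 : Real.log ((x:ℝ) - α 0 * y) + Real.log ((x:ℝ) - α 1 * y) + Real.log ((x:ℝ) - α 2 * y) = 0 := by
    rw [← Real.log_mul (hβ 0) (hβ 1), ← Real.log_mul (mul_ne_zero (hβ 0) (hβ 1)) (hβ 2), ← Real.log_abs,
      abs_mul, abs_mul, hpm, Real.log_one]
  have u0 := hup 0
  have u1 := hup 1
  have u2 := hup 2
  set Ly := Real.log |(y:ℝ)| with hLy
  have hLy0 : 0 ≤ Ly := Real.log_nonneg (by linarith)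
  have hXv : (X:ℝ) * Real.log B ≤ 4 * Ly + 2 * (8 * A / B) * X := by
    refine E6_X (Real.log A) (Real.log B) _ _ _ _ (8 * A / B) a b X (4 * Ly) _ _
      (Real.log_pos (by linarith)) (by linarith) l0 l1 m0 m1
      (by exact_mod_cast haX) (by exact_mod_cast hbX) ?_ ?_ ?_ (hlog 0) (hlog 1)
    · exact_mod_cast habX
    · rw [abs_le]; constructor <;> linarith
    · rw [abs_le]; constructor <;> linarith
  have hXn : (X:ℝ) * (0.69 * n) ≤ 4 * Ly := by
    have h1 := mul_le_mul_of_nonneg_left hv1 (by linarith : (0:ℝ) ≤ X)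
    have h2 := mul_le_mul_of_nonneg_right heps (by linarith : (0:ℝ) ≤ X)
    linarith
  refine E5_field hDp a b X t0 haX hbX habX ht ?_
  have hsplit : Real.log ((α (π 2) - α (π 0)) ^ 2 / (α (π 1) - α (π 0)) ^ 2) +
      a * Real.log ((α (π 1) / α (π 2)) ^ 2) + b * Real.log (((α (π 1) - A) / (α (π 2) - A)) ^ 2) =
      2 * (Real.log (α (π 2) - α (π 0)) - Real.log (α (π 1) - α (π 0)) +
        a * (Real.log (α (π 1)) - Real.log (α (π 2))) +
        b * (Real.log (α (π 1) - A) - Real.log (α (π 2) - A))) := by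
    have n1 : α (π 1) - α (π 0) ≠ 0 := by intro h0; simp only [h0] at hd10; norm_num at hd10
    have n2 : α (π 2) - α (π 0) ≠ 0 := by intro h0; simp only [h0] at hd20; norm_num at hd20
    rw [← div_pow, Real.log_pow, Real.log_pow, Real.log_pow, Real.log_div n2 n1,
      Real.log_div (hne _).1 (hne _).1, Real.log_div (hne _).2.1 (hne _).2.1]
    push_cast; ring
  rw [hsplit, abs_mul, abs_of_pos (by norm_num : (0:ℝ) < 2)]
  have hy2 : 2 * (2 / (y:ℝ) ^ 2) ≤ Real.exp (-((X:ℝ) * (8 * n : ℕ) / 32)) := by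
    have h1 : (y:ℝ) ^ 2 = Real.exp (2 * Ly) := by
      rw [two_mul, Real.exp_add, hLy, Real.exp_log hy0, ← sq, sq_abs]
    have h2 : (4:ℝ) ≤ Real.exp 3 := by
      have := Real.add_one_le_exp 3
      linarith
    calc 2 * (2 / (y:ℝ) ^ 2) = 4 * Real.exp (-(2 * Ly)) := by
          rw [h1, Real.exp_neg]; ring
      _ ≤ Real.exp 3 * Real.exp (-(2 * Ly)) := mul_le_mul_of_nonneg_right h2 (Real.exp_nonneg _)
      _ = Real.exp (3 + -(2 * Ly)) := by rw [Real.exp_add]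
      _ ≤ _ := by
          apply Real.exp_le_exp.2
          push_cast
          have h3 : (1001:ℝ) ≤ X * n := by
            have := mul_le_mul hX1 hn' (by norm_num) (by linarith)
            linarith
          linarith
  linarith

end

section
open Finset

theorem E9_logA (n : ℕ) (hn : 1000 < n) :
    |Real.log (Nat.fib n : ℝ) - (n * Real.log Real.goldenRatio - Real.log (Real.sqrt 5))| ≤
      2 * Real.exp (-(n * Real.log Real.goldenRatio)) := by
  have hφ := Real.goldenRatio_pos
  have h5 : (0:ℝ) < Real.sqrt 5 := Real.sqrt_pos.2 (by norm_num)
  have hr : 0 < Real.goldenRatio ^ n / Real.sqrt 5 := by positivity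
  have h1 : Real.log (Real.goldenRatio ^ n / Real.sqrt 5) =
      n * Real.log Real.goldenRatio - Real.log (Real.sqrt 5) := by
    rw [Real.log_div (by positivity) h5.ne', Real.log_pow]
  have h2 : Real.exp (-(n * Real.log Real.goldenRatio)) = (Real.goldenRatio ^ n)⁻¹ := by
    rw [Real.exp_neg, Real.exp_nat_mul, Real.exp_log hφ]
  rw [← h1, h2]
  apply E1_logaux _ _ _ hr
  · have h3 : (2:ℝ) ≤ Real.goldenRatio ^ n := by
      have : Real.goldenRatio ^ 2 ≤ Real.goldenRatio ^ n :=
        pow_le_pow_right₀ Real.one_lt_goldenRatio.le (by omega)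
      have h4 := Real.goldenRatio_sq
      have := Real.one_lt_goldenRatio
      linarith
    rw [one_div]
    exact inv_anti₀ (by norm_num) h3
  · rw [Real.coe_fib_eq]
    have e1 : (Real.goldenRatio ^ n - Real.goldenConj ^ n) / Real.sqrt 5 -
        Real.goldenRatio ^ n / Real.sqrt 5 = - (Real.goldenConj ^ n / Real.sqrt 5) := by ring
    rw [e1, abs_neg, abs_div, abs_pow, abs_of_pos h5]
    have e2 : (Real.goldenRatio ^ n)⁻¹ * (Real.goldenRatio ^ n / Real.sqrt 5) = 1 / Real.sqrt 5 := by
      field_simp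
    rw [e2]
    apply div_le_div_of_nonneg_right _ h5.le
    apply pow_le_one₀ (abs_nonneg _)
    rw [abs_le]
    have := Real.goldenConj_neg
    have := Real.neg_one_lt_goldenConj
    constructor <;> linarith

theorem E9_ratio (n : ℕ) (hn : 1000 < n) :
    Real.log (Nat.fib n : ℝ) + 48 / 157 * (n * Real.log 2) ≤ n * Real.log 2 := by
  have h1 := (abs_le.1 (E9_logA n hn)).2
  have h2 := Z10_theta
  have hn' : (1001:ℝ) ≤ n := by exact_mod_cast hn
  have lg := Real.log_two_gt_d9
  have h5 : 1 / 2 ≤ Real.log (Real.sqrt 5) := by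
    rw [Real.log_sqrt (by norm_num)]
    have : 1 ≤ Real.log 5 := by
      rw [Real.le_log_iff_exp_le (by norm_num)]
      linarith [Real.exp_one_lt_d9]
    linarith
  have hφ : 0.48 ≤ Real.log Real.goldenRatio := by linarith [h2.1]
  have h6 : 2 * Real.exp (-(n * Real.log Real.goldenRatio)) ≤ 1 / 2 := by
    have h7 : Real.exp (-(n * Real.log Real.goldenRatio)) ≤ Real.exp (-3) := by
      apply Real.exp_le_exp.2
      have := mul_le_mul hn' hφ (by norm_num) (by linarith)
      linarith
    have h8 : Real.exp (-3) ≤ 1 / 4 := by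
      rw [Real.exp_neg, one_div]
      apply inv_anti₀ (by norm_num)
      have := Real.add_one_le_exp 3
      linarith
    linarith
  have h9 := mul_le_mul_of_nonneg_left h2.2.le (by linarith : (0:ℝ) ≤ n)
  linarith

theorem E9_AB (n : ℕ) (hn : 1000 < n) :
    100 ≤ (Nat.fib n : ℤ) ∧ 100 * (Nat.fib n : ℤ) ≤ 2 ^ n := by
  have h1 : 144 ≤ Nat.fib n := by
    calc 144 = Nat.fib 12 := by decide
      _ ≤ Nat.fib n := Nat.fib_mono (by omega)
  refine ⟨by omega, ?_⟩
  have hn' : (1001:ℝ) ≤ n := by exact_mod_cast hn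
  have lg := Real.log_two_gt_d9
  have hpos : (0:ℝ) < Nat.fib n := by
    have : 0 < Nat.fib n := by omega
    exact_mod_cast this
  have h2 : (100:ℝ) * Nat.fib n ≤ 2 ^ n := by
    rw [← Real.log_le_log_iff (by positivity) (by positivity), Real.log_mul (by norm_num) hpos.ne',
      Real.log_pow]
    have h3 := E9_ratio n hn
    have h4 : Real.log 100 ≤ 99 := by
      have := Real.log_le_sub_one_of_pos (by norm_num : (0:ℝ) < 100)
      linarith
    have := mul_le_mul hn' lg.le (by norm_num) (by linarith)
    linarith
  exact_mod_cast h2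

theorem E9_grow (C t0 : ℕ) (h7 : 7 ≤ t0) (h0 : C * (t0 + 1) ^ 2 ≤ 2 ^ t0) :
    ∀ t ≥ t0, C * (t + 1) ^ 2 ≤ 2 ^ t := by
  intro t ht
  induction t, ht using Nat.le_induction with
  | base => exact h0
  | succ t ht ih =>
    have h1 : (t + 1 + 1) ^ 2 ≤ 2 * (t + 1) ^ 2 := by nlinarith
    calc C * (t + 1 + 1) ^ 2 ≤ C * (2 * (t + 1) ^ 2) := Nat.mul_le_mul_left _ h1
      _ = 2 * (C * (t + 1) ^ 2) := by ring
      _ ≤ 2 * 2 ^ t := Nat.mul_le_mul_left _ ih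
      _ = 2 ^ (t + 1) := by ring

theorem E9_ht3 (n : ℕ) (hn : 1000 < n) :
    ∀ t ≥ n / 11, 20000000000 * (8 * n) * (t + 1) ^ 2 ≤ 2 ^ t := by
  have h1 : ∀ s : ℕ, 91 ≤ s → 160000000000 * (11 * s + 10) * (s + 1) ^ 2 ≤ 2 ^ s := by
    intro s hs
    induction s, hs using Nat.le_induction with
    | base => norm_num
    | succ s hs ih =>
      have h2 : (11 * (s + 1) + 10) * (s + 1 + 1) ^ 2 ≤ 2 * ((11 * s + 10) * (s + 1) ^ 2) := by
        nlinarith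
      have e : (2:ℕ) ^ (s + 1) = 2 * 2 ^ s := by ring
      rw [e]
      nlinarith [h2, ih]
  apply E9_grow
  · omega
  · have h2 := h1 (n / 11) (by omega)
    refine le_trans (Nat.mul_le_mul_right _ ?_) h2
    omega

theorem E9_pw (h : ℕ) (hh : 49 ≤ h) : 160000000000 * (2 * h + 5) ^ 2 ≤ 2 ^ (h + 3) := by
  induction h, hh using Nat.le_induction with
  | base => norm_num
  | succ s hs ih =>
    have h2 : (2 * (s + 1) + 5) ^ 2 ≤ 2 * (2 * s + 5) ^ 2 := by nlinarith
    have e : (2:ℕ) ^ (s + 1 + 3) = 2 * 2 ^ (s + 3) := by ring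
    rw [e]
    linarith

theorem E9_ht1 (n h : ℕ) (hh : 49 ≤ h) (hn2 : n < 2 ^ (h + 1)) :
    ∀ t ≥ 2 * h + 4, 20000000000 * (8 * n) * (t + 1) ^ 2 ≤ 2 ^ t := by
  apply E9_grow
  · omega
  · have h1 := E9_pw h hh
    calc 20000000000 * (8 * n) * (2 * h + 4 + 1) ^ 2
        = n * (160000000000 * (2 * h + 5) ^ 2) := by ring
      _ ≤ 2 ^ (h + 1) * 2 ^ (h + 3) := Nat.mul_le_mul hn2.le h1
      _ = 2 ^ (2 * h + 4) := by rw [← pow_add]; congr 1; ring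

end

section
open Finset

theorem E10_AoB (n : ℕ) (hn : 1000 < n) :
    (Nat.fib n : ℝ) / 2 ^ n ≤ Real.exp (-(48 / 157 * (n * Real.log 2))) := by
  have h1 := E9_ratio n hn
  have hA : (0:ℝ) < Nat.fib n := by exact_mod_cast Nat.fib_pos.2 (by omega)
  have h2 : (Nat.fib n : ℝ) / 2 ^ n = Real.exp (Real.log (Nat.fib n) - n * Real.log 2) := by
    rw [Real.exp_sub, Real.exp_log hA, Real.exp_nat_mul, Real.exp_log (by norm_num)]
  rw [h2]
  apply Real.exp_le_exp.2
  linarith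

theorem E10_hn (h : ℕ) (hh : 49 ≤ h) : 420 * h + 1260 ≤ 2 ^ h := by
  induction h, hh using Nat.le_induction with
  | base => norm_num
  | succ s hs ih =>
    have e : (2:ℕ) ^ (s + 1) = 2 * 2 ^ s := by ring
    rw [e]
    linarith

theorem E10_core (n h : ℕ) (hh : 49 ≤ h) (hn1 : 2 ^ h ≤ n) (hn2 : n < 2 ^ (h + 1))
    (X : ℕ) (hX : X < 2 ^ (6 * h + 12)) (k l : ℤ) (hk : |k| ≤ 3 * X + 1) (hl : |l| ≤ 3 * X + 1)
    (H : |(k:ℝ) * Real.log (Nat.fib n) - l * (n * Real.log 2)| ≤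
      (3 + 4 * X) * (8 * Nat.fib n / 2 ^ n)) : k = 0 ∧ l = 0 := by
  have hnat := E10_hn h hh
  have hn : 1000 < n := by omega
  have lg := Real.log_two_gt_d9
  have lg2 := Real.log_two_lt_d9
  have hnR : (420 * h + 1260 : ℝ) ≤ n := by exact_mod_cast hnat.trans hn1
  have hn' : (1001:ℝ) ≤ n := by exact_mod_cast hn
  set E := Real.exp (-(48 / 157 * (n * Real.log 2))) with hE
  have hE0 : 0 < E := Real.exp_pos _
  have hab := E10_AoB n hn
  set D : ℝ := 2 ^ (6 * h + 12) with hD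
  have hD1 : 1 ≤ D := one_le_pow₀ (by norm_num)
  have hXD : (X:ℝ) ≤ D := by rw [hD]; exact_mod_cast hX.le
  have hX0 : (0:ℝ) ≤ X := Nat.cast_nonneg _
  have hH2 : (3 + 4 * (X:ℝ)) * (8 * Nat.fib n / 2 ^ n) ≤ 56 * D * E := by
    have e : (8 * (Nat.fib n:ℝ) / 2 ^ n) = 8 * ((Nat.fib n:ℝ) / 2 ^ n) := by ring
    rw [e]
    have h1 : (3 + 4 * (X:ℝ)) ≤ 7 * D := by linarith
    calc (3 + 4 * (X:ℝ)) * (8 * ((Nat.fib n:ℝ) / 2 ^ n)) ≤ (7 * D) * (8 * E) :=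
          mul_le_mul h1 (by linarith) (by positivity) (by linarith)
      _ = 56 * D * E := by ring
  have hfin : 64 * D * E ≤ Real.exp (-(n / 5)) := by
    have e1 : 64 * D = Real.exp ((6 * h + 18) * Real.log 2) := by
      have : ((6 * h + 18 : ℝ)) = ((6 * h + 18 : ℕ) : ℝ) := by push_cast; ring
      rw [this, Real.exp_nat_mul, Real.exp_log (by norm_num), hD]
      ring
    rw [e1, hE, ← Real.exp_add]
    apply Real.exp_le_exp.2
    have h1 : (6 * h + 18 : ℝ) * Real.log 2 ≤ (6 * h + 18) * 0.7 :=
      mul_le_mul_of_nonneg_left (by linarith) (by positivity)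
    have h2 : (n:ℝ) * 0.693 ≤ n * Real.log 2 :=
      mul_le_mul_of_nonneg_left (by linarith) (by positivity)
    linarith
  have hDE : 0 < D * E := by positivity
  by_cases hk0 : k = 0
  · refine ⟨hk0, ?_⟩
    by_contra hl0
    have h1 : (1:ℝ) ≤ |(l:ℝ)| := by exact_mod_cast Int.one_le_abs hl0
    rw [hk0] at H
    simp only [Int.cast_zero, zero_mul, zero_sub, abs_neg, abs_mul] at H
    rw [← abs_mul, abs_of_pos (by positivity : 0 < (n:ℝ) * Real.log 2)] at H
    have h2 : (n:ℝ) * 0.693 ≤ n * Real.log 2 :=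
      mul_le_mul_of_nonneg_left (by linarith) (by positivity)
    have h3 : Real.exp (-((n:ℝ) / 5)) ≤ 1 := Real.exp_le_one_iff.2 (by linarith)
    have h4 : 1 * ((n:ℝ) * Real.log 2) ≤ |(l:ℝ)| * (n * Real.log 2) :=
      mul_le_mul_of_nonneg_right h1 (by positivity)
    linarith
  · exfalso
    have hkl : ∀ m : ℤ, |m| ≤ 3 * X + 1 → |m| ≤ 2 ^ (6 * h + 14) := by
      intro m hm
      have h1 : (X:ℤ) + 1 ≤ 2 ^ (6 * h + 12) := by exact_mod_cast hX
      have e : (2:ℤ) ^ (6 * h + 14) = 4 * 2 ^ (6 * h + 12) := by ring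
      rw [e]
      have : (0:ℤ) ≤ X := Int.natCast_nonneg _
      linarith
    refine P5_final n h hh hn1 hn2 k l hk0 (hkl k hk) (hkl l hl) ?_
    have hA := E9_logA n hn
    have hkR : |(k:ℝ)| ≤ 4 * D := by
      have : |(k:ℝ)| ≤ 3 * X + 1 := by exact_mod_cast hk
      linarith
    have hφ : Real.exp (-(n * Real.log Real.goldenRatio)) ≤ E := by
      apply Real.exp_le_exp.2
      have h2 := Z10_theta
      have h9 := mul_le_mul_of_nonneg_left h2.1.le (by linarith : (0:ℝ) ≤ n)
      have : 0 < (n:ℝ) * Real.log 2 := by positivity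
      linarith
    have e : (k:ℝ) * (n * Real.log Real.goldenRatio - Real.log (Real.sqrt 5)) - n * l * Real.log 2 =
        ((k:ℝ) * Real.log (Nat.fib n) - l * (n * Real.log 2)) -
        k * (Real.log (Nat.fib n) - (n * Real.log Real.goldenRatio - Real.log (Real.sqrt 5))) := by
      ring
    rw [e]
    refine (abs_sub _ _).trans ?_
    rw [abs_mul]
    have : |(k:ℝ)| * |Real.log (Nat.fib n : ℝ) - (n * Real.log Real.goldenRatio - Real.log (Real.sqrt 5))|
        ≤ 4 * D * (2 * E) :=
      mul_le_mul hkR (by linarith) (abs_nonneg _) (by linarith)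
    linarith

theorem E10_y (a0 a1 c : ℝ) (h : a0 < a1) (x y e : ℤ) (he : e = 1 ∨ e = -1) (hy : 2 ≤ |y|)
    (h0 : (x:ℝ) - a0 * y = e * (a0 - c)) (h1 : (x:ℝ) - a1 * y = e * (a1 - c)) : False := by
  have h2 : (a1 - a0) * ((y:ℝ) + e) = 0 := by linarith
  have h3 : (y:ℝ) + e = 0 := (mul_eq_zero.1 h2).resolve_left (by linarith)
  have h4 : y + e = 0 := by exact_mod_cast h3
  rcases he with rfl | rfl
  · have : y = -1 := by omega
    subst this; norm_num at hy
  · have : y = 1 := by omega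
    subst this; norm_num at hy

theorem E10_mulb (a p q δ X : ℝ) (ha : |a| ≤ X) (h : |p - q| ≤ δ) :
    -(X * δ) ≤ a * p - a * q ∧ a * p - a * q ≤ X * δ := by
  rw [← abs_le, ← mul_sub, abs_mul]
  exact mul_le_mul ha h (abs_nonneg _) ((abs_nonneg _).trans ha)

theorem E10_ysq (A B : ℤ) (hA : 100 ≤ A) (hAB : 100 * A ≤ B) (y : ℤ) (hy : A * B ≤ 8 * |y|) :
    2 / (y:ℝ) ^ 2 ≤ A / (8 * B) ∧ 2 / (y:ℝ) ^ 2 ≤ 1 / 2 := by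
  have hA' : (100:ℝ) ≤ A := by exact_mod_cast hA
  have hB' : (100:ℝ) * A ≤ B := by exact_mod_cast hAB
  have hy' : (A:ℝ) * B ≤ 8 * |(y:ℝ)| := by exact_mod_cast hy
  have hB2 : (10000:ℝ) ≤ B := by linarith
  have h0 : (100:ℝ) * B ≤ A * B := mul_le_mul_of_nonneg_right hA' (by linarith)
  have h1 : (12 * B : ℝ) ≤ |(y:ℝ)| := by linarith
  have h2 : (144 * (B * B) : ℝ) ≤ (y:ℝ) ^ 2 := by
    rw [← sq_abs]
    nlinarith
  have h3 : (16 * B:ℝ) ≤ (y:ℝ) ^ 2 := by nlinarith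
  have hp : 0 < (y:ℝ) ^ 2 := by linarith
  constructor
  · rw [div_le_div_iff₀ hp (by linarith)]
    nlinarith
  · rw [div_le_div_iff₀ hp (by norm_num)]
    linarith

end

section
open Finset

theorem E11_type1 (n : ℕ) (hn : 1000 < n) (A B : ℤ) (hA : 100 ≤ A) (hAB : 100 * A ≤ B)
    (hAn : (A:ℝ) = Nat.fib n) (hB : (B:ℝ) = 2 ^ n) (α : Fin 3 → ℝ)
    (hord : α 0 < α 1 ∧ α 1 < α 2) (hroot : ∀ i, α i * (α i - A) * (α i - B) = 1) (x y : ℤ)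
    (h : x * (x - A * y) * (x - B * y) - y ^ 3 = 1 ∨ x * (x - A * y) * (x - B * y) - y ^ 3 = -1)
    (hy : 2 ≤ |y|) (hh : ℕ) (h49 : 49 ≤ hh) (hn1 : 2 ^ hh ≤ n) (hn2 : n < 2 ^ (hh + 1))
    (hmin : ∀ i, |(x:ℝ) - α 0 * y| ≤ |(x:ℝ) - α i * y|) : False := by
  obtain ⟨hyAB, e, a, b, X, he, hrep, ha, hb, hT, hX⟩ :=
    E8_master n hn A B hA hAB hB α hord hroot x y h hy (Equiv.refl _) hmin
  simp only [Equiv.refl_apply] at hT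
  have hA' : (100:ℝ) ≤ A := by exact_mod_cast hA
  have hAB' : (100:ℝ) * A ≤ B := by exact_mod_cast hAB
  have hX1 : X < 2 ^ (6 * hh + 12) := by
    have := hX (2 * hh + 4) (E9_ht1 n hh h49 hn2)
    rwa [show 3 * (2 * hh + 4) = 6 * hh + 12 by ring] at this
  obtain ⟨⟨l0, l1, l2⟩, ⟨m0, m1, m2⟩, q1, q2, q3⟩ :=
    E1_logs A B _ _ _ hA' hAB' hord.1 hord.2 (hroot 0) (hroot 1) (hroot 2)
  have hys := (E10_ysq A B hA hAB y hyAB).1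
  have hB0 : (0:ℝ) < B := by linarith
  have haR : |(a:ℝ)| ≤ X := by exact_mod_cast ha
  have hbR : |(b:ℝ)| ≤ X := by exact_mod_cast hb
  have hv : Real.log (B:ℝ) = n * Real.log 2 := by rw [hB, Real.log_pow]
  have a1 := E10_mulb a _ _ _ X haR l1
  have a2 := E10_mulb a _ _ _ X haR l2
  rw [← sub_neg_eq_add] at m1
  have b1 := E10_mulb b _ _ _ X hbR m1
  have b2 := E10_mulb b _ _ _ X hbR m2
  have hys2 : 2 / (y:ℝ) ^ 2 ≤ 8 * A / B := by
    refine hys.trans ?_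
    rw [div_le_div_iff₀ (by linarith) hB0]
    nlinarith [mul_pos (by linarith : (0:ℝ) < A) hB0]
  rw [abs_le] at hT q1 q2 q3
  have hkl := E10_core n hh h49 hn1 hn2 X hX1 (a - 1 - b) (a - 1 + 2 * b)
    (by rw [abs_le] at *; omega) (by rw [abs_le] at *; omega) (by
      rw [← hAn, ← hB, ← hv]
      push_cast
      rw [abs_le]
      constructor <;> linarith)
  obtain rfl : b = 0 := by omega
  obtain rfl : a = 1 := by omega
  have h0 := hrep 0
  have h1 := hrep 1
  simp only [zpow_one, zpow_zero, mul_one] at h0 h1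
  exact E10_y (α 0) (α 1) 0 hord.1 x y e he hy (by rw [h0, sub_zero]) (by rw [h1, sub_zero])

theorem E11_type2 (n : ℕ) (hn : 1000 < n) (A B : ℤ) (hA : 100 ≤ A) (hAB : 100 * A ≤ B)
    (hAn : (A:ℝ) = Nat.fib n) (hB : (B:ℝ) = 2 ^ n) (α : Fin 3 → ℝ)
    (hord : α 0 < α 1 ∧ α 1 < α 2) (hroot : ∀ i, α i * (α i - A) * (α i - B) = 1) (x y : ℤ)
    (h : x * (x - A * y) * (x - B * y) - y ^ 3 = 1 ∨ x * (x - A * y) * (x - B * y) - y ^ 3 = -1)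
    (hy : 2 ≤ |y|) (hh : ℕ) (h49 : 49 ≤ hh) (hn1 : 2 ^ hh ≤ n) (hn2 : n < 2 ^ (hh + 1))
    (hmin : ∀ i, |(x:ℝ) - α 1 * y| ≤ |(x:ℝ) - α i * y|) : False := by
  have s0 : (Equiv.swap (0 : Fin 3) 1) 0 = 1 := by decide
  have s1 : (Equiv.swap (0 : Fin 3) 1) 1 = 0 := by decide
  have s2 : (Equiv.swap (0 : Fin 3) 1) 2 = 2 := by decide
  obtain ⟨hyAB, e, a, b, X, he, hrep, ha, hb, hT, hX⟩ :=
    E8_master n hn A B hA hAB hB α hord hroot x y h hy (Equiv.swap 0 1) (by rw [s0]; exact hmin)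
  rw [s0, s1, s2] at hT
  have hA' : (100:ℝ) ≤ A := by exact_mod_cast hA
  have hAB' : (100:ℝ) * A ≤ B := by exact_mod_cast hAB
  have hX1 : X < 2 ^ (6 * hh + 12) := by
    have := hX (2 * hh + 4) (E9_ht1 n hh h49 hn2)
    rwa [show 3 * (2 * hh + 4) = 6 * hh + 12 by ring] at this
  obtain ⟨⟨l0, l1, l2⟩, ⟨m0, m1, m2⟩, q1, q2, q3⟩ :=
    E1_logs A B _ _ _ hA' hAB' hord.1 hord.2 (hroot 0) (hroot 1) (hroot 2)
  rw [← Real.log_neg_eq_log, neg_sub] at q1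
  have hys := (E10_ysq A B hA hAB y hyAB).1
  have hB0 : (0:ℝ) < B := by linarith
  have haR : |(a:ℝ)| ≤ X := by exact_mod_cast ha
  have hbR : |(b:ℝ)| ≤ X := by exact_mod_cast hb
  have hv : Real.log (B:ℝ) = n * Real.log 2 := by rw [hB, Real.log_pow]
  rw [← sub_neg_eq_add] at l0
  have a1 := E10_mulb a _ _ _ X haR l0
  have a2 := E10_mulb a _ _ _ X haR l2
  have b1 := E10_mulb b _ _ _ X hbR m0
  have b2 := E10_mulb b _ _ _ X hbR m2
  have hys2 : 2 / (y:ℝ) ^ 2 ≤ 8 * A / B := by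
    refine hys.trans ?_
    rw [div_le_div_iff₀ (by linarith) hB0]
    nlinarith [mul_pos (by linarith : (0:ℝ) < A) hB0]
  rw [abs_le] at hT q1 q2 q3
  have hkl := E10_core n hh h49 hn1 hn2 X hX1 (b - a - 1) (2 * a + b - 1)
    (by rw [abs_le] at *; omega) (by rw [abs_le] at *; omega) (by
      rw [← hAn, ← hB, ← hv]
      push_cast
      rw [abs_le]
      constructor <;> linarith)
  obtain rfl : a = 0 := by omega
  obtain rfl : b = 1 := by omega
  have h0 := hrep 0
  have h1 := hrep 1
  simp only [zpow_one, zpow_zero, mul_one] at h0 h1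
  exact E10_y (α 0) (α 1) A hord.1 x y e he hy h0 h1

end

section
open Finset

theorem E12_logs (A B a0 a1 a2 : ℝ) (hA : 100 ≤ A) (hAB : 100 * A ≤ B) (h01 : a0 < a1)
    (h12 : a1 < a2)
    (r0 : a0 * (a0 - A) * (a0 - B) = 1) (r1 : a1 * (a1 - A) * (a1 - B) = 1)
    (r2 : a2 * (a2 - A) * (a2 - B) = 1) :
    A / (2 * B) ≤ Real.log (B - a0) - Real.log (B - a1) ∧
    Real.log (B - a0) - Real.log (B - a1) ≤ 2 * A / B ∧
    |(Real.log (a2 - a0) - Real.log (a2 - a1)) - (Real.log (B - a0) - Real.log (B - a1))| ≤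
      4 / B ^ 3 := by
  obtain ⟨p0, p0', p1, p1', p2, p2'⟩ := E1_roots A B a0 a1 a2 hA hAB h01 h12 r0 r1 r2
  have hB : 10000 ≤ B := by linarith
  have hB0 : 0 < B := by linarith
  have hs : 4 / (A * B) ≤ 1 := by
    rw [div_le_one (by nlinarith)]
    nlinarith
  have g0 : B / 2 ≤ B - a0 := by linarith
  have g1 : B / 2 ≤ B - a1 := by linarith
  have lub : ∀ p q : ℝ, 0 < p → 0 < q → Real.log p - Real.log q ≤ (p - q) / q := by
    intro p q hp hq
    rw [← Real.log_div hp.ne' hq.ne']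
    have := Real.log_le_sub_one_of_pos (div_pos hp hq)
    have e : (p - q) / q = p / q - 1 := by field_simp
    linarith
  have hc1 := lub (B - a0) (B - a1) (by linarith) (by linarith)
  have hc2 := lub (B - a1) (B - a0) (by linarith) (by linarith)
  have hd0 := lub (a2 - a0) (B - a0) (by linarith) (by linarith)
  have hd1 := lub (a2 - a1) (B - a1) (by linarith) (by linarith)
  have he0 := Real.log_le_log (by linarith : 0 < B - a0) (by linarith : B - a0 ≤ a2 - a0)
  have he1 := Real.log_le_log (by linarith : 0 < B - a1) (by linarith : B - a1 ≤ a2 - a1)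
  have aux : ∀ d : ℝ, B / 2 ≤ d → (a2 - B) / d ≤ 4 / B ^ 3 := by
    intro d hd
    calc (a2 - B) / d ≤ (2 / B ^ 2) / (B / 2) :=
          div_le_div₀ (by positivity) p2' (by positivity) hd
      _ = 4 / B ^ 3 := by field_simp; norm_num
  have f0 := aux _ g0
  have f1 := aux _ g1
  refine ⟨?_, ?_, ?_⟩
  · have : A / (2 * B) ≤ (a1 - a0) / (B - a0) := by
      calc A / (2 * B) = (A / 2) / B := by field_simp
        _ ≤ (a1 - a0) / (B - a0) :=
          div_le_div₀ (by linarith) (by linarith) (by linarith) (by linarith)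
    have e : (B - a1 - (B - a0)) / (B - a0) = - ((a1 - a0) / (B - a0)) := by ring
    linarith
  · have : (a1 - a0) / (B - a1) ≤ 2 * A / B := by
      calc (a1 - a0) / (B - a1) ≤ A / (B / 2) :=
            div_le_div₀ (by linarith) (by linarith) (by linarith) (by linarith)
        _ = 2 * A / B := by field_simp
    have e : (B - a0 - (B - a1)) / (B - a1) = (a1 - a0) / (B - a1) := by ring
    linarith
  · have e0 : (a2 - a0 - (B - a0)) / (B - a0) = (a2 - B) / (B - a0) := by ring
    have e1 : (a2 - a1 - (B - a1)) / (B - a1) = (a2 - B) / (B - a1) := by ring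
    rw [abs_le]
    constructor <;> linarith

set_option maxHeartbeats 1000000 in
theorem E12_type3 (n : ℕ) (hn : 1000 < n) (A B : ℤ) (hA : 100 ≤ A) (hAB : 100 * A ≤ B)
    (hAn : (A:ℝ) = Nat.fib n) (hB : (B:ℝ) = 2 ^ n) (α : Fin 3 → ℝ)
    (hord : α 0 < α 1 ∧ α 1 < α 2) (hroot : ∀ i, α i * (α i - A) * (α i - B) = 1) (x y : ℤ)
    (h : x * (x - A * y) * (x - B * y) - y ^ 3 = 1 ∨ x * (x - A * y) * (x - B * y) - y ^ 3 = -1)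
    (hy : 2 ≤ |y|)
    (hmin : ∀ i, |(x:ℝ) - α 2 * y| ≤ |(x:ℝ) - α i * y|) : False := by
  obtain ⟨π, s0, s1, s2⟩ : ∃ π : Equiv.Perm (Fin 3), π 0 = 2 ∧ π 1 = 0 ∧ π 2 = 1 :=
    ⟨Equiv.swap 0 1 * Equiv.swap 0 2, by decide, by decide, by decide⟩
  obtain ⟨hyAB, e, a, b, X, he, hrep, ha, hb, hT, hX⟩ :=
    E8_master n hn A B hA hAB hB α hord hroot x y h hy π (by rw [s0]; exact hmin)
  rw [s0, s1, s2] at hT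
  have hA' : (100:ℝ) ≤ A := by exact_mod_cast hA
  have hAB' : (100:ℝ) * A ≤ B := by exact_mod_cast hAB
  have hX1 := hX (n / 11) (E9_ht3 n hn)
  obtain ⟨⟨l0, l1, -⟩, -, -⟩ :=
    E1_logs A B _ _ _ hA' hAB' hord.1 hord.2 (hroot 0) (hroot 1) (hroot 2)
  obtain ⟨c1, c2, c3⟩ :=
    E12_logs A B _ _ _ hA' hAB' hord.1 hord.2 (hroot 0) (hroot 1) (hroot 2)
  obtain ⟨hys, hys2⟩ := E10_ysq A B hA hAB y hyAB
  have hB0 : (0:ℝ) < B := by linarith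
  have hA0 : (0:ℝ) < A := by linarith
  have hbR : |(b:ℝ)| ≤ X := by exact_mod_cast hb
  have hne := E3_ne A B α hroot
  have hl : ∀ i, Real.log (α i - A) = - Real.log (α i) - Real.log (B - α i) := by
    intro i
    obtain ⟨n1, n2, n3⟩ := hne i
    have h1 := congrArg Real.log (hroot i)
    rw [Real.log_mul (mul_ne_zero n1 n2) n3, Real.log_mul n1 n2, Real.log_one,
      ← Real.log_neg_eq_log (α i - B), neg_sub] at h1
    linarith
  rw [hl 0, hl 1, ← Real.log_neg_eq_log (α 1 - α 2), ← Real.log_neg_eq_log (α 0 - α 2),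
    neg_sub, neg_sub] at hT
  set c := Real.log (B - α 0) - Real.log (B - α 1) with hc
  set c' := Real.log (α 2 - α 0) - Real.log (α 2 - α 1) with hc'
  set L := Real.log (α 1) - Real.log (α 0) with hL
  have hT' : |(b - a : ℝ) * L - b * c - c'| ≤ 2 / (y:ℝ) ^ 2 := by
    convert hT using 2
    rw [hc, hc', hL]
    ring
  have h4 : 4 / (B:ℝ) ^ 3 ≤ A / (8 * B) := by
    rw [div_le_div_iff₀ (by positivity) (by positivity)]
    have : (32:ℝ) ≤ A * B ^ 2 := by nlinarith [sq_nonneg (B:ℝ)]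
    nlinarith
  have hc0 : 0 < A / (2 * (B:ℝ)) := by positivity
  have hcp : 0 < c := by linarith
  have e8 : A / (8 * (B:ℝ)) = (A / (2 * (B:ℝ))) / 4 := by field_simp; norm_num
  rw [e8] at h4 hys
  by_cases hab : a = b
  · subst hab
    have hb1 : a = -1 := by
      by_contra hne1
      have h5 : (1:ℝ) ≤ |(a:ℝ) + 1| := by
        exact_mod_cast Int.one_le_abs (by omega : a + 1 ≠ 0)
      have h6 : |((a:ℝ) + 1) * c| ≤ 2 / (y:ℝ) ^ 2 + 4 / (B:ℝ) ^ 3 := by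
        rw [sub_self, zero_mul] at hT'
        rw [abs_le] at hT' c3 ⊢
        constructor <;> linarith
      rw [abs_mul, abs_of_pos hcp] at h6
      have := mul_le_mul_of_nonneg_right h5 hcp.le
      linarith
    subst hb1
    have hr : ∀ i, (x:ℝ) - α i * y = e * (α i - B) := by
      intro i
      obtain ⟨n1, n2, n3⟩ := hne i
      rw [hrep i, zpow_neg_one, zpow_neg_one, mul_assoc, ← mul_inv]
      congr 1
      exact inv_eq_of_mul_eq_one_right (hroot i)
    exact E10_y (α 0) (α 1) B hord.1 x y e he hy (hr 0) (hr 1)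
  · have h5 : (1:ℝ) ≤ |(b:ℝ) - a| := by
      exact_mod_cast Int.one_le_abs (by omega : b - a ≠ 0)
    have hd : (A:ℝ) / B ≤ 1 / 100 := by rw [div_le_div_iff₀ hB0 (by norm_num)]; linarith
    have e1 : 8 * (A:ℝ) / B = 8 * (A / B) := by ring
    have e2 : 2 * (A:ℝ) / B = 2 * (A / B) := by ring
    have e3 : (A:ℝ) / (2 * B) = (A / B) / 2 := by field_simp
    rw [e1] at l0 l1
    rw [e2] at c2
    rw [e3] at h4
    have hlog : ∀ t : ℝ, 100 ≤ t → 1 ≤ Real.log t := by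
      intro t ht
      rw [Real.le_log_iff_exp_le (by linarith)]
      linarith [Real.exp_one_lt_d9]
    have hLA := hlog A hA'
    have hLB := hlog B (by linarith)
    rw [abs_le] at l0 l1
    have hL2 : 2 ≤ L := by rw [hL]; linarith
    have h6 : 2 ≤ |(b:ℝ) - a| * |L| := by
      rw [abs_of_pos (by linarith : 0 < L)]
      have := mul_le_mul h5 hL2 (by norm_num) (abs_nonneg _)
      linarith
    rw [← abs_mul] at h6
    have h7 : |(b:ℝ) * c| ≤ X * (2 * (A / B)) := by
      rw [abs_mul, abs_of_pos hcp]
      exact mul_le_mul hbR c2 hcp.le (Nat.cast_nonneg _)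
    have h8 : |c'| ≤ 1 / 4 := by
      rw [abs_le] at c3 ⊢
      constructor <;> linarith
    have h9 : (2:ℝ) ≤ 1 / 2 + X * (2 * (A / B)) + 1 / 4 := by
      have e : (b - a : ℝ) * L = ((b - a : ℝ) * L - b * c - c') + b * c + c' := by ring
      have := (abs_add_three ((b - a : ℝ) * L - b * c - c') (b * c) c')
      rw [← e] at this
      linarith
    have h10 := E10_AoB n hn
    rw [← hAn, ← hB] at h10
    have hn' : (1001:ℝ) ≤ n := by exact_mod_cast hn
    have h11 : 2 * (X:ℝ) ≤ Real.exp ((3 * n / 11 + 1) * Real.log 2) := by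
      have h12 : (X:ℝ) ≤ 2 ^ (3 * (n / 11)) := by exact_mod_cast hX1.le
      have h13 : 2 * (2:ℝ) ^ (3 * (n / 11)) = Real.exp (((3 * (n / 11) + 1 : ℕ) : ℝ) * Real.log 2) := by
        rw [Real.exp_nat_mul, Real.exp_log (by norm_num)]
        ring
      have h14 : Real.exp (((3 * (n / 11) + 1 : ℕ) : ℝ) * Real.log 2) ≤
          Real.exp ((3 * n / 11 + 1) * Real.log 2) := by
        apply Real.exp_le_exp.2
        apply mul_le_mul_of_nonneg_right _ (Real.log_nonneg (by norm_num))
        push_cast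
        have : ((n / 11 : ℕ) : ℝ) ≤ n / 11 := by exact_mod_cast Nat.cast_div_le
        linarith
      linarith
    have h15 : 2 * (X:ℝ) * (A / B) ≤ 1 := by
      calc 2 * (X:ℝ) * (A / B) ≤ Real.exp ((3 * n / 11 + 1) * Real.log 2) *
            Real.exp (-(48 / 157 * (n * Real.log 2))) :=
            mul_le_mul h11 h10 (by positivity) (Real.exp_pos _).le
        _ ≤ 1 := by
          rw [← Real.exp_add]
          apply Real.exp_le_one_iff.2
          have lg := Real.log_two_gt_d9
          have := mul_le_mul hn' lg.le (by norm_num) (by linarith)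
          have := Real.log_two_lt_d9
          linarith
    linarith

end

/-- For `n > 1000`, no solution `(x, y)` with `|y| ≥ 2` has type `3`
(i.e. `|β⁽³⁾|` is not minimal among the `|β⁽ⁱ⁾|`), and if the type is `1` or `2`,
then `n < 1.03 · 10¹⁵`. -/
theorem absolute_bound_n (n : ℕ) (hn : 1000 < n)
    (α : Fin 3 → ℝ)
    (hord : α 0 < α 1 ∧ α 1 < α 2)
    (hroot : ∀ i, α i * (α i - (Nat.fib n : ℝ)) * (α i - 2 ^ n) - 1 = 0)
    (x y : ℤ)
    (heq : x * (x - (Nat.fib n : ℤ) * y) * (x - 2 ^ n * y) - y ^ 3 = 1 ∨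
           x * (x - (Nat.fib n : ℤ) * y) * (x - 2 ^ n * y) - y ^ 3 = -1)
    (hy : 2 ≤ |y|)
    (β : Fin 3 → ℝ) (hβ : ∀ i, β i = (x : ℝ) - α i * (y : ℝ)) :
    ¬ (∀ i, |β 2| ≤ |β i|) ∧
    (∀ j : Fin 3, (j = 0 ∨ j = 1) → (∀ i, |β j| ≤ |β i|) →
      (n : ℝ) < 1.03e15) := by
  obtain ⟨hA, hAB⟩ := E9_AB n hn
  have hAn : (((Nat.fib n : ℤ)) : ℝ) = Nat.fib n := by push_cast; rfl
  have hB : (((2 ^ n : ℤ)) : ℝ) = 2 ^ n := by push_cast; rfl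
  have hroot' : ∀ i, α i * (α i - ((Nat.fib n : ℤ) : ℝ)) * (α i - ((2 ^ n : ℤ) : ℝ)) = 1 := by
    intro i
    rw [hAn, hB]
    linarith [hroot i]
  refine ⟨fun hmin => ?_, fun j hj hmin => ?_⟩
  · simp only [hβ] at hmin
    exact E12_type3 n hn _ _ hA hAB hAn hB α hord hroot' x y heq hy hmin
  · by_contra hbig
    have hbig1 : (1030000000000000 : ℝ) ≤ n := by
      rw [not_lt] at hbig
      norm_num at hbig ⊢
      exact hbig
    have hbig2 : 1030000000000000 ≤ n := by exact_mod_cast hbig1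
    have h49 : 49 ≤ Nat.log 2 n := by
      apply Nat.le_log_of_pow_le (by norm_num)
      refine le_trans ?_ hbig2
      norm_num
    have hn1 : 2 ^ Nat.log 2 n ≤ n := Nat.pow_log_le_self 2 (by omega)
    have hn2 : n < 2 ^ (Nat.log 2 n + 1) := Nat.lt_pow_succ_log_self (by norm_num) n
    simp only [hβ] at hmin
    rcases hj with rfl | rfl
    · exact E11_type1 n hn _ _ hA hAB hAn hB α hord hroot' x y heq hy _ h49 hn1 hn2 hmin
    · exact E11_type2 n hn _ _ hA hAB hAn hB α hord hroot' x y heq hy _ h49 hn1 hn2 hmin
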